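/- Let n ≥ 1 and let Û ⊆ Sⁿ be a connected open subset of the unit sphere in ℝ^{n+1}. Let f̃ : Sⁿ → ℝ be measurable with 0 < λ ≤ f̃ ≤ Λ, and let F̃ : Sⁿ × (0,∞) → ℝ and G̃ : Sⁿ × (0,∞) → ℝ be positive Lipschitz functions. Let K₁ ⊆ K₂ be convex bodies in ℝ^{n+1} with 0 in the interior of K₁, whose boundaries are C¹ and strictly convex, and suppose that for every Borel set E ⊆ Û: σ(α_{K₁}(E)) ≤ ∫_E f̃(θ)·F̃(θ, ρ_{K₁}(θ)) / G̃(α_{K₁}(θ), h_{K₁}(α_{K₁}(θ))) dσ(θ) and σ(α_{K₂}(E)) ≥ ∫_E f̃(θ)·F̃(θ, ρ_{K₂}(θ)) / G̃(α_{K₂}(θ), h_{K₂}(α_{K₂}(θ))) dσ(θ). If there exists θ₀ ∈ Û with ρ_{K₁}(θ₀) = ρ_{K₂}(θ₀), then ρ_{K₁}(θ) = ρ_{K₂}(θ) for all θ ∈ Û. -/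

import Mathlib

open MeasureTheory Set
open scoped RealInnerProductSpace ENNReal Pointwise

noncomputable section

/-- The ambient Euclidean space `ℝ^{n+1}`. -/
abbrev Es (n : ℕ) := EuclideanSpace ℝ (Fin (n + 1))

/-- The unit sphere `Sⁿ ⊆ ℝ^{n+1}`. -/
def unitSphere (n : ℕ) : Set (Es n) := Metric.sphere (0 : Es n) 1

/-- The radial function `ρ_K(θ) = max {s > 0 : sθ ∈ K}` of a convex body `K`. -/
def radialFn {n : ℕ} (K : Set (Es n)) (θ : Es n) : ℝ :=
  sSup {s : ℝ | 0 < s ∧ s • θ ∈ K}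

/-- The support function `h_K(ξ) = sup_{x ∈ K} x·ξ` of a convex body `K`. -/
def supportFn {n : ℕ} (K : Set (Es n)) (ξ : Es n) : ℝ :=
  sSup ((fun x => ⟪x, ξ⟫) '' K)

/-- The normal cone `N_K(x) = {ξ ∈ Sⁿ : (y − x)·ξ ≤ 0 for all y ∈ K}`. -/
def normalCone {n : ℕ} (K : Set (Es n)) (x : Es n) : Set (Es n) :=
  {ξ | ‖ξ‖ = 1 ∧ ∀ y ∈ K, ⟪y - x, ξ⟫ ≤ 0}

/-- The Gauss image map `α_K(A) = ⋃_{θ ∈ A} N_K(ρ_K(θ)θ)`. -/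
def gaussImage {n : ℕ} (K : Set (Es n)) (A : Set (Es n)) : Set (Es n) :=
  ⋃ θ ∈ A, normalCone K ((radialFn K θ) • θ)

/-- The inverse Gauss image map `α*_K(ω) = {θ ∈ Sⁿ : α_K({θ}) ∩ ω ≠ ∅}`. -/
def gaussImageInv {n : ℕ} (K : Set (Es n)) (ω : Set (Es n)) : Set (Es n) :=
  {θ ∈ unitSphere n | (gaussImage K {θ} ∩ ω).Nonempty}

/-- The spherical Lebesgue (surface) measure on `Sⁿ`, realized as the `n`-dimensional
Hausdorff measure on `ℝ^{n+1}`. -/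
def sphMeasure (n : ℕ) : Measure (Es n) := μH[(n : ℝ)]

section

open Filter Topology Metric Module

section Subgradient

variable {V : Type*} [NormedAddCommGroup V] [InnerProductSpace ℝ V]

/-- `q` selects a subgradient of `u` at every point. -/
def IsSubgradientMap (u : V → ℝ) (q : V → V) : Prop :=
  ∀ x y, u x + ⟪q x, y - x⟫ ≤ u y

/-- `q` selects a subgradient of `u` at every point, and each supporting affine function touches
the graph of `u` only once. -/
def IsStrictSubgradientMap (u : V → ℝ) (q : V → V) : Prop :=
  ∀ x y, x ≠ y → u x + ⟪q x, y - x⟫ < u y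

theorem IsStrictSubgradientMap.isSubgradientMap {u : V → ℝ} {q : V → V}
    (h : IsStrictSubgradientMap u q) : IsSubgradientMap u q := by
  intro x y
  by_cases hxy : x = y
  · simp [hxy]
  · exact (h x y hxy).le

theorem IsSubgradientMap.monotone {u : V → ℝ} {q : V → V} (h : IsSubgradientMap u q) (x y : V) :
    0 ≤ ⟪q x - q y, x - y⟫ := by
  have h1 := h x y
  have h2 := h y x
  have h3 : ⟪q x, y - x⟫ = - ⟪q x, x - y⟫ := by rw [← inner_neg_right, neg_sub]
  rw [inner_sub_left]
  linarith

theorem IsStrictSubgradientMap.injective {u : V → ℝ} {q : V → V}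
    (h : IsStrictSubgradientMap u q) : Function.Injective q := by
  intro x y hxy
  by_contra hne
  have h1 := h x y hne
  have h2 := h y x (Ne.symm hne)
  have h3 : ⟪q x, y - x⟫ = - ⟪q x, x - y⟫ := by rw [← inner_neg_right, neg_sub]
  rw [← hxy] at h2
  linarith

theorem IsSubgradientMap.hasFDerivAt {u : V → ℝ} {q : V → V} (h : IsSubgradientMap u q)
    (hq : Continuous q) (x : V) : HasFDerivAt u (innerSL ℝ (q x)) x := by
  rw [hasFDerivAt_iff_isLittleO, Asymptotics.isLittleO_iff]
  intro c hc
  have h1 : ∀ᶠ y in 𝓝 x, ‖q y - q x‖ < c := by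
    have : Tendsto (fun y => ‖q y - q x‖) (𝓝 x) (𝓝 ‖q x - q x‖) :=
      ((hq.sub continuous_const).norm).tendsto x
    rw [sub_self, norm_zero] at this
    exact this.eventually_lt_const hc
  filter_upwards [h1] with y hy
  have h2 := h x y
  have h3 := h y x
  have h4 : ⟪q y, x - y⟫ = - ⟪q y, y - x⟫ := by rw [← inner_neg_right, neg_sub]
  have h5 : ⟪q y - q x, y - x⟫ ≤ ‖q y - q x‖ * ‖y - x‖ := real_inner_le_norm _ _
  have h6 : ‖q y - q x‖ * ‖y - x‖ ≤ c * ‖y - x‖ := by gcongr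
  rw [inner_sub_left] at h5
  rw [innerSL_apply_apply, Real.norm_eq_abs, abs_le]
  constructor <;> nlinarith [norm_nonneg (y - x)]

theorem IsSubgradientMap.continuous {u : V → ℝ} {q : V → V} (h : IsSubgradientMap u q)
    (hq : Continuous q) : Continuous u :=
  continuous_iff_continuousAt.2 fun x => (h.hasFDerivAt hq x).continuousAt

end Subgradient

section Determinant

variable {V : Type*} [NormedAddCommGroup V] [InnerProductSpace ℝ V] [FiniteDimensional ℝ V]

theorem prod_one_sub_rpow_add_le {ι : Type*} [Fintype ι] [Nonempty ι] (μ : ι → ℝ)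
    (h0 : ∀ i, 0 ≤ μ i) (h1 : ∀ i, μ i ≤ 1) :
    (∏ i, (1 - μ i)) ^ ((Fintype.card ι : ℝ)⁻¹) + (∏ i, μ i) ^ ((Fintype.card ι : ℝ)⁻¹) ≤ 1 := by
  have hc : (0 : ℝ) < Fintype.card ι := by exact_mod_cast Fintype.card_pos
  have key : ∀ z : ι → ℝ, (∀ i, 0 ≤ z i) →
      (∏ i, z i) ^ ((Fintype.card ι : ℝ)⁻¹) ≤ ∑ i, (Fintype.card ι : ℝ)⁻¹ * z i := by
    intro z hz
    have := Real.geom_mean_le_arith_mean_weighted Finset.univ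
      (fun _ : ι => (Fintype.card ι : ℝ)⁻¹) z (fun _ _ => by positivity)
      (by simp [hc.ne']) (fun i _ => hz i)
    rwa [Real.finsetProd_rpow _ _ (fun i _ => hz i)] at this
  have ha := key (fun i => 1 - μ i) (fun i => by linarith [h1 i])
  have hb := key μ h0
  have hs : ∑ i, (Fintype.card ι : ℝ)⁻¹ * (1 - μ i) + ∑ i, (Fintype.card ι : ℝ)⁻¹ * μ i = 1 := by
    rw [← Finset.sum_add_distrib]
    simp [← mul_add, hc.ne']
  linarith

/-- A form of Minkowski's determinant inequality for the commuting operators `1 - s X` and `X`. -/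
theorem det_mul_le_one_of_firmly_monotone (hN : 0 < finrank ℝ V) {X : V →ₗ[ℝ] V}
    (hX : X.IsSymmetric) {s : ℝ} (hs : 0 < s) (hmono : ∀ z, s * ‖X z‖ ^ 2 ≤ ⟪X z, z⟫)
    {t c γ : ℝ} (ht : 0 < t) (hc : 0 < c) (hγ : 0 ≤ γ) (hγc : γ ≤ c ^ finrank ℝ V)
    (hdet : γ * |LinearMap.det X| ≤ |LinearMap.det (t⁻¹ • (LinearMap.id - s • X))|) :
    (t + s / c) ^ finrank ℝ V * (γ * |LinearMap.det X|) ≤ 1 := by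
  set N := finrank ℝ V with hNdef
  have hNe : Nonempty (Fin N) := ⟨⟨0, hN⟩⟩
  let μ := hX.eigenvalues rfl
  let b := hX.eigenvectorBasis rfl
  have hb : ∀ i, X (b i) = μ i • b i := hX.apply_eigenvectorBasis rfl
  have hnorm : ∀ i, ‖b i‖ = 1 := b.orthonormal.1
  have hμ : ∀ i, s * (μ i) ^ 2 ≤ μ i := by
    intro i
    have := hmono (b i)
    rw [hb, norm_smul, inner_smul_left, real_inner_self_eq_norm_sq, hnorm] at this
    simpa using this
  have hμ0 : ∀ i, 0 ≤ μ i := fun i => le_trans (by positivity) (hμ i)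
  have hμ1 : ∀ i, s * μ i ≤ 1 := by
    intro i
    by_contra hcon
    push Not at hcon
    have hpos : 0 < μ i := by
      rcases (hμ0 i).lt_or_eq with h | h
      · exact h
      · rw [← h] at hcon; norm_num at hcon
    nlinarith [hμ i]
  have hdX : LinearMap.det X = ∏ i, μ i := by
    have := hX.det_eq_prod_eigenvalues rfl
    simpa using this
  have hdY : LinearMap.det (LinearMap.id - s • X) = ∏ i, (1 - s * μ i) := by
    have hm : LinearMap.toMatrix b.toBasis b.toBasis (LinearMap.id - s • X)
        = Matrix.diagonal (fun i => 1 - s * μ i) := by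
      ext i j
      rw [LinearMap.toMatrix_apply]
      simp only [OrthonormalBasis.coe_toBasis, LinearMap.sub_apply, LinearMap.id_apply,
        LinearMap.smul_apply, hb, map_sub, map_smul]
      by_cases hij : i = j
      · subst hij; simp
      · simp [hij]
    rw [← LinearMap.det_toMatrix b.toBasis, hm, Matrix.det_diagonal]
  have hP0 : 0 ≤ ∏ i, μ i := Finset.prod_nonneg fun i _ => hμ0 i
  have hQ0 : 0 ≤ ∏ i, (1 - s * μ i) := Finset.prod_nonneg fun i _ => by linarith [hμ1 i]
  rw [LinearMap.det_smul, hdY, hdX, abs_mul, abs_of_nonneg hP0, abs_of_nonneg hQ0,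
    abs_of_pos (by positivity)] at hdet
  rw [hdX, abs_of_nonneg hP0]
  have hag := prod_one_sub_rpow_add_le (fun i => s * μ i)
      (fun i => by have := hμ0 i; positivity) hμ1
  rw [Finset.prod_mul_distrib, Finset.prod_const, Finset.card_univ, Fintype.card_fin] at hag
  set P := ∏ i, μ i
  set Q := ∏ i, (1 - s * μ i)
  have hNR : (N : ℝ) ≠ 0 := by exact_mod_cast hN.ne'
  rw [Real.mul_rpow (by positivity) hP0, Real.pow_rpow_inv_natCast hs.le hN.ne'] at hag
  have hQ : t * (γ * P) ^ ((N : ℝ)⁻¹) ≤ Q ^ ((N : ℝ)⁻¹) := by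
    have h1 : (t ^ N * (γ * P)) ^ ((N : ℝ)⁻¹) ≤ Q ^ ((N : ℝ)⁻¹) := by
      apply Real.rpow_le_rpow (by positivity) _ (by positivity)
      calc t ^ N * (γ * P) ≤ t ^ N * (t⁻¹ ^ N * Q) := by gcongr
        _ = Q := by rw [← mul_assoc, ← mul_pow, mul_inv_cancel₀ ht.ne', one_pow, one_mul]
    rwa [Real.mul_rpow (by positivity) (by positivity),
      Real.pow_rpow_inv_natCast ht.le hN.ne'] at h1
  have hγ1 : γ ^ ((N : ℝ)⁻¹) ≤ c := by
    calc γ ^ ((N : ℝ)⁻¹) ≤ (c ^ N) ^ ((N : ℝ)⁻¹) := Real.rpow_le_rpow hγ hγc (by positivity)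
      _ = c := Real.pow_rpow_inv_natCast hc.le hN.ne'
  have hfin : (t + s / c) * (γ * P) ^ ((N : ℝ)⁻¹) ≤ 1 := by
    have h2 : s / c * (γ * P) ^ ((N : ℝ)⁻¹) ≤ s * P ^ ((N : ℝ)⁻¹) := by
      rw [Real.mul_rpow hγ hP0]
      have : 0 ≤ P ^ ((N : ℝ)⁻¹) := by positivity
      calc s / c * (γ ^ ((N : ℝ)⁻¹) * P ^ ((N : ℝ)⁻¹))
          ≤ s / c * (c * P ^ ((N : ℝ)⁻¹)) := by gcongr
        _ = s * P ^ ((N : ℝ)⁻¹) := by field_simp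
    linarith
  calc (t + s / c) ^ N * (γ * P) = ((t + s / c) * (γ * P) ^ ((N : ℝ)⁻¹)) ^ N := by
        rw [mul_pow, Real.rpow_inv_natCast_pow (by positivity) hN.ne']
    _ ≤ 1 := pow_le_one₀ (by positivity) hfin

end Determinant

section Resolvent

variable {V : Type*} [NormedAddCommGroup V] [InnerProductSpace ℝ V]

theorem IsSubgradientMap.smul_add_norm_sq {v : V → ℝ} {T : V → V} (h : IsSubgradientMap v T)
    {t s : ℝ} (ht : 0 ≤ t) (hs : 0 ≤ s) :
    IsSubgradientMap (fun x => t * v x + s / 2 * ‖x‖ ^ 2) (fun x => t • T x + s • x) := by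
  intro x y
  have h1 := mul_le_mul_of_nonneg_left (h x y) ht
  have h2 : ‖y‖ ^ 2 = ‖x‖ ^ 2 + 2 * ⟪x, y - x⟫ + ‖y - x‖ ^ 2 := by
    rw [← norm_add_sq_real, add_sub_cancel]
  simp only [inner_add_left, real_inner_smul_left]
  rw [h2]
  nlinarith [mul_nonneg hs (sq_nonneg ‖y - x‖)]

theorem IsSubgradientMap.sub_inner {v : V → ℝ} {T : V → V} (h : IsSubgradientMap v T) (y : V) :
    IsSubgradientMap (fun x => v x - ⟪y, x⟫) (fun x => T x - y) := by
  intro x z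
  have h1 := h x z
  simp only [inner_sub_left, inner_sub_right] at *
  linarith

theorem IsSubgradientMap.eq_zero_of_isLocalMin {u : V → ℝ} {q : V → V} (h : IsSubgradientMap u q)
    (hq : Continuous q) {x : V} (hx : IsLocalMin u x) : q x = 0 := by
  have h1 := hx.hasFDerivAt_eq_zero (h.hasFDerivAt hq x)
  have h2 := congrArg (fun L => L (q x)) h1
  simpa using h2

theorem IsSubgradientMap.surjective_smul_add [FiniteDimensional ℝ V] {v : V → ℝ} {T : V → V}
    (h : IsSubgradientMap v T) (hT : Continuous T) {t s : ℝ} (ht : 0 ≤ t) (hs : 0 < s) :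
    Function.Surjective (fun x => t • T x + s • x) := by
  intro y
  have hφ := (h.smul_add_norm_sq ht hs.le).sub_inner y
  have hcont : Continuous (fun x => (t • T x + s • x) - y) := by fun_prop
  have hev : ∀ᶠ x in cocompact V, 2 * (t * ‖T 0‖ + ‖y‖) / s ≤ ‖x‖ :=
    (tendsto_norm_cocompact_atTop (E := V)).eventually_ge_atTop _
  obtain ⟨x, hx⟩ := (hφ.continuous hcont).exists_forall_le' 0 (by
    filter_upwards [hev] with x hx
    have h1 := mul_le_mul_of_nonneg_left (h 0 x) ht
    have h2 : -(‖T 0‖ * ‖x‖) ≤ ⟪T 0, x⟫ := by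
      have := abs_le.1 (abs_real_inner_le_norm (T 0) x); linarith [this.1]
    have h3 := real_inner_le_norm y x
    rw [sub_zero] at h1
    rw [div_le_iff₀ hs] at hx
    simp only [norm_zero, inner_zero_right]
    have h4 := mul_le_mul_of_nonneg_left h2 ht
    nlinarith [norm_nonneg x])
  refine ⟨x, ?_⟩
  have := hφ.eq_zero_of_isLocalMin hcont (x := x) (Eventually.of_forall hx)
  exact sub_eq_zero.1 this

theorem IsSubgradientMap.mul_norm_sq_le {v : V → ℝ} {T : V → V} (h : IsSubgradientMap v T)
    {t s : ℝ} (ht : 0 ≤ t) (x y : V) :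
    s * ‖x - y‖ ^ 2 ≤ ⟪x - y, (t • T x + s • x) - (t • T y + s • y)⟫ := by
  have h1 := mul_nonneg ht (h.monotone x y)
  have h2 : (t • T x + s • x) - (t • T y + s • y) = t • (T x - T y) + s • (x - y) := by
    simp only [smul_sub]; abel
  rw [h2, inner_add_right, real_inner_smul_right, real_inner_smul_right,
    real_inner_self_eq_norm_sq, real_inner_comm]
  linarith

/-- The data of the resolvent of a continuous gradient map of a convex function. -/
theorem IsSubgradientMap.exists_resolvent [FiniteDimensional ℝ V] {v : V → ℝ} {T : V → V}
    (h : IsSubgradientMap v T) (hT : Continuous T) {t s : ℝ} (ht : 0 ≤ t) (hs : 0 < s) :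
    ∃ J : V → V, (∀ x, J (t • T x + s • x) = x) ∧ (∀ y, t • T (J y) + s • J y = y) ∧
      LipschitzWith (Real.toNNReal s⁻¹) J ∧
      ∀ y (X : V →L[ℝ] V), HasFDerivAt J X y → (X : V →ₗ[ℝ] V).IsSymmetric ∧
        ∀ z, s * ‖X z‖ ^ 2 ≤ ⟪X z, z⟫ := by
  have hinj : Function.Injective (fun x => t • T x + s • x) := by
    intro x y hxy
    have h1 := h.mul_norm_sq_le (s := s) ht x y
    have h2 : (t • T x + s • x) - (t • T y + s • y) = 0 := sub_eq_zero.2 hxy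
    rw [h2, inner_zero_right] at h1
    have h3 : ‖x - y‖ ^ 2 ≤ 0 := by nlinarith
    have h4 : ‖x - y‖ = 0 := by nlinarith [norm_nonneg (x - y)]
    exact sub_eq_zero.1 (norm_eq_zero.1 h4)
  let e := Equiv.ofBijective _ ⟨hinj, h.surjective_smul_add hT ht hs⟩
  have he1 : ∀ x, e.symm (t • T x + s • x) = x := fun x => e.symm_apply_apply x
  have he2 : ∀ y, t • T (e.symm y) + s • e.symm y = y := fun y => e.apply_symm_apply y
  have hfirm : ∀ y z, s * ‖e.symm y - e.symm z‖ ^ 2 ≤ ⟪e.symm y - e.symm z, y - z⟫ := by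
    intro y z
    have := h.mul_norm_sq_le (s := s) ht (e.symm y) (e.symm z)
    rwa [he2, he2] at this
  have hlip : LipschitzWith (Real.toNNReal s⁻¹) e.symm := by
    refine LipschitzWith.of_dist_le_mul fun y z => ?_
    rw [Real.coe_toNNReal _ (by positivity), dist_eq_norm, dist_eq_norm]
    have h1 := (hfirm y z).trans (real_inner_le_norm _ _)
    rw [inv_mul_eq_div, le_div_iff₀ hs]
    by_contra hcon
    push Not at hcon
    have h5 : 0 < ‖e.symm y - e.symm z‖ := by
      by_contra h6
      have : ‖e.symm y - e.symm z‖ = 0 := le_antisymm (not_lt.1 h6) (norm_nonneg _)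
      rw [this, zero_mul] at hcon
      exact absurd hcon (not_lt.2 (norm_nonneg _))
    nlinarith
  refine ⟨e.symm, he1, he2, hlip, fun y X hX => ⟨?_, fun z => ?_⟩⟩
  · have hφ := h.smul_add_norm_sq ht hs.le
    have hw : IsSubgradientMap
        (fun y => ⟪y, e.symm y⟫ - (t * v (e.symm y) + s / 2 * ‖e.symm y‖ ^ 2)) e.symm := by
      intro y y'
      have h1 := hφ (e.symm y') (e.symm y)
      simp only [he2, inner_sub_right] at h1 ⊢
      rw [real_inner_comm y' (e.symm y), real_inner_comm y (e.symm y)]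
      rw [real_inner_comm, real_inner_comm y]
      linarith
    have hw' := fun z => hw.hasFDerivAt hlip.continuous z
    have h2 : HasFDerivAt (fun y => innerSL ℝ (e.symm y)) ((innerSL ℝ).comp X) y :=
      (innerSL ℝ).hasFDerivAt.comp y hX
    have h3 := second_derivative_symmetric hw' h2
    intro a b
    have := h3 a b
    simp only [ContinuousLinearMap.comp_apply, innerSL_apply_apply] at this
    rw [ContinuousLinearMap.coe_coe, this, real_inner_comm]
  · have hline : HasDerivAt (fun r : ℝ => e.symm (y + r • z)) (X z) 0 := by
      have h1 : HasFDerivAt e.symm X (y + (0 : ℝ) • z) := by simpa using hX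
      have h2 : HasDerivAt (fun r : ℝ => y + r • z) z 0 := by
        simpa using ((hasDerivAt_id (0 : ℝ)).smul_const z).const_add y
      exact h1.comp_hasDerivAt 0 h2
    rw [hasDerivAt_iff_tendsto_slope_zero] at hline
    simp only [zero_add, zero_smul, add_zero] at hline
    have hA : Tendsto (fun r : ℝ => s * ‖r⁻¹ • (e.symm (y + r • z) - e.symm y)‖ ^ 2) (𝓝[≠] 0)
        (𝓝 (s * ‖X z‖ ^ 2)) := ((hline.norm).pow 2).const_mul s
    have hB : Tendsto (fun r : ℝ => ⟪r⁻¹ • (e.symm (y + r • z) - e.symm y), z⟫) (𝓝[≠] 0)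
        (𝓝 ⟪X z, z⟫) := hline.inner tendsto_const_nhds
    refine le_of_tendsto_of_tendsto hA hB ?_
    filter_upwards [self_mem_nhdsWithin] with r hr
    have hr' : r ≠ 0 := hr
    have h1 := hfirm (y + r • z) y
    rw [add_sub_cancel_left, real_inner_smul_right] at h1
    rw [norm_smul, mul_pow, real_inner_smul_left, norm_inv, Real.norm_eq_abs, inv_pow, sq_abs]
    have hr2 : 0 < r ^ 2 := by positivity
    calc s * ((r ^ 2)⁻¹ * ‖e.symm (y + r • z) - e.symm y‖ ^ 2)
        = (r ^ 2)⁻¹ * (s * ‖e.symm (y + r • z) - e.symm y‖ ^ 2) := by ring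
      _ ≤ (r ^ 2)⁻¹ * (r * ⟪e.symm (y + r • z) - e.symm y, z⟫) := by gcongr
      _ = r⁻¹ * ⟪e.symm (y + r • z) - e.symm y, z⟫ := by field_simp

end Resolvent

section BrunnMinkowski

variable {V : Type*} [NormedAddCommGroup V] [InnerProductSpace ℝ V] [FiniteDimensional ℝ V]
  [MeasurableSpace V] [BorelSpace V]

theorem LipschitzWith.volume_image_eq_zero {C : NNReal} {J : V → V} (hJ : LipschitzWith C J)
    {A : Set V} (hA : volume A = 0) : volume (J '' A) = 0 := by
  have h1 : (μH[finrank ℝ V] : Measure V) A = 0 :=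
    Measure.absolutelyContinuous_isAddHaarMeasure _ volume hA
  have h2 := hJ.hausdorffMeasure_image_le (d := finrank ℝ V) (by positivity) A
  rw [h1, mul_zero] at h2
  exact Measure.absolutelyContinuous_isAddHaarMeasure volume μH[finrank ℝ V] (le_antisymm h2 bot_le)

/-- Brunn–Minkowski inequality for the Monge–Ampère measure of `t v + s |x|² / 2`. -/
theorem IsStrictSubgradientMap.pow_mul_lintegral_le_volume_image (hN : 0 < finrank ℝ V)
    {v : V → ℝ} {T : V → V}
    (h : IsStrictSubgradientMap v T) (hT : Continuous T) {t s c : ℝ} (ht : 0 < t) (hs : 0 < s)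
    (hc : 0 < c) {D : Set V} (hD : MeasurableSet D) {g : V → ℝ} (hg : Measurable g)
    (hg0 : ∀ x ∈ D, 0 ≤ g x) (hgc : ∀ x ∈ D, g x ≤ c ^ finrank ℝ V)
    (hMA : ∀ A ⊆ D, MeasurableSet A → ∫⁻ x in A, ENNReal.ofReal (g x) ≤ volume (T '' A)) :
    ENNReal.ofReal ((t + s / c) ^ finrank ℝ V) * ∫⁻ x in D, ENNReal.ofReal (g x) ≤
      volume ((fun x => t • T x + s • x) '' D) := by
  set N := finrank ℝ V
  obtain ⟨J, hJ1, hJ2, hJlip, hJder⟩ := h.isSubgradientMap.exists_resolvent hT ht.le hs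
  have hJinj : Function.Injective J := fun a b hab => by rw [← hJ2 a, ← hJ2 b, hab]
  set Θ : V → V := fun x => t • T x + s • x with hΘ
  have hΘD : Θ '' D = J ⁻¹' D := by
    ext y
    constructor
    · rintro ⟨x, hx, rfl⟩
      simpa [hΘ, hJ1] using hx
    · intro hy
      exact ⟨J y, hy, hJ2 y⟩
  have hEm : MeasurableSet (J ⁻¹' D) := hJlip.continuous.measurable hD
  set A := J ⁻¹' D ∩ {y | DifferentiableAt ℝ J y} with hAdef
  have hAm : MeasurableSet A := hEm.inter (measurableSet_of_differentiableAt ℝ J)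
  have hnull : volume (J ⁻¹' D \ A) = 0 := by
    refine measure_mono_null ?_ (ae_iff.1 (hJlip.ae_differentiableAt (μ := (volume : Measure V))))
    intro y hy
    by_contra hcon
    rw [mem_ofPred_eq, not_not] at hcon
    exact hy.2 ⟨hy.1, hcon⟩
  have hder : ∀ y ∈ A, HasFDerivWithinAt J (fderiv ℝ J y) A y :=
    fun y hy => hy.2.hasFDerivAt.hasFDerivWithinAt
  have hTJ : ∀ y, T (J y) = t⁻¹ • (y - s • J y) := by
    intro y
    have : t • T (J y) = y - s • J y := eq_sub_of_add_eq (hJ2 y)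
    rw [← this, smul_smul, inv_mul_cancel₀ ht.ne', one_smul]
  have hder2 : ∀ y ∈ A, HasFDerivWithinAt (T ∘ J)
      (t⁻¹ • (ContinuousLinearMap.id ℝ V - s • fderiv ℝ J y)) A y := by
    intro y hy
    have h1 : (T ∘ J) = fun y => t⁻¹ • (y - s • J y) := funext hTJ
    rw [h1]
    exact (((hasFDerivAt_id y).sub (hy.2.hasFDerivAt.const_smul s)).const_smul
      t⁻¹).hasFDerivWithinAt
  have hTJinj : Function.Injective (T ∘ J) := h.injective.comp hJinj
  have hfm : Measurable (fun y => |(fderiv ℝ J y).det|) :=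
    (ContinuousLinearMap.continuous_det.measurable.comp (measurable_fderiv ℝ J)).abs
  have hae : ∀ᵐ y ∂(volume.restrict A),
      ENNReal.ofReal |(fderiv ℝ J y).det| * ENNReal.ofReal (g (J y)) ≤
      ENNReal.ofReal |(t⁻¹ • (ContinuousLinearMap.id ℝ V - s • fderiv ℝ J y)).det| := by
    refine ae_le_of_forall_setLIntegral_le_of_sigmaFinite
      (hfm.ennreal_ofReal.mul (hg.comp hJlip.continuous.measurable).ennreal_ofReal) fun S hS _ => ?_
    rw [Measure.restrict_restrict hS]
    have hSm : MeasurableSet (S ∩ A) := hS.inter hAm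
    rw [← lintegral_image_eq_lintegral_abs_det_fderiv_mul volume hSm
      (fun y hy => (hder y hy.2).mono inter_subset_right) hJinj.injOn
      (fun x => ENNReal.ofReal (g x)),
      lintegral_abs_det_fderiv_eq_addHaar_image volume hSm
      (fun y hy => (hder2 y hy.2).mono inter_subset_right) hTJinj.injOn, image_comp]
    refine hMA _ ?_ (hSm.image_of_continuousOn_injOn hJlip.continuous.continuousOn hJinj.injOn)
    rintro _ ⟨y, hy, rfl⟩
    exact hy.2.1
  have hDJ : D ⊆ J '' A ∪ J '' (J ⁻¹' D \ A) := by
    intro x hx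
    rw [← image_union, union_sdiff_cancel inter_subset_left]
    exact ⟨Θ x, by simpa [hΘ, hJ1] using hx, hJ1 x⟩
  calc ENNReal.ofReal ((t + s / c) ^ N) * ∫⁻ x in D, ENNReal.ofReal (g x)
      ≤ ENNReal.ofReal ((t + s / c) ^ N) * ∫⁻ x in J '' A, ENNReal.ofReal (g x) := by
        gcongr 1
        calc ∫⁻ x in D, ENNReal.ofReal (g x)
            ≤ ∫⁻ x in J '' A ∪ J '' (J ⁻¹' D \ A), ENNReal.ofReal (g x) :=
              lintegral_mono_set hDJ
          _ ≤ (∫⁻ x in J '' A, ENNReal.ofReal (g x)) +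
              ∫⁻ x in J '' (J ⁻¹' D \ A), ENNReal.ofReal (g x) := lintegral_union_le _ _ _
          _ = ∫⁻ x in J '' A, ENNReal.ofReal (g x) := by
              rw [setLIntegral_measure_zero _ _ (hJlip.volume_image_eq_zero hnull), add_zero]
    _ = ∫⁻ y in A, ENNReal.ofReal ((t + s / c) ^ N) *
          (ENNReal.ofReal |(fderiv ℝ J y).det| * ENNReal.ofReal (g (J y))) := by
        rw [lintegral_image_eq_lintegral_abs_det_fderiv_mul volume hAm hder hJinj.injOn,
          lintegral_const_mul]
        exact hfm.ennreal_ofReal.mul (hg.comp hJlip.continuous.measurable).ennreal_ofReal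
    _ ≤ ∫⁻ y in A, 1 := by
        refine lintegral_mono_ae ?_
        filter_upwards [hae, ae_restrict_mem hAm] with y hy hyA
        obtain ⟨hsym, hmono⟩ := hJder y _ hyA.2.hasFDerivAt
        have hg0' : 0 ≤ g (J y) := hg0 _ hyA.1
        rw [← ENNReal.ofReal_mul (abs_nonneg _), ENNReal.ofReal_le_ofReal_iff (abs_nonneg _),
          mul_comm] at hy
        rw [← ENNReal.ofReal_mul (abs_nonneg _), ← ENNReal.ofReal_mul (by positivity),
          ← ENNReal.ofReal_one]
        refine ENNReal.ofReal_le_ofReal ?_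
        rw [mul_comm |_|]
        exact det_mul_le_one_of_firmly_monotone hN hsym hs hmono ht hc hg0' (hgc _ hyA.1) hy
    _ = volume A := by simp
    _ ≤ volume (Θ '' D) := by rw [hΘD]; exact measure_mono inter_subset_left

end BrunnMinkowski

section Comparison

variable {V : Type*} [NormedAddCommGroup V] [InnerProductSpace ℝ V] [FiniteDimensional ℝ V]

theorem ContinuousLinearMap.det_adjoint_real (L : V →L[ℝ] V) :
    (ContinuousLinearMap.adjoint L).det = L.det := by
  have h : ((ContinuousLinearMap.adjoint L : V →L[ℝ] V) : V →ₗ[ℝ] V) =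
      LinearMap.adjoint (L : V →ₗ[ℝ] V) := rfl
  rw [ContinuousLinearMap.det, ContinuousLinearMap.det, h,
    ← LinearMap.det_toMatrix (stdOrthonormalBasis ℝ V).toBasis,
    ← LinearMap.det_toMatrix (stdOrthonormalBasis ℝ V).toBasis, LinearMap.toMatrix_adjoint,
    Matrix.det_conjTranspose, star_trivial]

/-- Comparison of gradient images: below a strict local maximum of `w - u`, every slope of `w`
is a slope of `u`. -/
theorem IsSubgradientMap.image_subset_image {u w : V → ℝ} {gu gw : V → V}
    (hu : IsSubgradientMap u gu) (hgu : Continuous gu) (hw : IsSubgradientMap w gw)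
    {xb : V} {r m : ℝ}
    (hbd : ∀ x ∈ sphere xb r, w x - u x ≤ m) :
    gw '' {x ∈ closedBall xb r | m < w x - u x} ⊆ gu '' {x ∈ closedBall xb r | m < w x - u x} := by
  rintro _ ⟨x, ⟨hxb, hxm⟩, rfl⟩
  have hφ := hu.sub_inner (gw x)
  have hφc : Continuous (fun y => gu y - gw x) := by fun_prop
  obtain ⟨z, hz, hzmin⟩ := (isCompact_closedBall xb r).exists_isMinOn ⟨x, hxb⟩
    (hφ.continuous hφc).continuousOn
  have h1 : u z - ⟪gw x, z⟫ ≤ u x - ⟪gw x, x⟫ := hzmin hxb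
  have h2 := hw x z
  rw [inner_sub_right] at h2
  have hzm : m < w z - u z := by linarith
  have hzb : z ∈ ball xb r := by
    refine mem_ball.2 (lt_of_le_of_ne (mem_closedBall.1 hz) fun h => ?_)
    exact absurd (hbd z h) (not_le.2 hzm)
  refine ⟨z, ⟨hz, hzm⟩, ?_⟩
  have h3 : IsLocalMin (fun y => u y - ⟪gw x, y⟫) z :=
    hzmin.isLocalMin (mem_of_superset (isOpen_ball.mem_nhds hzb) ball_subset_closedBall)
  exact sub_eq_zero.1 (hφ.eq_zero_of_isLocalMin hφc h3)

variable [MeasurableSpace V] [BorelSpace V]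

theorem IsStrictSubgradientMap.pow_mul_lintegral_le_volume_image_equiv (hN : 0 < finrank ℝ V)
    {v : V → ℝ} {T : V → V} (h : IsStrictSubgradientMap v T) (hT : Continuous T)
    (B : V ≃L[ℝ] V) {t s c : ℝ} (ht : 0 < t) (hs : 0 < s)
    (hc : 0 < c) {D : Set V} (hD : MeasurableSet D) {g : V → ℝ} (hg : Measurable g)
    (hg0 : ∀ x ∈ D, 0 ≤ g x)
    (hgc : ∀ x ∈ D, g x ≤ c ^ finrank ℝ V * (B : V →L[ℝ] V).det ^ 2)
    (hMA : ∀ A ⊆ D, MeasurableSet A → ∫⁻ x in A, ENNReal.ofReal (g x) ≤ volume (T '' A)) :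
    ENNReal.ofReal ((t + s / c) ^ finrank ℝ V) * ∫⁻ x in D, ENNReal.ofReal (g x) ≤
      volume ((fun x => t • T x +
        s • ContinuousLinearMap.adjoint (B : V →L[ℝ] V) (B x)) '' D) := by
  set d := (B : V →L[ℝ] V).det with hd
  set P : V →L[ℝ] V := ContinuousLinearMap.adjoint (B.symm : V →L[ℝ] V) with hP
  have hdne : d ≠ 0 := B.toLinearEquiv.isUnit_det'.ne_zero
  have hPdet : P.det = d⁻¹ := by
    rw [hP, ContinuousLinearMap.det_adjoint_real]
    have h1 := LinearEquiv.det_symm_mul_det B.toLinearEquiv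
    exact eq_inv_of_mul_eq_one_left h1
  have hPB : ∀ x, P (ContinuousLinearMap.adjoint (B : V →L[ℝ] V) x) = x := by
    intro x
    refine ext_inner_right ℝ fun y => ?_
    rw [hP, ContinuousLinearMap.adjoint_inner_left, ContinuousLinearMap.adjoint_inner_left]
    simp
  have hchange : ∀ A, MeasurableSet A →
      ∫⁻ y in B '' A, ENNReal.ofReal (d⁻¹ ^ 2 * g (B.symm y)) =
        ENNReal.ofReal |d⁻¹| * ∫⁻ x in A, ENNReal.ofReal (g x) := by
    intro A hA
    rw [lintegral_image_eq_lintegral_abs_det_fderiv_mul volume hA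
      (f := B) (fun x _ => (B : V →L[ℝ] V).hasFDerivAt.hasFDerivWithinAt) B.injective.injOn,
      ← lintegral_const_mul' _ _ ENNReal.ofReal_ne_top]
    refine lintegral_congr fun x => ?_
    rw [B.symm_apply_apply, ← ENNReal.ofReal_mul (abs_nonneg _),
      ← ENNReal.ofReal_mul (abs_nonneg _), ← hd]
    congr 1
    rw [← mul_assoc]
    congr 1
    rw [abs_inv, inv_pow, ← sq_abs d]
    have : |d| ≠ 0 := abs_ne_zero.2 hdne
    field_simp
  have hstrict : IsStrictSubgradientMap (fun y => v (B.symm y)) (fun y => P (T (B.symm y))) := by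
    intro x y hxy
    have h1 := h (B.symm x) (B.symm y) (fun h => hxy (B.symm.injective h))
    rw [hP, ContinuousLinearMap.adjoint_inner_left]
    simpa using h1
  have hvol : ∀ A, volume (P '' A) = ENNReal.ofReal |d⁻¹| * volume A := by
    intro A
    rw [Measure.addHaar_image_continuousLinearMap, ← hPdet]
  have key := hstrict.pow_mul_lintegral_le_volume_image hN
    (P.continuous.comp (hT.comp B.symm.continuous)) ht hs hc
    (D := B '' D) (g := fun y => d⁻¹ ^ 2 * g (B.symm y))
    (B.toHomeomorph.toMeasurableEquiv.measurableSet_image.2 hD)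
    ((hg.comp B.symm.continuous.measurable).const_mul _)
    (by
      rintro _ ⟨x, hx, rfl⟩
      rw [B.symm_apply_apply]
      exact mul_nonneg (sq_nonneg _) (hg0 x hx))
    (by
      rintro _ ⟨x, hx, rfl⟩
      rw [B.symm_apply_apply]
      have := mul_le_mul_of_nonneg_left (hgc x hx) (sq_nonneg d⁻¹)
      refine this.trans_eq ?_
      field_simp)
    (by
      intro A hA hAm
      have hA' : A = B '' (B ⁻¹' A) := (image_preimage_eq A B.surjective).symm
      have hm : MeasurableSet (B ⁻¹' A) := B.continuous.measurable hAm
      have hsubs : B ⁻¹' A ⊆ D := by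
        intro x hx
        obtain ⟨z, hz, hzx⟩ := hA hx
        rwa [← B.injective hzx]
      have him : (fun y => P (T (B.symm y))) '' A = P '' (T '' (B ⁻¹' A)) := by
        conv_lhs => rw [hA']
        rw [image_image, image_image]
        simp
      rw [him, hvol]
      conv_lhs => rw [hA']
      rw [hchange _ hm]
      gcongr
      exact hMA _ hsubs hm)
  have him : (fun y => t • P (T (B.symm y)) + s • y) '' (B '' D) =
      P '' ((fun x => t • T x + s • ContinuousLinearMap.adjoint (B : V →L[ℝ] V) (B x)) '' D) := by
    rw [image_image, image_image]
    refine image_congr fun x _ => ?_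
    rw [map_add, map_smul, map_smul, hPB]
    simp
  rw [him, hvol, hchange _ hD, mul_left_comm] at key
  have h0 : ENNReal.ofReal |d⁻¹| ≠ 0 := by
    rw [ne_eq, ENNReal.ofReal_eq_zero, not_le]; positivity
  exact (ENNReal.mul_le_mul_iff_right h0 ENNReal.ofReal_ne_top).1 key

/-- A convex combination of `v` with a steep quadratic cannot touch `u` from below when the
Monge–Ampère measures are ordered up to a factor smaller than `1 + ε`. -/
theorem not_touching_of_monge_ampere (hN : 0 < finrank ℝ V)
    {u v : V → ℝ} {gu gv : V → V}
    (hu : IsStrictSubgradientMap u gu) (hgu : Continuous gu)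
    (hv : IsStrictSubgradientMap v gv) (hgv : Continuous gv)
    (B : V ≃L[ℝ] V) (b : V) (κ : ℝ) {xb : V} {r0 ε s : ℝ} (hr0 : 0 < r0) (hε : 0 < ε) (hε1 : ε < 1)
    (hs : 0 < s)
    (hmax : ∀ x ∈ closedBall xb r0, (1 - ε) * v x + ε * (‖B x‖ ^ 2 / 2 + ⟪b, x⟫ + κ) - u x ≤
      (1 - ε) * v xb + ε * (‖B xb‖ ^ 2 / 2 + ⟪b, xb⟫ + κ) - u xb - s * ‖x - xb‖ ^ 2)
    {f Hu Hv : V → ℝ} {lam Lam : ℝ} (hf : Measurable f) (hlam : 0 < lam)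
    (hf1 : ∀ x ∈ ball xb r0, lam ≤ f x) (hf2 : ∀ x ∈ ball xb r0, f x ≤ Lam)
    (hMAu : ∀ A ⊆ ball xb r0, MeasurableSet A →
      volume (gu '' A) ≤ ∫⁻ x in A, ENNReal.ofReal (f x * Hu x))
    (hMAv : ∀ A ⊆ ball xb r0, MeasurableSet A →
      ∫⁻ x in A, ENNReal.ofReal (f x * Hv x) ≤ volume (gv '' A))
    (hHu : ContinuousAt Hu xb) (hHv : ContinuousAt Hv xb) (hpos : 0 < Hv xb)
    (hlt : Hu xb < (1 + ε) * Hv xb)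
    (hdet : 2 ^ finrank ℝ V * Hv xb * Lam ≤ (B : V →L[ℝ] V).det ^ 2) : False := by
  obtain ⟨av, hav1, hav2⟩ : ∃ av, max 0 (Hu xb / (1 + ε)) < av ∧ av < Hv xb :=
    exists_between (max_lt hpos (by rw [div_lt_iff₀ (by linarith)]; linarith))
  have hav0 : 0 < av := (le_max_left _ _).trans_lt hav1
  have hau : Hu xb < (1 + ε) * av := by
    have := (le_max_right _ _).trans_lt hav1
    rw [div_lt_iff₀ (by linarith)] at this; linarith
  obtain ⟨au, hau1, hau2⟩ := exists_between hau
  obtain ⟨r1, hr1, hr1s⟩ := Metric.eventually_nhds_iff_ball.1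
    ((hHu.eventually_lt_const hau1).and (hHv.eventually_const_lt hav2))
  set r := min (r0 / 2) (r1 / 2) with hr
  have hrpos : 0 < r := by positivity
  have hrr0 : closedBall xb r ⊆ ball xb r0 :=
    closedBall_subset_ball (by have := min_le_left (r0 / 2) (r1 / 2); linarith)
  have hrr1 : closedBall xb r ⊆ ball xb r1 :=
    closedBall_subset_ball (by have := min_le_right (r0 / 2) (r1 / 2); linarith)
  set w : V → ℝ := fun x => (1 - ε) * v x + ε * (‖B x‖ ^ 2 / 2 + ⟪b, x⟫ + κ) with hw
  set gw : V → V := fun x => ((1 - ε) • gv x +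
    ε • ContinuousLinearMap.adjoint (B : V →L[ℝ] V) (B x)) + ε • b with hgw
  have hwsub : IsSubgradientMap w gw := by
    intro x y
    have h1 := mul_le_mul_of_nonneg_left (hv.isSubgradientMap x y) (by linarith : 0 ≤ 1 - ε)
    have h2 : ‖B y‖ ^ 2 = ‖B x‖ ^ 2 + 2 * ⟪B x, B (y - x)⟫ + ‖B (y - x)‖ ^ 2 := by
      rw [← norm_add_sq_real, ← map_add, add_sub_cancel]
    have h3 : ⟪ContinuousLinearMap.adjoint (B : V →L[ℝ] V) (B x), y - x⟫ = ⟪B x, B (y - x)⟫ :=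
      ContinuousLinearMap.adjoint_inner_left _ _ _
    have h4 : ⟪b, y - x⟫ = ⟪b, y⟫ - ⟪b, x⟫ := inner_sub_right _ _ _
    have h5 := mul_nonneg hε.le (sq_nonneg ‖B (y - x)‖)
    simp only [hw, hgw, inner_add_left, real_inner_smul_left, h3, h4, h2]
    nlinarith
  have hgwc : Continuous gw := by
    have := B.continuous
    fun_prop
  have hwc : Continuous w := hwsub.continuous hgwc
  have huc : Continuous u := hu.isSubgradientMap.continuous hgu
  set m := w xb - u xb - s * r ^ 2 with hm
  have hbd : ∀ x ∈ sphere xb r, w x - u x ≤ m := by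
    intro x hx
    have h1 := hmax x (ball_subset_closedBall (hrr0 (sphere_subset_closedBall hx)))
    rw [mem_sphere_iff_norm.1 hx] at h1
    exact h1
  set D : Set V := {x ∈ closedBall xb r | m < w x - u x} with hD
  have hDm : MeasurableSet D := isClosed_closedBall.measurableSet.inter
    (isOpen_lt continuous_const (hwc.sub huc)).measurableSet
  have hDball : D ⊆ ball xb r0 := fun x hx => hrr0 hx.1
  have hsubset := hu.isSubgradientMap.image_subset_image hgu hwsub hbd
  have hI : ∀ x ∈ D, 0 < f x := fun x hx => hlam.trans_le (hf1 x (hDball hx))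
  -- upper bound
  have hup : volume (gu '' D) ≤ ENNReal.ofReal au * ∫⁻ x in D, ENNReal.ofReal (f x) := by
    refine (hMAu D hDball hDm).trans ?_
    rw [← lintegral_const_mul' _ _ ENNReal.ofReal_ne_top]
    refine setLIntegral_mono' hDm fun x hx => ?_
    rw [mul_comm, ENNReal.ofReal_mul' (hI x hx).le]
    gcongr
    exact (hr1s x (hrr1 hx.1)).1.le
  have hlow : ENNReal.ofReal ((1 + ε) ^ finrank ℝ V) *
      (ENNReal.ofReal av * ∫⁻ x in D, ENNReal.ofReal (f x)) ≤ volume (gw '' D) := by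
    have key := hv.pow_mul_lintegral_le_volume_image_equiv hN hgv B (t := 1 - ε) (s := ε)
      (c := 1 / 2) (by linarith) hε (by norm_num) hDm (g := fun x => av * f x)
      (hf.const_mul _) (fun x hx => (mul_pos hav0 (hI x hx)).le)
      (by
        intro x hx
        rw [one_div, inv_pow, inv_mul_eq_div, le_div_iff₀ (by positivity)]
        refine le_trans ?_ hdet
        have h1 : av * f x ≤ Hv xb * Lam :=
          mul_le_mul hav2.le (hf2 x (hDball hx)) (hI x hx).le hpos.le
        calc av * f x * 2 ^ finrank ℝ V ≤ Hv xb * Lam * 2 ^ finrank ℝ V := by gcongr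
          _ = _ := by ring)
      (by
        intro A hA hAm
        refine le_trans ?_ (hMAv A (hA.trans hDball) hAm)
        refine setLIntegral_mono' hAm fun x hx => ?_
        refine ENNReal.ofReal_le_ofReal ?_
        rw [mul_comm]
        exact mul_le_mul_of_nonneg_left (hr1s x (hrr1 (hA hx).1)).2.le (hI x (hA hx)).le)
    have h1 : (1 - ε + ε / (1 / 2)) = 1 + ε := by ring
    rw [h1] at key
    have h2 : gw '' D = (fun y => y + ε • b) '' ((fun x => (1 - ε) • gv x +
        ε • ContinuousLinearMap.adjoint (B : V →L[ℝ] V) (B x)) '' D) := by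
      rw [image_image]
    have h3 : volume (gw '' D) = volume ((fun x => (1 - ε) • gv x +
        ε • ContinuousLinearMap.adjoint (B : V →L[ℝ] V) (B x)) '' D) := by
      rw [h2, image_add_right, measure_preimage_add_right]
    rw [h3]
    refine le_trans (le_of_eq ?_) key
    congr 1
    rw [← lintegral_const_mul' _ _ ENNReal.ofReal_ne_top]
    refine lintegral_congr fun x => ?_
    rw [ENNReal.ofReal_mul hav0.le]
  have hchain := hlow.trans ((measure_mono hsubset).trans hup)
  -- the integral of `f` over `D` is positive and finite
  set I := ∫⁻ x in D, ENNReal.ofReal (f x) with hIdef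
  have hIfin : I ≠ ⊤ := by
    refine ne_of_lt (lt_of_le_of_lt (setLIntegral_mono' hDm (g := fun _ => ENNReal.ofReal Lam)
      fun x hx => ENNReal.ofReal_le_ofReal (hf2 x (hDball hx))) ?_)
    rw [setLIntegral_const]
    refine ENNReal.mul_lt_top ENNReal.ofReal_lt_top ?_
    exact (measure_mono (fun x hx => hx.1)).trans_lt (measure_closedBall_lt_top (x := xb) (r := r))
  have hIpos : I ≠ 0 := by
    have h1 : 0 < volume (ball xb r ∩ {x | m < w x - u x}) := by
      refine IsOpen.measure_pos _ (isOpen_ball.inter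
        (isOpen_lt continuous_const (hwc.sub huc))) ⟨xb, mem_ball_self hrpos, ?_⟩
      have : 0 < s * r ^ 2 := by positivity
      simp only [mem_ofPred_eq, hm]
      linarith
    have h2 : volume (ball xb r ∩ {x | m < w x - u x}) ≤ volume D :=
      measure_mono fun x hx => ⟨ball_subset_closedBall hx.1, hx.2⟩
    have h3 : ENNReal.ofReal lam * volume D ≤ I := by
      rw [← setLIntegral_const]
      exact setLIntegral_mono' hDm fun x hx => ENNReal.ofReal_le_ofReal (hf1 x (hDball hx))
    refine ne_of_gt (lt_of_lt_of_le ?_ h3)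
    exact ENNReal.mul_pos (by simpa using hlam) (h1.trans_le h2).ne'
  rw [← mul_assoc, ENNReal.mul_le_mul_iff_left hIpos hIfin, ← ENNReal.ofReal_mul (by positivity)]
    at hchain
  have hpow : 1 + ε ≤ (1 + ε) ^ finrank ℝ V := le_self_pow₀ (by linarith) hN.ne'
  have h5 : 0 < (1 + ε) ^ finrank ℝ V * av := by positivity
  have h6 := (ENNReal.ofReal_le_ofReal_iff' .. ).1 hchain
  rcases h6 with h6 | h6
  · have := mul_le_mul_of_nonneg_right hpow hav0.le
    linarith
  · linarith

end Comparison

section Normalization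

variable {V : Type*} [NormedAddCommGroup V] [InnerProductSpace ℝ V]
variable {ι : Type*} [Fintype ι] [DecidableEq ι]

/-- A compact neighbourhood of the origin contains a basis with respect to which all of its
elements have coordinates bounded by one. -/
theorem OrthonormalBasis.exists_basis_abs_repr_le_one (e : OrthonormalBasis ι ℝ V)
    {S : Set V} (hS : IsCompact S) {r : ℝ} (hr : 0 < r) (hrS : closedBall 0 r ⊆ S) :
    ∃ b : Basis ι ℝ V, (∀ i, b i ∈ S) ∧ ∀ y ∈ S, ∀ i, |b.repr y i| ≤ 1 := by
  have hcont : Continuous (fun Y : ι → V => |e.toBasis.det Y|) := by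
    change Continuous (fun Y : ι → V => |(e.toBasis.toMatrix Y).det|)
    refine (Continuous.matrix_det ?_).abs
    refine continuous_matrix fun i j => ?_
    simp only [Basis.toMatrix_apply, OrthonormalBasis.coe_toBasis_repr_apply,
      OrthonormalBasis.repr_apply_apply]
    fun_prop
  have hmem : ∀ i, r • e i ∈ S := fun i => hrS (by
    rw [mem_closedBall_zero_iff, norm_smul, e.orthonormal.1 i, mul_one, Real.norm_of_nonneg hr.le])
  obtain ⟨Y, hY, hmax⟩ := (isCompact_univ_pi fun _ : ι => hS).exists_isMaxOn
    ⟨fun i => r • e i, fun i _ => hmem i⟩ hcont.continuousOn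
  have hdet : 0 < |e.toBasis.det Y| := by
    have h1 : |e.toBasis.det fun i => r • e i| ≤ |e.toBasis.det Y| :=
      hmax (fun i _ => hmem i)
    refine lt_of_lt_of_le ?_ h1
    rw [AlternatingMap.map_smul_univ]
    have h2 : e.toBasis.det (fun i => e i) = 1 := by
      have := e.toBasis.det_self
      rwa [e.coe_toBasis] at this
    rw [h2]
    simp only [Finset.prod_const, smul_eq_mul, mul_one]
    positivity
  obtain ⟨hli, hsp⟩ := e.toBasis.is_basis_iff_det.2 (isUnit_iff_ne_zero.2 (abs_pos.1 hdet))
  refine ⟨Basis.mk hli hsp.ge, fun i => by simpa using hY i (mem_univ i), fun y hy i => ?_⟩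
  have h1 := congrArg (fun l => l y) (e.toBasis.det_smul_mk_coord_eq_det_update hli hsp.ge i)
  have h2 : |e.toBasis.det (Function.update Y i y)| ≤ |e.toBasis.det Y| := by
    refine hmax fun j _ => ?_
    by_cases hji : j = i
    · subst hji; simpa using hy
    · simpa [hji] using hY j (mem_univ j)
  have h3 : e.toBasis.det Y * (Basis.mk hli hsp.ge).repr y i =
      e.toBasis.det (Function.update Y i y) := by
    simpa using h1
  rw [← h3, abs_mul] at h2
  exact le_of_mul_le_mul_left (by linarith) hdet

theorem Matrix.det_updateRow_smul_one (a : ℝ) (i : ι) (w : ι → ℝ) :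
    ((a • (1 : Matrix ι ι ℝ)).updateRow i w).det = a ^ (Fintype.card ι - 1) * w i := by
  rw [← Matrix.cramer_transpose_apply, Matrix.cramer_eq_adjugate_mulVec, Matrix.transpose_smul,
    Matrix.transpose_one, Matrix.adjugate_smul, Matrix.adjugate_one, Matrix.smul_mulVec,
    Matrix.one_mulVec]
  simp

variable [FiniteDimensional ℝ V]

/-- A quadratic form that is bounded on `S`, except in the direction `p`, and whose determinant is
large compared to the volume of `S`. -/
theorem OrthonormalBasis.exists_steep_normalization [Nonempty ι] (e : OrthonormalBasis ι ℝ V)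
    {S : Set V} (hS : IsCompact S) {r : ℝ} (hr : 0 < r) (hrS : closedBall 0 r ⊆ S)
    {p : V} (hp : p ≠ 0) {a A : ℝ} (ha : 0 < a) (haN : 2 * Fintype.card ι * a ^ 2 ≤ 1)
    (hA : 0 < A) :
    ∃ (L B : V ≃ₗ[ℝ] V) (M : ℝ), (∀ i, L (e i) ∈ S) ∧ ‖p‖ * r ≤ M ∧
      (∀ y ∈ S, |⟪p, y⟫| ≤ M) ∧
      (∀ y ∈ S, ‖B y‖ ^ 2 ≤ 1 / 2 + A ^ 2 * (⟪p, y⟫ / M) ^ 2) ∧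
      (a ^ (Fintype.card ι - 1) * A / Fintype.card ι) ^ 2 ≤
        LinearMap.det (B : V →ₗ[ℝ] V) ^ 2 * LinearMap.det (L : V →ₗ[ℝ] V) ^ 2 := by
  obtain ⟨b, hbS, hb⟩ := e.exists_basis_abs_repr_le_one hS hr hrS
  have hcard : (0 : ℝ) < Fintype.card ι := by exact_mod_cast Fintype.card_pos
  have hp0 : 0 < ‖p‖ := norm_pos_iff.2 hp
  obtain ⟨ys, hys, hysmax⟩ := hS.exists_isMaxOn ⟨0, hrS (mem_closedBall_self hr.le)⟩
    (f := fun y => |⟪p, y⟫|) (by fun_prop)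
  set M := |⟪p, ys⟫| with hM
  have hMr : ‖p‖ * r ≤ M := by
    have h1 : (r / ‖p‖) • p ∈ S := hrS (by
      rw [mem_closedBall_zero_iff, norm_smul, Real.norm_of_nonneg (by positivity)]
      field_simp; exact le_rfl)
    have h2 : |⟪p, (r / ‖p‖) • p⟫| ≤ M := hysmax h1
    rw [real_inner_smul_right, real_inner_self_eq_norm_sq, abs_of_nonneg (by positivity)] at h2
    refine le_trans (le_of_eq ?_) h2
    field_simp
  have hMpos : 0 < M := lt_of_lt_of_le (by positivity) hMr
  have hexp : ∀ y, ⟪p, y⟫ = ∑ j, ⟪p, b j⟫ * b.repr y j := by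
    intro y
    conv_lhs => rw [← b.sum_repr y, inner_sum]
    simp only [real_inner_smul_right]
    exact Finset.sum_congr rfl fun j _ => mul_comm _ _
  obtain ⟨i, hi⟩ : ∃ i, M ≤ Fintype.card ι * |⟪p, b i⟫| := by
    by_contra! hcon
    have h1 : M ≤ ∑ j, |⟪p, b j⟫| := by
      rw [hM, hexp]
      refine (Finset.abs_sum_le_sum_abs _ _).trans (Finset.sum_le_sum fun j _ => ?_)
      rw [abs_mul]
      exact mul_le_of_le_one_right (abs_nonneg _) (hb ys hys j)
    have h2 : ∑ j, |⟪p, b j⟫| < ∑ _j : ι, M / Fintype.card ι := by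
      refine Finset.sum_lt_sum_of_nonempty Finset.univ_nonempty fun j _ => ?_
      rw [lt_div_iff₀ hcard, mul_comm]; exact hcon j
    rw [Finset.sum_const, Finset.card_univ, nsmul_eq_mul, mul_div_cancel₀ _ hcard.ne'] at h2
    linarith
  set w : ι → ℝ := fun j => A / M * ⟪p, b j⟫ with hw
  set m := (a • (1 : Matrix ι ι ℝ)).updateRow i w with hm
  have hmdet : m.det = a ^ (Fintype.card ι - 1) * (A / M * ⟪p, b i⟫) :=
    Matrix.det_updateRow_smul_one a i w
  have hbi : 0 < |⟪p, b i⟫| := by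
    by_contra! h
    have := mul_nonpos_of_nonneg_of_nonpos hcard.le h
    linarith
  have hmdet0 : m.det ≠ 0 := by
    rw [hmdet]
    have := abs_pos.1 hbi
    positivity
  set G : V →ₗ[ℝ] V := Matrix.toLin e.toBasis e.toBasis m with hG
  have hGdet : LinearMap.det G = m.det := by rw [hG, LinearMap.det_toLin]
  let Ge : V ≃ₗ[ℝ] V := LinearMap.equivOfDetNeZero G (by rwa [hGdet])
  let L : V ≃ₗ[ℝ] V := e.toBasis.equiv b (Equiv.refl ι)
  have hLe : ∀ i, L (e i) = b i := by
    intro i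
    have := e.toBasis.equiv_apply i b (Equiv.refl ι)
    simpa using this
  refine ⟨L, L.symm.trans Ge, M, fun i => by rw [hLe]; exact hbS i, hMr,
    fun y hy => hysmax hy, fun y hy => ?_, ?_⟩
  · have hcomp : ∀ k, ⟪e k, (L.symm.trans Ge) y⟫ = (m.mulVec (b.repr y)) k := by
      intro k
      have h1 : e.toBasis.repr (G (L.symm y)) = m.mulVec (e.toBasis.repr (L.symm y)) := by
        rw [hG, Matrix.repr_toLin]
      have h2 : e.toBasis.repr (L.symm y) = b.repr y := by
        ext j
        have h3 : L.symm y = ∑ j, b.repr y j • e j := by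
          rw [LinearEquiv.symm_apply_eq, map_sum]
          simp only [map_smul, hLe]
          exact (b.sum_repr y).symm
        rw [h3]
        have := e.toBasis.repr_sum_self (fun j => b.repr y j)
        simp only [e.coe_toBasis] at this
        exact congrFun this j
      rw [h2] at h1
      have h4 := congrFun h1 k
      rw [← h4]
      simp [Ge, OrthonormalBasis.repr_apply_apply]
    have hk1 : (m.mulVec (b.repr y)) i = A * (⟪p, y⟫ / M) := by
      rw [Matrix.mulVec, hm, Matrix.updateRow_self, dotProduct, hexp y, Finset.sum_div,
        Finset.mul_sum]
      refine Finset.sum_congr rfl fun j _ => ?_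
      simp only [hw]; ring
    have hk2 : ∀ k, k ≠ i → (m.mulVec (b.repr y)) k = a * b.repr y k := by
      intro k hk
      rw [Matrix.mulVec, hm, Matrix.updateRow_ne hk, dotProduct]
      simp [Matrix.one_apply]
    rw [← e.sum_sq_inner_right]
    simp only [hcomp]
    rw [← Finset.add_sum_erase _ _ (Finset.mem_univ i), hk1]
    have h5 : ∑ k ∈ Finset.univ.erase i, (m.mulVec (b.repr y)) k ^ 2 ≤
        ∑ k ∈ Finset.univ.erase i, a ^ 2 := by
      refine Finset.sum_le_sum fun k hk => ?_
      rw [hk2 k (Finset.ne_of_mem_erase hk), mul_pow]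
      refine mul_le_of_le_one_right (sq_nonneg a) ?_
      rw [← sq_abs]
      exact pow_le_one₀ (abs_nonneg _) (hb y hy k)
    have h6 : ∑ k ∈ Finset.univ.erase i, a ^ 2 ≤ ∑ k : ι, a ^ 2 :=
      Finset.sum_le_sum_of_subset_of_nonneg (Finset.erase_subset _ _)
        fun _ _ _ => sq_nonneg a
    have h7 : ∑ k : ι, a ^ 2 = Fintype.card ι * a ^ 2 := by simp
    nlinarith
  · have h1 : LinearMap.det ((L.symm.trans Ge : V ≃ₗ[ℝ] V) : V →ₗ[ℝ] V) *
        LinearMap.det (L : V →ₗ[ℝ] V) = m.det := by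
      rw [← LinearMap.det_comp, ← hGdet]
      congr 1
      ext x
      simp [Ge]
    rw [← mul_pow, h1, hmdet, sq_le_sq, abs_of_nonneg (by positivity), abs_mul, abs_mul,
      abs_of_nonneg (by positivity : 0 ≤ a ^ (Fintype.card ι - 1)), mul_div_assoc]
    gcongr
    rw [abs_of_nonneg (by positivity : 0 ≤ A / M), div_mul_eq_mul_div, div_le_div_iff₀ hcard hMpos]
    nlinarith

end Normalization

section Volume

variable {V : Type*} [NormedAddCommGroup V] [InnerProductSpace ℝ V]
variable {ι : Type*} [Fintype ι]

theorem abs_inner_le_of_coord_mem_Icc [Nonempty ι] {v : V → ℝ} {T : V → V}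
    (hv : IsSubgradientMap v T) (hv0 : v 0 = 0) (hT0 : T 0 = 0) {b : ι → V} {c : ι → ℝ} {h : ℝ}
    (hb : ∀ i, v (b i) ≤ h)
    (hc : ∀ i, c i ∈ Icc (1 / (4 * Fintype.card ι) : ℝ) (1 / (2 * Fintype.card ι))) (i : ι) :
    |⟪T (∑ j, c j • b j), b i⟫| ≤ 4 * Fintype.card ι * h := by
  have hcard : (1 : ℝ) ≤ Fintype.card ι := by exact_mod_cast Fintype.card_pos
  have hnn : ∀ y, 0 ≤ v y := fun y => by simpa [hv0, hT0] using hv 0 y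
  have hh : 0 ≤ h := (hnn _).trans (hb i)
  set y := ∑ j, c j • b j with hy
  have hcpos : ∀ j, 0 < c j := fun j => lt_of_lt_of_le (by positivity) (hc j).1
  have hsum : ∑ j, c j ≤ 1 / 2 := by
    have h1 : ∑ j, c j ≤ ∑ _j : ι, (1 / (2 * Fintype.card ι) : ℝ) :=
      Finset.sum_le_sum fun j _ => (hc j).2
    refine h1.trans (le_of_eq ?_)
    rw [Finset.sum_const, Finset.card_univ, nsmul_eq_mul]
    field_simp
  have hyz : ∀ z, ⟪z, y⟫ = ∑ j, c j * ⟪z, b j⟫ := fun z => by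
    simp only [hy, inner_sum, real_inner_smul_right]
  have hS : ⟪T y, y⟫ = ∑ j, c j * ⟪T y, b j⟫ := hyz _
  have hS0 : v y ≤ ⟪T y, y⟫ := by
    have := hv y 0
    simp only [hv0, zero_sub, inner_neg_right] at this
    linarith
  have hX : ∀ j, ⟪T y, b j⟫ ≤ h + ⟪T y, y⟫ := by
    intro j
    have h1 := hv y (b j)
    rw [inner_sub_right] at h1
    linarith [hb j, hnn y]
  have hTy : 0 ≤ ⟪T y, y⟫ := (hnn y).trans hS0
  have hSh : ⟪T y, y⟫ ≤ h := by
    have h1 : ⟪T y, y⟫ ≤ ∑ j, c j * (h + ⟪T y, y⟫) := by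
      conv_lhs => rw [hS]
      exact Finset.sum_le_sum fun j _ => mul_le_mul_of_nonneg_left (hX j) (hcpos j).le
    rw [← Finset.sum_mul] at h1
    nlinarith
  have hX2 : ∀ j, ⟪T y, b j⟫ ≤ 2 * h := fun j => by linarith [hX j]
  rw [abs_le]
  constructor
  · classical
    have h1 : ⟪T y, y⟫ ≤ c i * ⟪T y, b i⟫ + ∑ j ∈ Finset.univ.erase i, c j * (2 * h) := by
      conv_lhs => rw [hS]
      rw [← Finset.add_sum_erase _ _ (Finset.mem_univ i)]
      gcongr with j hj
      · exact (hcpos j).le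
      · exact hX2 j
    have h2 : ∑ j ∈ Finset.univ.erase i, c j ≤ ∑ j, c j :=
      Finset.sum_le_sum_of_subset_of_nonneg (Finset.erase_subset _ _) fun j _ _ => (hcpos j).le
    rw [← Finset.sum_mul] at h1
    have h3 : -h ≤ c i * ⟪T y, b i⟫ := by nlinarith
    have h4 : 1 ≤ c i * (4 * Fintype.card ι) := by
      have := (hc i).1
      rwa [div_le_iff₀ (by positivity)] at this
    by_contra! hlt
    have h5 := mul_lt_mul_of_pos_left hlt (hcpos i)
    nlinarith
  · nlinarith [hX2 i]

variable [FiniteDimensional ℝ V] [MeasurableSpace V] [BorelSpace V]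

/-- The volume of a sublevel set of a convex function is controlled by its height when its
Monge–Ampère measure is bounded below. -/
theorem OrthonormalBasis.exists_mul_det_sq_le [Nonempty ι] (e : OrthonormalBasis ι ℝ V) :
    ∃ C : ℝ, 0 < C ∧ ∀ (v : V → ℝ) (T : V → V), IsSubgradientMap v T → v 0 = 0 → T 0 = 0 →
      ∀ (L : V ≃ₗ[ℝ] V) (h r lam : ℝ), 0 < h → 0 ≤ lam → (∀ i, v (L (e i)) ≤ h) →
      (∀ i, ‖L (e i)‖ < r) →
      (∀ A ⊆ ball 0 r, MeasurableSet A → ENNReal.ofReal lam * volume A ≤ volume (T '' A)) →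
      lam * LinearMap.det (L : V →ₗ[ℝ] V) ^ 2 ≤ C * h ^ Fintype.card ι := by
  set N := Fintype.card ι with hN
  have hcard : (1 : ℝ) ≤ N := by exact_mod_cast Fintype.card_pos
  have hfin : finrank ℝ V = N := finrank_eq_card_basis e.toBasis
  have : Nontrivial V := nontrivial_of_finrank_pos (R := ℝ)
    (by rw [hfin, hN]; exact Fintype.card_pos)
  set x0 : V := ∑ j, (3 / (8 * N) : ℝ) • e j with hx0
  set Q : Set V := closedBall x0 (1 / (8 * N)) with hQ
  have hQpos : 0 < volume Q := measure_closedBall_pos _ _ (by positivity)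
  have hQfin : volume Q ≠ ⊤ := measure_closedBall_lt_top.ne
  have hBpos : 0 < volume (ball (0 : V) 1) := measure_ball_pos _ _ one_pos
  have hBfin : volume (ball (0 : V) 1) ≠ ⊤ := measure_ball_lt_top.ne
  refine ⟨(4 * N * N) ^ N * (volume (ball (0 : V) 1)).toReal / (volume Q).toReal, ?_, ?_⟩
  · have h1 := ENNReal.toReal_pos hBpos.ne' hBfin
    have h2 := ENNReal.toReal_pos hQpos.ne' hQfin
    positivity
  intro v T hv hv0 hT0 L h r lam hh hlam hLh hLr hMA
  set Lc : V →L[ℝ] V := LinearMap.toContinuousLinearMap (L : V →ₗ[ℝ] V) with hLc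
  have hcoord : ∀ x ∈ Q, ∀ i, ⟪e i, x⟫ ∈ Icc (1 / (4 * N) : ℝ) (1 / (2 * N)) := by
    intro x hx i
    have h1 : ⟪e i, x0⟫ = 3 / (8 * N) := by
      classical
      rw [hx0, inner_sum]
      simp [real_inner_smul_right, e.inner_eq_ite]
    have h2 : |⟪e i, x - x0⟫| ≤ 1 / (8 * N) := by
      refine (abs_real_inner_le_norm _ _).trans ?_
      rw [e.orthonormal.1 i, one_mul]
      exact mem_closedBall_iff_norm.1 hx
    rw [inner_sub_right, h1, abs_le] at h2
    have h3 : (1 / (4 * N) : ℝ) = 3 / (8 * N) - 1 / (8 * N) := by field_simp; norm_num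
    have h4 : (1 / (2 * N) : ℝ) = 3 / (8 * N) + 1 / (8 * N) := by field_simp; norm_num
    rw [h3, h4]
    constructor <;> linarith [h2.1, h2.2]
  have hLx : ∀ x, Lc x = ∑ j, ⟪e j, x⟫ • L (e j) := by
    intro x
    conv_lhs => rw [← e.sum_repr' x, map_sum]
    simp [hLc]
  have hsub : Lc '' Q ⊆ ball 0 r := by
    rintro _ ⟨x, hx, rfl⟩
    rw [mem_ball_zero_iff, hLx]
    have hr : 0 < r := (norm_nonneg _).trans_lt (hLr (Classical.arbitrary ι))
    refine (norm_sum_le _ _).trans_lt ?_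
    have h1 : ∑ j, ‖⟪e j, x⟫ • L (e j)‖ ≤ ∑ _j : ι, 1 / (2 * N) * r := by
      refine Finset.sum_le_sum fun j _ => ?_
      have h2 := hcoord x hx j
      have h3 : 0 ≤ ⟪e j, x⟫ := le_trans (by positivity) h2.1
      rw [norm_smul, Real.norm_of_nonneg h3]
      exact mul_le_mul h2.2 (hLr j).le (norm_nonneg _) (by positivity)
    refine h1.trans_lt ?_
    rw [Finset.sum_const, Finset.card_univ, nsmul_eq_mul, ← hN]
    field_simp
    linarith
  have hinc : ContinuousLinearMap.adjoint Lc '' (T '' (Lc '' Q)) ⊆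
      closedBall 0 (h * (4 * N * N)) := by
    rw [image_image, image_image]
    rintro _ ⟨x, hx, rfl⟩
    rw [mem_closedBall_zero_iff]
    have h1 : ∀ i, |⟪ContinuousLinearMap.adjoint Lc (T (Lc x)), e i⟫| ≤ 4 * N * h := by
      intro i
      rw [ContinuousLinearMap.adjoint_inner_left, hLx]
      exact abs_inner_le_of_coord_mem_Icc hv hv0 hT0 hLh (hcoord x hx) i
    refine abs_le_of_sq_le_sq' ?_ (by positivity) |>.2
    rw [← e.sum_sq_inner_left]
    have h2 : ∀ i, ⟪ContinuousLinearMap.adjoint Lc (T (Lc x)), e i⟫ ^ 2 ≤ (4 * N * h) ^ 2 := by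
      intro i
      rw [← sq_abs]
      exact pow_le_pow_left₀ (abs_nonneg _) (h1 i) 2
    refine (Finset.sum_le_sum fun i _ => h2 i).trans ?_
    rw [Finset.sum_const, Finset.card_univ, nsmul_eq_mul, ← hN]
    nlinarith [sq_nonneg ((4 : ℝ) * N * h), mul_nonneg (sub_nonneg.2 hcard)
      (sq_nonneg ((4 : ℝ) * N * h))]
  have hdet : Lc.det = LinearMap.det (L : V →ₗ[ℝ] V) := rfl
  have hvol := measure_mono (μ := volume) hinc
  have hv1 : volume (ContinuousLinearMap.adjoint Lc '' (T '' (Lc '' Q))) =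
      ENNReal.ofReal |Lc.det| * volume (T '' (Lc '' Q)) := by
    rw [← ContinuousLinearMap.det_adjoint_real]
    exact Measure.addHaar_image_continuousLinearMap _ _ _
  have hv2 : volume (Lc '' Q) = ENNReal.ofReal |Lc.det| * volume Q :=
    Measure.addHaar_image_continuousLinearMap _ _ _
  rw [hv1, Measure.addHaar_closedBall _ _ (by positivity), hfin] at hvol
  have hmQ : MeasurableSet (Lc '' Q) :=
    ((isCompact_closedBall _ _).image Lc.continuous).isClosed.measurableSet
  have h1 := (mul_le_mul_right (hMA _ hsub hmQ) (ENNReal.ofReal |Lc.det|)).trans hvol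
  rw [hv2, ← mul_assoc, ← mul_assoc, ← ENNReal.ofReal_mul (abs_nonneg _),
    ← ENNReal.ofReal_mul (by positivity)] at h1
  have h2 := ENNReal.toReal_mono (ENNReal.mul_ne_top ENNReal.ofReal_ne_top hBfin) h1
  rw [ENNReal.toReal_mul, ENNReal.toReal_mul, ENNReal.toReal_ofReal (by positivity),
    ENNReal.toReal_ofReal (by positivity)] at h2
  have h3 := ENNReal.toReal_pos hQpos.ne' hQfin
  rw [div_mul_eq_mul_div, le_div_iff₀ h3, ← hdet, ← sq_abs]
  calc lam * |Lc.det| ^ 2 * (volume Q).toReal = |Lc.det| * lam * |Lc.det| * (volume Q).toReal := by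
        ring
    _ ≤ _ := h2
    _ = _ := by rw [mul_pow]; ring

end Volume

section Touching

variable {V : Type*} [NormedAddCommGroup V] [InnerProductSpace ℝ V] [FiniteDimensional ℝ V]

theorem norm_adjoint_apply_self_le_of_ball_subset (B : V →L[ℝ] V) {S : Set V} {r β : ℝ}
    (hr : 0 < r) (hβ : 0 ≤ β) (hS : closedBall 0 r ⊆ S) (hB : ∀ y ∈ S, ‖B y‖ ≤ β) {x : V}
    (hx : x ∈ S) : ‖ContinuousLinearMap.adjoint B (B x)‖ ≤ β ^ 2 / r := by
  have h1 : ‖B‖ ≤ β / r := by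
    refine B.opNorm_le_bound' (by positivity) fun y hy => ?_
    have hy' : 0 < ‖y‖ := lt_of_le_of_ne (norm_nonneg y) (Ne.symm hy)
    have h2 := hB ((r / ‖y‖) • y) (hS (by
      rw [mem_closedBall_zero_iff, norm_smul, Real.norm_of_nonneg (by positivity)]
      field_simp; exact le_rfl))
    rw [map_smul, norm_smul, Real.norm_of_nonneg (by positivity)] at h2
    rw [div_mul_eq_mul_div, le_div_iff₀ hr]
    rw [div_mul_eq_mul_div, div_le_iff₀ hy'] at h2
    linarith
  calc ‖ContinuousLinearMap.adjoint B (B x)‖ ≤ ‖ContinuousLinearMap.adjoint B‖ * ‖B x‖ :=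
        ContinuousLinearMap.le_opNorm _ _
    _ ≤ β / r * β := by
        rw [LinearIsometryEquiv.norm_map]
        exact mul_le_mul h1 (hB x hx) (norm_nonneg _) (by positivity)
    _ = β ^ 2 / r := by ring

theorem isSubgradientMap_quadratic (B : V →L[ℝ] V) (b : V) (κ : ℝ) {s : ℝ} (hs : 0 ≤ s) :
    IsSubgradientMap (fun x => ‖B x‖ ^ 2 / 2 + ⟪b, x⟫ + κ + s * ‖x‖ ^ 2)
      (fun x => ContinuousLinearMap.adjoint B (B x) + b + (2 * s) • x) := by
  intro x y
  have h2 : ‖B y‖ ^ 2 = ‖B x‖ ^ 2 + 2 * ⟪B x, B (y - x)⟫ + ‖B (y - x)‖ ^ 2 := by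
    rw [← norm_add_sq_real, ← map_add, add_sub_cancel]
  have h5 : ‖y‖ ^ 2 = ‖x‖ ^ 2 + 2 * ⟪x, y - x⟫ + ‖y - x‖ ^ 2 := by
    rw [← norm_add_sq_real, add_sub_cancel]
  have h4 : ⟪b, y - x⟫ = ⟪b, y⟫ - ⟪b, x⟫ := inner_sub_right _ _ _
  have h6 := mul_nonneg hs (sq_nonneg ‖y - x‖)
  simp only [inner_add_left, real_inner_smul_left, ContinuousLinearMap.adjoint_inner_left, h4, h2,
    h5]
  nlinarith [sq_nonneg ‖B (y - x)‖]

variable [MeasurableSpace V] [BorelSpace V]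

set_option maxHeartbeats 800000 in
/-- The local form of the strong maximum principle, normalized so that the contact point is the
origin and `v` vanishes there to first order: contact is impossible if the functions are separated
on a half space near the contact point. -/
theorem not_touching_at_zero (hN : 0 < finrank ℝ V)
    {u v : V → ℝ} {gu gv : V → V}
    (hu : IsStrictSubgradientMap u gu) (hgu : Continuous gu)
    (hv : IsStrictSubgradientMap v gv) (hgv : Continuous gv)
    (hv0 : v 0 = 0) (hgv0 : gv 0 = 0) (hu0 : u 0 = 0) {R : ℝ} (hR : 0 < R)
    (huv : ∀ x ∈ ball (0 : V) R, v x ≤ u x) {p : V} (hp : p ≠ 0)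
    (hsep : ∀ x ∈ ball (0 : V) R, v x < ⟪p, x⟫ → v x < u x)
    {f Hu Hv : V → ℝ} {lam Lam Lc : ℝ} (hf : Measurable f) (hlam : 0 < lam)
    (hf1 : ∀ x ∈ ball 0 R, lam ≤ f x) (hf2 : ∀ x ∈ ball 0 R, f x ≤ Lam)
    (hMAu : ∀ A ⊆ ball 0 R, MeasurableSet A →
      volume (gu '' A) ≤ ∫⁻ x in A, ENNReal.ofReal (f x * Hu x))
    (hMAv : ∀ A ⊆ ball 0 R, MeasurableSet A →
      ∫⁻ x in A, ENNReal.ofReal (f x * Hv x) ≤ volume (gv '' A))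
    (hHu : ∀ x ∈ ball 0 R, ContinuousAt Hu x) (hHv : ∀ x ∈ ball 0 R, ContinuousAt Hv x)
    (hpos : 0 < Hv 0) (hLc : 0 ≤ Lc)
    (hLip : ∀ x ∈ ball 0 R, Hu x ≤ Hv x + Lc * (|u x - v x| + ‖gu x - gv x‖)) : False := by
  have : Nontrivial V := nontrivial_of_finrank_pos (R := ℝ) hN
  have : Nonempty (Fin (finrank ℝ V)) := ⟨⟨0, hN⟩⟩
  set N := finrank ℝ V with hNdef
  have hN1 : (1 : ℝ) ≤ N := by exact_mod_cast hN
  set e := stdOrthonormalBasis ℝ V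
  have huc : Continuous u := hu.isSubgradientMap.continuous hgu
  have hvc : Continuous v := hv.isSubgradientMap.continuous hgv
  have hp0 : 0 < ‖p‖ := norm_pos_iff.2 hp
  set Hm := Hv 0 with hHm
  have hLam : 0 < Lam := hlam.trans_le ((hf1 0 (mem_ball_self hR)).trans (hf2 0 (mem_ball_self hR)))
  obtain ⟨R1, hR1, hR1R, hHb⟩ : ∃ R1, 0 < R1 ∧ R1 ≤ R ∧
      ∀ x ∈ ball (0 : V) R1, Hm / 2 < Hv x ∧ Hv x < 2 * Hm := by
    have h0 := hHv 0 (mem_ball_self hR)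
    obtain ⟨r, hr, hrs⟩ := Metric.eventually_nhds_iff_ball.1
      ((h0.eventually_const_lt (by linarith : Hm / 2 < Hv 0)).and
        (h0.eventually_lt_const (by linarith : Hv 0 < 2 * Hm)))
    exact ⟨min r R, lt_min hr hR, min_le_right _ _, fun x hx =>
      hrs x (ball_subset_ball (min_le_left _ _) hx)⟩
  have hRR : ball (0 : V) R1 ⊆ ball 0 R := ball_subset_ball hR1R
  obtain ⟨C, hC, hvolC⟩ := e.exists_mul_det_sq_le
  rw [Fintype.card_fin] at hvolC
  -- the steepness
  set a : ℝ := 1 / (2 * N) with ha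
  have hapos : 0 < a := by positivity
  set k : ℝ := a ^ (N - 1) / N with hk
  have hkpos : 0 < k := by positivity
  obtain ⟨A, hA1, hAk⟩ : ∃ A : ℝ, 1 ≤ A ∧
      2 ^ N * (2 * Hm) * Lam * C ≤ (k * A) ^ 2 * (lam * (Hm / 2)) := by
    set X := 2 ^ N * (2 * Hm) * Lam * C
    set Y := k ^ 2 * (lam * (Hm / 2)) with hY
    have hYpos : 0 < Y := by positivity
    refine ⟨max 1 (X / Y), le_max_left _ _, ?_⟩
    have h1 : X / Y ≤ max 1 (X / Y) := le_max_right _ _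
    have h2 : (1 : ℝ) ≤ max 1 (X / Y) := le_max_left _ _
    generalize max 1 (X / Y) = A at h1 h2
    rw [div_le_iff₀ hYpos] at h1
    have h3 : (k * A) ^ 2 * (lam * (Hm / 2)) = A ^ 2 * Y := by rw [hY]; ring
    have h4 : A * Y ≤ A ^ 2 * Y := mul_le_mul_of_nonneg_right (by nlinarith) hYpos.le
    rw [h3]
    linarith
  have hA0 : 0 < A := by linarith
  have hAsq : 1 ≤ A ^ 2 := one_le_pow₀ hA1
  -- the slope bound
  obtain ⟨η, hη, hη1, hη2⟩ : ∃ η : ℝ, 0 < η ∧ 8 * A ^ 2 * η ≤ ‖p‖ ∧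
      Lc * (9 * A ^ 2 * η) < Hm / 2 := by
    refine ⟨min (‖p‖ / (8 * A ^ 2)) (Hm / (20 * A ^ 2 * (Lc + 1))), by positivity, ?_, ?_⟩
    · calc 8 * A ^ 2 * min (‖p‖ / (8 * A ^ 2)) _ ≤ 8 * A ^ 2 * (‖p‖ / (8 * A ^ 2)) := by
            gcongr; exact min_le_left _ _
        _ = ‖p‖ := by field_simp
    · calc Lc * (9 * A ^ 2 * min _ (Hm / (20 * A ^ 2 * (Lc + 1))))
          ≤ Lc * (9 * A ^ 2 * (Hm / (20 * A ^ 2 * (Lc + 1)))) := by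
            gcongr; exact min_le_right _ _
        _ = (Lc / (Lc + 1)) * (9 / 20 * Hm) := by field_simp
        _ ≤ 1 * (9 / 20 * Hm) := by
            gcongr; rw [div_le_one (by linarith)]; linarith
        _ < Hm / 2 := by linarith
  obtain ⟨r0, hr0, hr0R, hgη⟩ : ∃ r0, 0 < r0 ∧ r0 < R1 ∧
      ∀ x ∈ closedBall (0 : V) r0, ‖gv x‖ ≤ η := by
    have h0 : ContinuousAt (fun x => ‖gv x‖) 0 := hgv.norm.continuousAt
    obtain ⟨r, hr, hrs⟩ := Metric.eventually_nhds_iff_ball.1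
      (h0.eventually_lt_const (by simpa [hgv0] using hη : ‖gv 0‖ < η))
    refine ⟨min r R1 / 2, by positivity, by linarith [min_le_right r R1], fun x hx => ?_⟩
    refine (hrs x (closedBall_subset_ball ?_ hx)).le
    have := min_le_left r R1
    have := lt_min hr hR1
    linarith
  have hballR : closedBall (0 : V) r0 ⊆ ball 0 R1 := closedBall_subset_ball hr0R
  have hvnn : ∀ y, 0 ≤ v y := fun y => by simpa [hv0, hgv0] using hv.isSubgradientMap 0 y
  -- the height
  obtain ⟨c0, hc0, hc0s⟩ : ∃ c0 : ℝ, 0 < c0 ∧ ∀ x ∈ sphere (0 : V) r0, c0 ≤ v x := by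
    obtain ⟨z, hz, hzm⟩ := (isCompact_sphere (0 : V) r0).exists_isMinOn
      (NormedSpace.sphere_nonempty.2 hr0.le) hvc.continuousOn
    refine ⟨v z, ?_, fun x hx => hzm hx⟩
    have hz0 : (0 : V) ≠ z := fun h => by simp [← h] at hz; linarith
    simpa [hv0, hgv0] using hv 0 z hz0
  obtain ⟨h, hh, hhc0, hhη, hhr0⟩ : ∃ h : ℝ, 0 < h ∧ h < c0 ∧ h ≤ η ∧ h / η ≤ r0 := by
    refine ⟨min (c0 / 2) (min η (η * r0)), by positivity, ?_, ?_, ?_⟩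
    · exact (min_le_left _ _).trans_lt (by linarith)
    · exact (min_le_right _ _).trans (min_le_left _ _)
    · rw [div_le_iff₀ hη]
      exact ((min_le_right _ _).trans (min_le_right _ _)).trans_eq (mul_comm _ _)
  set S : Set V := {x ∈ closedBall (0 : V) r0 | v x ≤ h} with hS
  have hScomp : IsCompact S :=
    (isCompact_closedBall (0 : V) r0).inter_right (isClosed_le hvc continuous_const)
  have hrh : 0 < h / η := by positivity
  have hballS : closedBall (0 : V) (h / η) ⊆ S := by
    intro x hx
    have hx' := closedBall_subset_closedBall hhr0 hx
    refine ⟨hx', ?_⟩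
    have h1 := hv.isSubgradientMap x 0
    rw [hv0, zero_sub, inner_neg_right] at h1
    have h2 := real_inner_le_norm (gv x) x
    have h3 := mul_le_mul (hgη x hx') (mem_closedBall_zero_iff.1 hx) (norm_nonneg x) hη.le
    rw [mul_div_cancel₀ _ hη.ne'] at h3
    linarith
  obtain ⟨L, B0, M, hLS, hM, hpM, hB0, hdet⟩ := e.exists_steep_normalization hScomp hrh hballS hp
    hapos (by
      rw [Fintype.card_fin, ha]
      have : 2 * (N : ℝ) * (1 / (2 * N)) ^ 2 = 1 / (2 * N) := by field_simp
      rw [this, div_le_one (by positivity)]; linarith) hA0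
  rw [Fintype.card_fin] at hdet
  have hMpos : 0 < M := lt_of_lt_of_le (by positivity) hM
  have hpM' : ‖p‖ * h ≤ M * η := by
    rw [← mul_div_assoc, div_le_iff₀ hη] at hM; exact hM
  have hτ : ∀ y ∈ S, |⟪p, y⟫ / M| ≤ 1 := by
    intro y hy
    rw [abs_div, abs_of_pos hMpos, div_le_one hMpos]; exact hpM y hy
  have hvolL := hvolC v gv hv.isSubgradientMap hv0 hgv0 L h R1 (lam * (Hm / 2)) hh (by positivity)
    (fun i => (hLS i).2) (fun i => mem_ball_zero_iff.1 (hballR (hLS i).1)) (by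
      intro E hE hEm
      refine le_trans ?_ (hMAv E (hE.trans hRR) hEm)
      rw [← setLIntegral_const]
      refine setLIntegral_mono' hEm fun x hx => ENNReal.ofReal_le_ofReal ?_
      have h1 := hf1 x (hRR (hE hx))
      exact mul_le_mul h1 (hHb x (hE hx)).1.le (by positivity) (by linarith))
  set dB := LinearMap.det (B0 : V →ₗ[ℝ] V)
  set dL := LinearMap.det (L : V →ₗ[ℝ] V)
  have hdetB : 2 ^ N * (2 * Hm) * Lam ≤ h ^ N * dB ^ 2 := by
    have h1 : (k * A) ^ 2 ≤ dB ^ 2 * dL ^ 2 := by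
      refine le_trans (le_of_eq ?_) hdet
      rw [hk]; ring
    have h2 : 2 ^ N * (2 * Hm) * Lam * C ≤ h ^ N * dB ^ 2 * C := by
      calc 2 ^ N * (2 * Hm) * Lam * C ≤ (k * A) ^ 2 * (lam * (Hm / 2)) := hAk
        _ ≤ dB ^ 2 * dL ^ 2 * (lam * (Hm / 2)) := by gcongr
        _ = dB ^ 2 * (lam * (Hm / 2) * dL ^ 2) := by ring
        _ ≤ dB ^ 2 * (C * h ^ N) := by gcongr
        _ = _ := by ring
    exact le_of_mul_le_mul_right h2 hC
  obtain ⟨s, hs, hs1, hs2⟩ : ∃ s : ℝ, 0 < s ∧ s * r0 ^ 2 ≤ h / 8 ∧ 2 * s * r0 ≤ η := by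
    refine ⟨min (h / (8 * r0 ^ 2)) (η / (2 * r0)), by positivity, ?_, ?_⟩
    · calc min (h / (8 * r0 ^ 2)) _ * r0 ^ 2 ≤ h / (8 * r0 ^ 2) * r0 ^ 2 := by
            gcongr; exact min_le_left _ _
        _ = h / 8 := by field_simp
    · calc 2 * min _ (η / (2 * r0)) * r0 ≤ 2 * (η / (2 * r0)) * r0 := by
            gcongr; exact min_le_right _ _
        _ = η := by field_simp
  have hsh : (√h) ^ 2 = h := Real.sq_sqrt hh.le
  set Bc : V ≃L[ℝ] V := (B0.trans (LinearEquiv.smulOfNeZero ℝ V (√h)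
    (by positivity))).toContinuousLinearEquiv with hBc
  have hBcapp : ∀ x, Bc x = √h • B0 x := fun x => rfl
  have hBcn : ∀ x, ‖Bc x‖ ^ 2 = h * ‖B0 x‖ ^ 2 := by
    intro x
    rw [hBcapp, norm_smul, mul_pow, Real.norm_of_nonneg (Real.sqrt_nonneg _), hsh]
  have hBcdet : (Bc : V →L[ℝ] V).det ^ 2 = h ^ N * dB ^ 2 := by
    have h1 : (Bc : V →L[ℝ] V).det = √h ^ N * dB := by
      have h2 : ((Bc : V →L[ℝ] V) : V →ₗ[ℝ] V) = √h • (B0 : V →ₗ[ℝ] V) := by ext x; rfl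
      rw [ContinuousLinearMap.det, h2, LinearMap.det_smul]
    rw [h1, mul_pow, ← pow_mul, mul_comm N 2, pow_mul, hsh]
  set K : ℝ := h * (A ^ 2 / 2) / M with hK
  set ψ : V → ℝ := fun x => ‖Bc x‖ ^ 2 / 2 + ⟪K • p, x⟫ + h / 4 + s * ‖x‖ ^ 2 with hψ
  have hψeq : ∀ x, ψ x = h * (1 / 4 + A ^ 2 / 2 * (⟪p, x⟫ / M) + ‖B0 x‖ ^ 2 / 2) +
      s * ‖x‖ ^ 2 := by
    intro x
    simp only [hψ, hBcn, real_inner_smul_left, hK]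
    ring
  have hsx : ∀ x ∈ S, s * ‖x‖ ^ 2 ≤ h / 8 := by
    intro x hx
    refine le_trans ?_ hs1
    have := mem_closedBall_zero_iff.1 hx.1
    gcongr
  have hψ0 : ∀ x ∈ S, ψ x ≤ h * (1 / 4 + 1 / 4 + A ^ 2 / 2 * (⟪p, x⟫ / M + (⟪p, x⟫ / M) ^ 2)
      + 1 / 8) := by
    intro x hx
    rw [hψeq]
    have h1 := hB0 x hx
    have h2 := hsx x hx
    have h3 := mul_le_mul_of_nonneg_left h1 hh.le
    linarith
  have hψmax : ∀ x ∈ S, ψ x ≤ h * (1 + A ^ 2) := by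
    intro x hx
    refine (hψ0 x hx).trans ?_
    have h1 := abs_le.1 (hτ x hx)
    have h2 : (⟪p, x⟫ / M) ^ 2 ≤ 1 := (sq_le_one_iff_abs_le_one _).2 (hτ x hx)
    have h3 : A ^ 2 / 2 * (⟪p, x⟫ / M + (⟪p, x⟫ / M) ^ 2) ≤ A ^ 2 / 2 * 2 :=
      mul_le_mul_of_nonneg_left (by linarith) (by positivity)
    exact mul_le_mul_of_nonneg_left (by linarith) hh.le
  have hψsmall : ∀ x ∈ S, ⟪p, x⟫ < 2 * h → ψ x < h := by
    intro x hx hxp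
    refine (hψ0 x hx).trans_lt ?_
    have h1 := abs_le.1 (hτ x hx)
    have h2 : 4 * A ^ 2 * (⟪p, x⟫ / M) ≤ 1 := by
      rw [← mul_div_assoc, div_le_one hMpos]
      have h3 : 8 * A ^ 2 * η * h ≤ M * η := (mul_le_mul_of_nonneg_right hη1 hh.le).trans hpM'
      have h4 : 8 * A ^ 2 * h ≤ M := le_of_mul_le_mul_right (by linarith) hη
      have h5 : 4 * A ^ 2 * ⟪p, x⟫ ≤ 4 * A ^ 2 * (2 * h) := by gcongr
      linarith
    set τ := ⟪p, x⟫ / M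
    have h5 : A ^ 2 / 2 * (τ + τ ^ 2) ≤ 1 / 4 := by
      rcases le_total τ 0 with h6 | h6
      · have h7 : τ * (1 + τ) ≤ 0 := mul_nonpos_of_nonpos_of_nonneg h6 (by linarith)
        have h8 : A ^ 2 / 2 * (τ * (1 + τ)) ≤ 0 :=
          mul_nonpos_of_nonneg_of_nonpos (by positivity) h7
        linarith
      · have h7 : τ * τ ≤ τ * 1 := mul_le_mul_of_nonneg_left h1.2 h6
        have h8 : A ^ 2 / 2 * (τ * τ) ≤ A ^ 2 / 2 * (τ * 1) := by gcongr
        linarith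
    calc _ ≤ h * (7 / 8) := mul_le_mul_of_nonneg_left (by linarith) hh.le
      _ < h := by linarith
  have hψsub : IsSubgradientMap ψ _ :=
      isSubgradientMap_quadratic (Bc : V →L[ℝ] V) (K • p) (h / 4) hs.le
  have hψgc : Continuous (fun x => ContinuousLinearMap.adjoint (Bc : V →L[ℝ] V) (Bc x) + K • p +
      (2 * s) • x) := by
    have := Bc.continuous
    fun_prop
  have hψc : Continuous ψ := hψsub.continuous hψgc
  -- separation on the far part of the boundary
  obtain ⟨c, hc, hcS⟩ : ∃ c : ℝ, 0 < c ∧ ∀ x ∈ S, 2 * h ≤ ⟪p, x⟫ → c ≤ u x - v x := by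
    have hcomp : IsCompact (S ∩ {x | 2 * h ≤ ⟪p, x⟫}) :=
      hScomp.inter_right (isClosed_le continuous_const (by fun_prop))
    rcases (S ∩ {x | 2 * h ≤ ⟪p, x⟫}).eq_empty_or_nonempty with he | hne
    · refine ⟨1, one_pos, fun x hx hxp => ?_⟩
      have : x ∈ S ∩ {x | 2 * h ≤ ⟪p, x⟫} := ⟨hx, hxp⟩
      simp [he] at this
    · obtain ⟨z, hz, hzm⟩ := hcomp.exists_isMinOn hne (huc.sub hvc).continuousOn
      refine ⟨u z - v z, ?_, fun x hx hxp => hzm ⟨hx, hxp⟩⟩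
      have h1 : 2 * h ≤ ⟪p, z⟫ := hz.2
      have h2 := hsep z (hRR (hballR hz.1.1)) (by linarith [hz.1.2])
      linarith
  obtain ⟨ε, hε, hε1, hεc⟩ : ∃ ε : ℝ, 0 < ε ∧ ε < 1 ∧ ε * (h * (1 + A ^ 2)) ≤ c := by
    refine ⟨min (1 / 2) (c / (h * (1 + A ^ 2))), by positivity, ?_, ?_⟩
    · exact (min_le_left _ _).trans_lt (by norm_num)
    · calc min _ (c / (h * (1 + A ^ 2))) * (h * (1 + A ^ 2))
          ≤ c / (h * (1 + A ^ 2)) * (h * (1 + A ^ 2)) := by gcongr; exact min_le_right _ _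
        _ = c := by field_simp
  set w : V → ℝ := fun x => (1 - ε) * v x + ε * ψ x with hw
  have hwc : Continuous w := by fun_prop
  have h0S : (0 : V) ∈ S := hballS (mem_closedBall_self hrh.le)
  obtain ⟨xb, hxbS, hxbmax⟩ := hScomp.exists_isMaxOn ⟨0, h0S⟩ (hwc.sub huc).continuousOn
  have hxbpos : 0 < w xb - u xb := by
    have h1 : w 0 - u 0 ≤ w xb - u xb := hxbmax h0S
    refine lt_of_lt_of_le ?_ h1
    have h2 : w 0 - u 0 = ε * h / 4 := by
      simp only [hw, hψeq, hv0, hu0, map_zero, inner_zero_right, norm_zero, zero_div]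
      ring
    rw [h2]
    positivity
  have hxbR : xb ∈ ball (0 : V) R := hRR (hballR hxbS.1)
  have huvb := huv xb hxbR
  have hxbh : v xb < h := by
    refine lt_of_le_of_ne hxbS.2 fun heq => ?_
    rcases lt_or_ge ⟪p, xb⟫ (2 * h) with h1 | h1
    · have h2 := hψsmall xb hxbS h1
      have h3 : ε * (ψ xb - v xb) ≤ 0 := mul_nonpos_of_nonneg_of_nonpos hε.le (by linarith)
      simp only [hw] at hxbpos
      linarith
    · have h2 := hcS xb hxbS h1
      have h3 := mul_le_mul_of_nonneg_left (hψmax xb hxbS) hε.le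
      have h4 := mul_nonneg hε.le (hvnn xb)
      simp only [hw] at hxbpos
      linarith
  have hxbr : ‖xb‖ < r0 := by
    refine lt_of_le_of_ne (mem_closedBall_zero_iff.1 hxbS.1) fun heq => ?_
    have := hc0s xb (by simp [heq])
    linarith
  obtain ⟨r', hr', hr'S⟩ : ∃ r', 0 < r' ∧ closedBall xb r' ⊆ S := by
    have hopen : IsOpen {x : V | ‖x‖ < r0 ∧ v x < h} :=
      (isOpen_lt continuous_norm continuous_const).inter (isOpen_lt hvc continuous_const)
    obtain ⟨r', hr', hsub⟩ := Metric.nhds_basis_closedBall.mem_iff.1 (hopen.mem_nhds ⟨hxbr, hxbh⟩)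
    exact ⟨r', hr', fun x hx => ⟨mem_closedBall_zero_iff.2 (hsub hx).1.le, (hsub hx).2.le⟩⟩
  -- first order conditions
  set gψ : V → V := fun x => ContinuousLinearMap.adjoint (Bc : V →L[ℝ] V) (Bc x) + K • p +
      (2 * s) • x with hgψ
  have hgrad : gu xb = (1 - ε) • gv xb + ε • gψ xb := by
    have hmin : IsLocalMin (fun x => u x - w x) xb := by
      filter_upwards [closedBall_mem_nhds xb hr'] with x hx
      have h1 : w x - u x ≤ w xb - u xb := hxbmax (hr'S hx)
      linarith
    have hd := (hu.isSubgradientMap.hasFDerivAt hgu xb).sub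
      (((hv.isSubgradientMap.hasFDerivAt hgv xb).const_mul (1 - ε)).add
        ((hψsub.hasFDerivAt hψgc xb).const_mul ε))
    have h1 := hmin.hasFDerivAt_eq_zero hd
    rw [← sub_eq_zero]
    refine ext_inner_right ℝ fun z => ?_
    have h2 := congrArg (fun l => l z) h1
    simp only [sub_apply, add_apply, smul_apply, innerSL_apply_apply, smul_eq_mul,
      zero_apply] at h2
    rw [inner_sub_left, inner_add_left, real_inner_smul_left, real_inner_smul_left,
      inner_zero_left]
    exact h2
  have hgψb : ‖gψ xb‖ ≤ (4 * A ^ 2 + A ^ 2 / 2 + 1) * η := by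
    have h1 : ‖ContinuousLinearMap.adjoint (Bc : V →L[ℝ] V) (Bc xb)‖ ≤
        (√h * (A + 1)) ^ 2 / (h / η) := by
      refine norm_adjoint_apply_self_le_of_ball_subset (Bc : V →L[ℝ] V) hrh (by positivity) hballS
        (fun y hy => ?_) hxbS
      refine abs_le_of_sq_le_sq' ?_ (by positivity) |>.2
      change ‖Bc y‖ ^ 2 ≤ _
      rw [hBcn, mul_pow, hsh]
      have h2 := hB0 y hy
      have h3 := abs_le.1 (hτ y hy)
      have h4 : (⟪p, y⟫ / M) ^ 2 ≤ 1 := (sq_le_one_iff_abs_le_one _).2 (hτ y hy)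
      have h5 : A ^ 2 * (⟪p, y⟫ / M) ^ 2 ≤ A ^ 2 * 1 := by gcongr
      have h6 : (A + 1) ^ 2 = A ^ 2 + 2 * A + 1 := by ring
      exact mul_le_mul_of_nonneg_left (by linarith) hh.le
    have h2 : (√h * (A + 1)) ^ 2 / (h / η) = (A + 1) ^ 2 * η := by
      rw [mul_pow, hsh]; field_simp
    have h3 : ‖K • p‖ ≤ A ^ 2 / 2 * η := by
      rw [norm_smul, Real.norm_of_nonneg (by positivity), hK, div_mul_eq_mul_div,
        div_le_iff₀ hMpos]
      have h4 := mul_le_mul_of_nonneg_left hpM' (by positivity : 0 ≤ A ^ 2 / 2)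
      linarith
    have h4 : ‖(2 * s) • xb‖ ≤ η := by
      rw [norm_smul, Real.norm_of_nonneg (by positivity)]
      refine le_trans ?_ hs2
      gcongr
    have h6 : (A + 1) ^ 2 ≤ 4 * A ^ 2 := by
      have h7 : (A + 1) ^ 2 = A ^ 2 + 2 * A + 1 := by ring
      have h8 : A * 1 ≤ A * A := mul_le_mul_of_nonneg_left hA1 hA0.le
      linarith
    have h5 : (A + 1) ^ 2 * η ≤ 4 * A ^ 2 * η :=
      mul_le_mul_of_nonneg_right h6 hη.le
    calc ‖gψ xb‖ ≤ ‖ContinuousLinearMap.adjoint (Bc : V →L[ℝ] V) (Bc xb)‖ + ‖K • p‖ +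
          ‖(2 * s) • xb‖ := norm_add₃_le
      _ ≤ _ := by linarith
  have hgdiff : ‖gu xb - gv xb‖ ≤ ε * ((4 * A ^ 2 + A ^ 2 / 2 + 2) * η) := by
    have h1 : gu xb - gv xb = ε • (gψ xb - gv xb) := by
      rw [hgrad, sub_smul, one_smul, smul_sub]; abel
    rw [h1, norm_smul, Real.norm_of_nonneg hε.le]
    gcongr
    refine (norm_sub_le _ _).trans ?_
    linarith [hgη xb hxbS.1]
  have hudiff : |u xb - v xb| ≤ ε * (η * (1 + A ^ 2)) := by
    rw [abs_of_nonneg (by linarith)]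
    have h1 : ε * ψ xb ≤ ε * (η * (1 + A ^ 2)) := by
      gcongr
      exact (hψmax xb hxbS).trans (by gcongr)
    have h2 := mul_nonneg hε.le (hvnn xb)
    simp only [hw] at hxbpos
    linarith
  have hHlt : Hu xb < (1 + ε) * Hv xb := by
    have h1 := hLip xb hxbR
    have h2 := (hHb xb (hballR hxbS.1)).1
    have h3 : |u xb - v xb| + ‖gu xb - gv xb‖ ≤ ε * (9 * A ^ 2 * η) := by
      have h4 : ε * (η * (1 + A ^ 2)) + ε * ((4 * A ^ 2 + A ^ 2 / 2 + 2) * η) ≤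
          ε * (9 * A ^ 2 * η) := by
        rw [← mul_add]
        refine mul_le_mul_of_nonneg_left ?_ hε.le
        have h8 := mul_le_mul_of_nonneg_left hAsq hη.le
        linarith
      linarith
    have h5 := mul_le_mul_of_nonneg_left h3 hLc
    have h6 : Lc * (ε * (9 * A ^ 2 * η)) < ε * (Hm / 2) := by
      calc Lc * (ε * (9 * A ^ 2 * η)) = ε * (Lc * (9 * A ^ 2 * η)) := by ring
        _ < _ := mul_lt_mul_of_pos_left hη2 hε
    have h7 := mul_lt_mul_of_pos_left h2 hε
    linarith
  have hrball : ball xb r' ⊆ ball (0 : V) R := fun x hx =>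
    hRR (hballR (hr'S (ball_subset_closedBall hx)).1)
  have hHvb := hHb xb (hballR hxbS.1)
  refine not_touching_of_monge_ampere hN hu hgu hv hgv Bc (K • p + (2 * s) • xb)
    (h / 4 - s * ‖xb‖ ^ 2) hr' hε hε1 (mul_pos hε hs) (fun x hx => ?_) hf hlam
    (fun x hx => hf1 x (hrball hx)) (fun x hx => hf2 x (hrball hx))
    (fun E hE => hMAu E (hE.trans hrball)) (fun E hE => hMAv E (hE.trans hrball))
    (hHu xb hxbR) (hHv xb hxbR) (by linarith) hHlt ?_
  · have h1 : ∀ x, ‖Bc x‖ ^ 2 / 2 + ⟪K • p + (2 * s) • xb, x⟫ + (h / 4 - s * ‖xb‖ ^ 2) =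
        ψ x - s * ‖x - xb‖ ^ 2 := by
      intro x
      simp only [hψ, inner_add_left, real_inner_smul_left, norm_sub_sq_real,
        real_inner_comm x xb]
      ring
    have h2 : w x - u x ≤ w xb - u xb := hxbmax (hr'S hx)
    rw [h1, h1]
    simp only [hw] at h2
    simp only [sub_self, norm_zero]
    linarith
  · rw [hBcdet]
    refine le_trans ?_ hdetB
    gcongr
    exact hHvb.2.le

end Touching

section Translate

variable {V : Type*} [NormedAddCommGroup V] [InnerProductSpace ℝ V]

theorem IsStrictSubgradientMap.translate {u : V → ℝ} {g : V → V} (hu : IsStrictSubgradientMap u g)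
    (x₀ b : V) (c : ℝ) :
    IsStrictSubgradientMap (fun y => u (x₀ + y) - c - ⟪b, y⟫) (fun y => g (x₀ + y) - b) := by
  intro x y hxy
  have h1 := hu (x₀ + x) (x₀ + y) (by simpa using hxy)
  rw [add_sub_add_left_eq_sub] at h1
  have h2 : ⟪b, y - x⟫ = ⟪b, y⟫ - ⟪b, x⟫ := inner_sub_right _ _ _
  simp only [inner_sub_left]
  linarith

variable [FiniteDimensional ℝ V] [MeasurableSpace V] [BorelSpace V]

theorem setLIntegral_image_add_left (x₀ : V) (A : Set V) (F : V → ℝ≥0∞) :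
    ∫⁻ x in (fun y => x₀ + y) '' A, F x = ∫⁻ y in A, F (x₀ + y) :=
  (MeasurePreserving.setLIntegral_comp_emb (measurePreserving_add_left volume x₀)
    (measurableEmbedding_addLeft x₀) F A).symm

/-- Contact is impossible if the functions are separated near the contact point on the region where
`v` lies below a plane through the contact point whose slope is that of `v` at another point. -/
theorem not_touching_at (hN : 0 < finrank ℝ V)
    {u v : V → ℝ} {gu gv : V → V}
    (hu : IsStrictSubgradientMap u gu) (hgu : Continuous gu)
    (hv : IsStrictSubgradientMap v gv) (hgv : Continuous gv)
    {x₀ : V} (huv0 : u x₀ = v x₀) {R : ℝ} (hR : 0 < R)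
    (huv : ∀ x ∈ ball x₀ R, v x ≤ u x) {p : V} (hp : p ≠ gv x₀)
    (hsep : ∀ x ∈ ball x₀ R, v x - v x₀ < ⟪p, x - x₀⟫ → v x < u x)
    {f Hu Hv : V → ℝ} {lam Lam Lc : ℝ} (hf : Measurable f) (hlam : 0 < lam)
    (hf1 : ∀ x ∈ ball x₀ R, lam ≤ f x) (hf2 : ∀ x ∈ ball x₀ R, f x ≤ Lam)
    (hMAu : ∀ A ⊆ ball x₀ R, MeasurableSet A →
      volume (gu '' A) ≤ ∫⁻ x in A, ENNReal.ofReal (f x * Hu x))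
    (hMAv : ∀ A ⊆ ball x₀ R, MeasurableSet A →
      ∫⁻ x in A, ENNReal.ofReal (f x * Hv x) ≤ volume (gv '' A))
    (hHu : ∀ x ∈ ball x₀ R, ContinuousAt Hu x) (hHv : ∀ x ∈ ball x₀ R, ContinuousAt Hv x)
    (hpos : 0 < Hv x₀) (hLc : 0 ≤ Lc)
    (hLip : ∀ x ∈ ball x₀ R, Hu x ≤ Hv x + Lc * (|u x - v x| + ‖gu x - gv x‖)) : False := by
  have hmem : ∀ y ∈ ball (0 : V) R, x₀ + y ∈ ball x₀ R := fun y hy => by simpa using hy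
  have himg : ∀ A ⊆ ball (0 : V) R, (fun y => x₀ + y) '' A ⊆ ball x₀ R := by
    rintro A hA _ ⟨y, hy, rfl⟩; exact hmem y (hA hy)
  have hadd : Continuous fun y : V => x₀ + y := by fun_prop
  have hm : ∀ {A : Set V}, MeasurableSet A → MeasurableSet ((fun y => x₀ + y) '' A) := fun hA =>
    (measurableEmbedding_addLeft x₀).measurableSet_image.2 hA
  have hvol : ∀ (g : V → V) (A : Set V),
      volume ((fun y => g (x₀ + y) - gv x₀) '' A) = volume (g '' ((fun y => x₀ + y) '' A)) := by
    intro g A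
    rw [image_image, ← image_image (fun z => z - gv x₀) (fun y => g (x₀ + y))]
    simp only [sub_eq_add_neg, image_add_right, measure_preimage_add_right]
  refine not_touching_at_zero hN (hu.translate x₀ (gv x₀) (v x₀))
    ((hgu.comp hadd).sub continuous_const) (hv.translate x₀ (gv x₀) (v x₀))
    ((hgv.comp hadd).sub continuous_const) (f := fun y => f (x₀ + y))
    (Hu := fun y => Hu (x₀ + y)) (Hv := fun y => Hv (x₀ + y)) (by simp) (by simp) (by simp [huv0])
    hR (fun y hy => ?_) (p := p - gv x₀) (sub_ne_zero.2 hp) (fun y hy h => ?_)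
    (hf.comp hadd.measurable) hlam
    (fun y hy => hf1 _ (hmem y hy)) (fun y hy => hf2 _ (hmem y hy)) (fun A hA hAm => ?_)
    (fun A hA hAm => ?_) (fun y hy => ?_) (fun y hy => ?_) (by simpa using hpos) hLc
    (fun y hy => ?_)
  · have := huv _ (hmem y hy)
    linarith
  · rw [inner_sub_left] at h
    have := hsep _ (hmem y hy) (by rw [add_sub_cancel_left]; linarith)
    linarith
  · rw [hvol, ← setLIntegral_image_add_left x₀ A fun x => ENNReal.ofReal (f x * Hu x)]
    exact hMAu _ (himg A hA) (hm hAm)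
  · rw [hvol, ← setLIntegral_image_add_left x₀ A fun x => ENNReal.ofReal (f x * Hv x)]
    exact hMAv _ (himg A hA) (hm hAm)
  · exact (hHu _ (hmem y hy)).comp hadd.continuousAt
  · exact (hHv _ (hmem y hy)).comp hadd.continuousAt
  · have := hLip _ (hmem y hy)
    simpa using this

end Translate

section Global

variable {V : Type*} [NormedAddCommGroup V] [InnerProductSpace ℝ V] [FiniteDimensional ℝ V]
  [MeasurableSpace V] [BorelSpace V]

/-- A strong maximum principle for Monge-Ampère sub- and supersolutions: if `v ≤ u` touch at one
point of a connected open set, then they agree on it. -/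
theorem eqOn_of_monge_ampere (hN : 0 < finrank ℝ V)
    {u v : V → ℝ} {gu gv : V → V}
    (hu : IsStrictSubgradientMap u gu) (hgu : Continuous gu)
    (hv : IsStrictSubgradientMap v gv) (hgv : Continuous gv)
    {U : Set V} (hU : IsOpen U) (hUc : IsPreconnected U)
    (huv : ∀ x ∈ U, v x ≤ u x)
    {f Hu Hv : V → ℝ} {lam Lam : ℝ} (hf : Measurable f) (hlam : 0 < lam)
    (hf1 : ∀ x ∈ U, lam ≤ f x) (hf2 : ∀ x ∈ U, f x ≤ Lam)
    (hMAu : ∀ A ⊆ U, MeasurableSet A →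
      volume (gu '' A) ≤ ∫⁻ x in A, ENNReal.ofReal (f x * Hu x))
    (hMAv : ∀ A ⊆ U, MeasurableSet A →
      ∫⁻ x in A, ENNReal.ofReal (f x * Hv x) ≤ volume (gv '' A))
    (hHu : ContinuousOn Hu U) (hHv : ContinuousOn Hv U) (hpos : ∀ x ∈ U, 0 < Hv x)
    (hLip : ∀ x₀ ∈ U, u x₀ = v x₀ → ∃ Lc, 0 ≤ Lc ∧
      ∀ᶠ x in 𝓝 x₀, Hu x ≤ Hv x + Lc * (|u x - v x| + ‖gu x - gv x‖))
    {x₁ : V} (hx₁ : x₁ ∈ U) (hcontact : u x₁ = v x₁) : EqOn u v U := by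
  have huc : Continuous u := hu.isSubgradientMap.continuous hgu
  have hvc : Continuous v := hv.isSubgradientMap.continuous hgv
  have key : ∀ z ∈ U, u z = v z → ∀ᶠ x in 𝓝 z, u x = v x := by
    intro z hz hzc
    obtain ⟨r, hr, hrU⟩ := Metric.nhds_basis_closedBall.mem_iff.1 (hU.mem_nhds hz)
    by_contra hcon
    -- the gap on the sphere
    have hnt : (sphere z r).Nonempty := by
      have : Nontrivial V := nontrivial_of_finrank_pos (R := ℝ) hN
      exact NormedSpace.sphere_nonempty.2 hr.le
    obtain ⟨y, hy, hym⟩ := (isCompact_sphere z r).exists_isMinOn hnt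
      (f := fun x => v x - v z - ⟪gv z, x - z⟫) (by fun_prop)
    have hc : 0 < v y - v z - ⟪gv z, y - z⟫ := by
      have := hv z y (fun h => by simp [← h] at hy; linarith)
      linarith
    set c := v y - v z - ⟪gv z, y - z⟫
    have hnear : ∀ᶠ x in 𝓝 z, r * ‖gv x - gv z‖ < c := by
      have : Continuous fun x => r * ‖gv x - gv z‖ := by fun_prop
      exact this.continuousAt.eventually_lt_const (by simpa using hc)
    obtain ⟨y₁, hy₁c, hy₁, hy₁U⟩ : ∃ y₁, u y₁ ≠ v y₁ ∧ r * ‖gv y₁ - gv z‖ < c ∧ y₁ ∈ U := by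
      obtain ⟨y₁, h1, h2⟩ := ((not_eventually.1 hcon).and_eventually
        (hnear.and (hU.mem_nhds hz))).exists
      exact ⟨y₁, h1, h2⟩
    obtain ⟨x₀, hx₀, hx₀m⟩ := ((isCompact_closedBall z r).inter_right
      (isClosed_eq huc hvc)).exists_isMinOn ⟨z, mem_closedBall_self hr.le, hzc⟩
      (f := fun x => v x - ⟪gv y₁, x⟫) (by fun_prop)
    have hx₀z : v x₀ - ⟪gv y₁, x₀⟫ ≤ v z - ⟪gv y₁, z⟫ := hx₀m ⟨mem_closedBall_self hr.le, hzc⟩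
    have hx₀b : x₀ ∈ ball z r := by
      refine lt_of_le_of_ne (mem_closedBall.1 hx₀.1) fun heq => ?_
      have h1 : c ≤ v x₀ - v z - ⟪gv z, x₀ - z⟫ := hym heq
      have h2 := real_inner_le_norm (gv y₁ - gv z) (x₀ - z)
      rw [← dist_eq_norm x₀ z, heq, inner_sub_left] at h2
      rw [← sub_nonneg] at hx₀z
      have h3 : ⟪gv y₁, x₀ - z⟫ = ⟪gv y₁, x₀⟫ - ⟪gv y₁, z⟫ := inner_sub_right _ _ _
      linarith
    have hx₀U : x₀ ∈ U := hrU (ball_subset_closedBall hx₀b)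
    have hne : gv y₁ ≠ gv x₀ := fun h => hy₁c ((hv.injective h) ▸ hx₀.2)
    obtain ⟨Lc, hLc, hL⟩ := hLip x₀ hx₀U hx₀.2
    obtain ⟨R, hR, hRb⟩ := Metric.eventually_nhds_iff_ball.1 (hL.and (isOpen_ball.mem_nhds hx₀b))
    have hRU : ball x₀ R ⊆ U := fun x hx => hrU (ball_subset_closedBall (hRb x hx).2)
    refine not_touching_at hN hu hgu hv hgv hx₀.2 hR (fun x hx => huv x (hRU hx)) hne
      (fun x hx h => ?_) hf hlam (fun x hx => hf1 x (hRU hx)) (fun x hx => hf2 x (hRU hx))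
      (fun A hA => hMAu A (hA.trans hRU)) (fun A hA => hMAv A (hA.trans hRU))
      (fun x hx => hHu.continuousAt (hU.mem_nhds (hRU hx)))
      (fun x hx => hHv.continuousAt (hU.mem_nhds (hRU hx))) (hpos x₀ hx₀U) hLc
      (fun x hx => (hRb x hx).1)
    refine lt_of_le_of_ne (huv x (hRU hx)) fun heq => ?_
    have h1 : v x₀ - ⟪gv y₁, x₀⟫ ≤ v x - ⟪gv y₁, x⟫ :=
      hx₀m ⟨ball_subset_closedBall (hRb x hx).2, heq.symm⟩
    rw [inner_sub_right] at h
    linarith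
  have hopen : IsOpen (U ∩ {x | u x = v x}) := by
    rw [isOpen_iff_mem_nhds]
    rintro z ⟨hz, hzc⟩
    exact inter_mem (hU.mem_nhds hz) (key z hz hzc)
  have hopen2 : IsOpen (U ∩ {x | u x ≠ v x}) := hU.inter (isOpen_ne_fun huc hvc)
  intro x hx
  by_contra hxc
  obtain ⟨z, hzU, hz1, hz2⟩ := hUc _ _ hopen hopen2
    (fun y hy => (em (u y = v y)).imp (fun h => ⟨hy, h⟩) (fun h => ⟨hy, h⟩))
    ⟨x₁, hx₁, hx₁, hcontact⟩ ⟨x, hx, hx, hxc⟩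
  exact hz2.2 hz1.2

end Global

section UniformlyDistributed

variable {V : Type*} [NormedAddCommGroup V] [NormedSpace ℝ V] [FiniteDimensional ℝ V]
  [MeasurableSpace V] [BorelSpace V]

theorem MeasureTheory.Measure.AbsolutelyContinuous.exists_eq_smul_of_closedBall {μ κ : Measure V}
    [IsFiniteMeasure μ] [IsFiniteMeasure κ] (hac : μ ≪ κ) {S : Set V} (hκS : ∀ᵐ x ∂κ, x ∈ S)
    (hμ : ∀ x ∈ S, ∀ y ∈ S, ∀ r, μ (closedBall x r) = μ (closedBall y r))
    (hκ : ∀ x ∈ S, ∀ y ∈ S, ∀ r, κ (closedBall x r) = κ (closedBall y r)) (hκ0 : κ ≠ 0) :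
    ∃ c : ℝ≥0∞, μ = c • κ := by
  have h1 := (Besicovitch.ae_tendsto_rnDeriv μ κ).and hκS
  have : (ae κ).NeBot := ae_neBot.2 hκ0
  obtain ⟨x₁, hx₁, hx₁S⟩ := h1.exists
  refine ⟨μ.rnDeriv κ x₁, ?_⟩
  have h2 : μ.rnDeriv κ =ᵐ[κ] fun _ => μ.rnDeriv κ x₁ := by
    filter_upwards [h1] with x ⟨hx, hxS⟩
    refine tendsto_nhds_unique hx (hx₁.congr fun r => ?_)
    rw [hμ x hxS x₁ hx₁S, hκ x hxS x₁ hx₁S]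
  conv_lhs => rw [← Measure.withDensity_rnDeriv_eq μ κ hac]
  rw [withDensity_congr_ae h2, withDensity_const]

/-- Two uniformly distributed measures on the same set are proportional. -/
theorem MeasureTheory.Measure.exists_eq_smul_of_closedBall {μ ν : Measure V}
    [IsFiniteMeasure μ] [IsFiniteMeasure ν] {S : Set V} (hμS : ∀ᵐ x ∂μ, x ∈ S)
    (hνS : ∀ᵐ x ∂ν, x ∈ S)
    (hμ : ∀ x ∈ S, ∀ y ∈ S, ∀ r, μ (closedBall x r) = μ (closedBall y r))
    (hν : ∀ x ∈ S, ∀ y ∈ S, ∀ r, ν (closedBall x r) = ν (closedBall y r))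
    (hμ0 : μ ≠ 0) (hν0 : ν ≠ 0) :
    ∃ c : ℝ≥0∞, c ≠ 0 ∧ c ≠ ∞ ∧ μ = c • ν := by
  have hκS : ∀ᵐ x ∂(μ + ν), x ∈ S := ae_add_measure_iff.2 ⟨hμS, hνS⟩
  have hκ : ∀ x ∈ S, ∀ y ∈ S, ∀ r, (μ + ν) (closedBall x r) = (μ + ν) (closedBall y r) := by
    intro x hx y hy r
    rw [Measure.add_apply, Measure.add_apply, hμ x hx y hy, hν x hx y hy]
  have hκ0 : μ + ν ≠ 0 := fun h => hμ0 (Measure.measure_univ_eq_zero.1 (by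
    have := congrArg (fun m => m univ) h
    simp only [Measure.add_apply, Measure.coe_zero, Pi.zero_apply, add_eq_zero] at this
    exact this.1))
  have fin : ∀ {m : Measure V} {c : ℝ≥0∞}, IsFiniteMeasure m → m = c • (μ + ν) → c ≠ ∞ := by
    rintro m c hm h rfl
    have h1 := measure_ne_top m univ
    rw [h, Measure.smul_apply, smul_eq_mul, ENNReal.top_mul] at h1
    · exact h1 rfl
    · exact fun h2 => hκ0 (Measure.measure_univ_eq_zero.1 h2)
  obtain ⟨c, hc⟩ := Measure.AbsolutelyContinuous.exists_eq_smul_of_closedBall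
    (Measure.le_add_right le_rfl).absolutelyContinuous hκS hμ hκ hκ0
  obtain ⟨d, hd⟩ := Measure.AbsolutelyContinuous.exists_eq_smul_of_closedBall
    (Measure.le_add_left le_rfl).absolutelyContinuous hκS hν hκ hκ0
  have hc1 := fin inferInstance hc
  have hd1 := fin inferInstance hd
  have hc0 : c ≠ 0 := by rintro rfl; rw [zero_smul] at hc; exact hμ0 hc
  have hd0 : d ≠ 0 := by rintro rfl; rw [zero_smul] at hd; exact hν0 hd
  refine ⟨c / d, ENNReal.div_ne_zero.2 ⟨hc0, hd1⟩, ENNReal.div_ne_top hc1 hd0, ?_⟩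
  calc μ = c • (μ + ν) := hc
    _ = (c / d) • d • (μ + ν) := by rw [smul_smul, ENNReal.div_mul_cancel hd0 hd1]
    _ = (c / d) • ν := by rw [← hd]

end UniformlyDistributed

section SphereTransitive

variable {V : Type*} [NormedAddCommGroup V] [InnerProductSpace ℝ V] [MeasurableSpace V]
  [BorelSpace V]

theorem measure_closedBall_eq_of_isometry_invariant {μ : Measure V}
    (hμ : ∀ (e : V ≃ₗᵢ[ℝ] V) (A : Set V), MeasurableSet A → μ (e ⁻¹' A) = μ A) {x y : V}
    (hxy : ‖x‖ = ‖y‖) (r : ℝ) : μ (closedBall x r) = μ (closedBall y r) := by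
  have h1 := hμ ((ℝ ∙ (x - y))ᗮ.reflection) (closedBall y r) isClosed_closedBall.measurableSet
  have h2 : (ℝ ∙ (x - y))ᗮ.reflection y = x := by
    have h3 := Submodule.reflection_sub hxy
    have h4 := Submodule.reflection_reflection (ℝ ∙ (x - y))ᗮ x
    rwa [h3] at h4
  rw [← h1, LinearIsometryEquiv.preimage_closedBall, Submodule.reflection_symm, h2]

end SphereTransitive

section Sphere

variable {V : Type*} [NormedAddCommGroup V] [InnerProductSpace ℝ V] [FiniteDimensional ℝ V]
  [MeasurableSpace V] [BorelSpace V]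

/-- The surface measure induced by the volume, as a measure on the ambient space. -/
def surfaceMeasure (V : Type*) [NormedAddCommGroup V] [InnerProductSpace ℝ V]
    [FiniteDimensional ℝ V] [MeasurableSpace V] [BorelSpace V] : Measure V :=
  ((volume : Measure V).toSphere).map Subtype.val

instance : IsFiniteMeasure (surfaceMeasure V) := by
  unfold surfaceMeasure; infer_instance

theorem surfaceMeasure_apply {A : Set V} (hA : MeasurableSet A) :
    surfaceMeasure V A = finrank ℝ V * volume (Ioo (0 : ℝ) 1 • (A ∩ sphere 0 1)) := by
  rw [surfaceMeasure, Measure.map_apply measurable_subtype_coe hA,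
    Measure.toSphere_apply' _ (measurable_subtype_coe hA), Subtype.image_preimage_coe, inter_comm]

theorem ae_surfaceMeasure_mem : ∀ᵐ x ∂(surfaceMeasure V), x ∈ sphere (0 : V) 1 := by
  refine (ae_map_iff measurable_subtype_coe.aemeasurable
    (isClosed_sphere (x := (0 : V)) (ε := 1)).measurableSet).2 ?_
  exact ae_of_all _ fun x => x.2

theorem surfaceMeasure_preimage (e : V ≃ₗᵢ[ℝ] V) {A : Set V} (hA : MeasurableSet A) :
    surfaceMeasure V (e ⁻¹' A) = surfaceMeasure V A := by
  rw [surfaceMeasure_apply hA, surfaceMeasure_apply (e.continuous.measurable hA),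
    ← (e.measurePreserving).measure_preimage_emb e.toHomeomorph.measurableEmbedding
      (Ioo (0 : ℝ) 1 • (A ∩ sphere (0 : V) 1))]
  congr 2
  ext x
  simp only [mem_preimage, Set.mem_smul]
  constructor
  · rintro ⟨t, ht, y, ⟨hy, hys⟩, rfl⟩
    exact ⟨t, ht, e y, ⟨hy, by simpa using hys⟩, (map_smul e t y).symm⟩
  · rintro ⟨t, ht, y, ⟨hy, hys⟩, h⟩
    refine ⟨t, ht, e.symm y, ⟨by simpa using hy, by simpa using hys⟩, ?_⟩
    rw [← map_smul, h, e.symm_apply_apply]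

theorem surfaceMeasure_ne_zero [Nontrivial V] : surfaceMeasure V ≠ 0 := by
  rw [surfaceMeasure, Ne, Measure.map_eq_zero_iff measurable_subtype_coe.aemeasurable]
  exact Measure.toSphere_ne_zero _

/-- Integration in polar coordinates. -/
theorem lintegral_eq_lintegral_surfaceMeasure [Nontrivial V] {g : V → ℝ≥0∞} (hg : Measurable g) :
    ∫⁻ x, g x = ∫⁻ θ, (∫⁻ r in Ioi (0 : ℝ), ENNReal.ofReal (r ^ (finrank ℝ V - 1)) * g (r • θ))
      ∂(surfaceMeasure V) := by
  have hm : Measurable fun p : V × ℝ =>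
      ENNReal.ofReal (p.2 ^ (finrank ℝ V - 1)) * g (p.2 • p.1) := by fun_prop
  rw [surfaceMeasure, lintegral_map hm.lintegral_prod_right' measurable_subtype_coe]
  have h0 : ∫⁻ x, g x = ∫⁻ x in ({0}ᶜ : Set V), g x := by
    rw [restrict_compl_singleton (μ := volume) (0 : V)]
  have h1 := ((volume : Measure V).measurePreserving_homeomorphUnitSphereProd).lintegral_comp_emb
    (homeomorphUnitSphereProd V).measurableEmbedding (fun p => g (p.2.1 • p.1.1))
  have h2 : ∀ x : ({0}ᶜ : Set V), g ((homeomorphUnitSphereProd V x).2.1 •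
      (homeomorphUnitSphereProd V x).1.1) = g x := by
    intro x
    have : (homeomorphUnitSphereProd V).symm (homeomorphUnitSphereProd V x) = x := by simp
    conv_rhs => rw [← this]
    rfl
  simp only [h2] at h1
  rw [h0, ← lintegral_subtype_comap (measurableSet_singleton _).compl, h1,
    lintegral_prod _ (by fun_prop)]
  refine lintegral_congr fun θ => ?_
  rw [Measure.volumeIoiPow, lintegral_withDensity_eq_lintegral_mul _ (by fun_prop) (by fun_prop),
    ← lintegral_subtype_comap measurableSet_Ioi]
  rfl

end Sphere

section SphMeasure

theorem dist_smul_inv_norm_le {E : Type*} [NormedAddCommGroup E] [NormedSpace ℝ E] {x y : E}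
    (hx : 1 ≤ ‖x‖) (hy : 1 ≤ ‖y‖) : dist (‖x‖⁻¹ • x) (‖y‖⁻¹ • y) ≤ 2 * dist x y := by
  have hx0 : 0 < ‖x‖ := by linarith
  have hy0 : 0 < ‖y‖ := by linarith
  have h1 : ‖x‖⁻¹ • x - ‖y‖⁻¹ • y = ‖x‖⁻¹ • ((x - y) + (‖y‖ - ‖x‖) • ‖y‖⁻¹ • y) := by
    rw [smul_add, smul_smul, smul_smul, smul_sub]
    have : ‖x‖⁻¹ * ((‖y‖ - ‖x‖) * ‖y‖⁻¹) = ‖x‖⁻¹ - ‖y‖⁻¹ := by field_simp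
    rw [← mul_assoc] at this
    rw [this, sub_smul]
    abel
  have h2 : ‖‖y‖⁻¹ • y‖ = 1 := by
    rw [norm_smul, norm_inv, norm_norm, inv_mul_cancel₀ hy0.ne']
  rw [dist_eq_norm, dist_eq_norm, h1, norm_smul, Real.norm_of_nonneg (by positivity)]
  have h3 : ‖(x - y) + (‖y‖ - ‖x‖) • ‖y‖⁻¹ • y‖ ≤ 2 * ‖x - y‖ := by
    refine (norm_add_le _ _).trans ?_
    rw [norm_smul, h2, mul_one, Real.norm_eq_abs, abs_sub_comm]
    linarith [abs_norm_sub_norm_le x y]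
  calc ‖x‖⁻¹ * _ ≤ 1 * (2 * ‖x - y‖) := by
        gcongr; exact inv_le_one_of_one_le₀ hx
    _ = _ := one_mul _

variable {n : ℕ}

/-- The point of the ambient space with `i`-th coordinate `s` and the other coordinates `y`. -/
def faceMap (i : Fin (n + 1)) (s : ℝ) (y : Fin n → ℝ) : Es n :=
  WithLp.toLp 2 (Fin.insertNth (α := fun _ => ℝ) i s y)

theorem exists_lipschitzWith_faceMap (i : Fin (n + 1)) (s : ℝ) :
    ∃ C, LipschitzWith C (faceMap i s) := by
  have h1 : LipschitzWith 1 (fun y : Fin n → ℝ => Fin.insertNth (α := fun _ => ℝ) i s y) := by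
    refine LipschitzWith.of_dist_le_mul fun y z => ?_
    rw [NNReal.coe_one, one_mul, dist_pi_le_iff dist_nonneg]
    intro j
    rcases Fin.eq_self_or_eq_succAbove i j with rfl | ⟨k, rfl⟩
    · simp
    · simpa using dist_le_pi_dist y z k
  exact ⟨_, (PiLp.lipschitzWith_toLp 2 (fun _ : Fin (n + 1) => ℝ)).comp h1⟩

theorem sphere_subset_iUnion_image_faceMap :
    sphere (0 : Es n) 1 ⊆ ⋃ i, ⋃ s ∈ ({1, -1} : Set ℝ),
      (fun y => ‖faceMap i s y‖⁻¹ • faceMap i s y) ''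
      closedBall (0 : Fin n → ℝ) 1 := by
  intro x hx
  obtain ⟨i, -, hi⟩ := Finset.univ.exists_max_image (fun i => |x i|) Finset.univ_nonempty
  have hxn : ‖x‖ = 1 := mem_sphere_zero_iff_norm.1 hx
  have hxi : 0 < |x i| := by
    by_contra h
    have : x = 0 := by
      ext j
      have := hi j (Finset.mem_univ _)
      simpa using le_antisymm (this.trans (not_lt.1 h)) (abs_nonneg _)
    simp [this] at hxn
  have hxi' : x i ≠ 0 := abs_pos.1 hxi
  have hface : faceMap i (x i / |x i|) (fun k => x (i.succAbove k) / |x i|) = |x i|⁻¹ • x := by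
    ext j
    rcases Fin.eq_self_or_eq_succAbove i j with rfl | ⟨k, rfl⟩
    · simp [faceMap, div_eq_inv_mul]
    · simp [faceMap, div_eq_inv_mul]
  simp only [mem_iUnion]
  refine ⟨i, x i / |x i|, ?_, fun k => x (i.succAbove k) / |x i|, ?_, ?_⟩
  · rcases abs_choice (x i) with h | h <;> rw [h]
    · left; exact div_self hxi'
    · right; rw [div_neg, div_self hxi']; rfl
  · rw [mem_closedBall_zero_iff, pi_norm_le_iff_of_nonneg zero_le_one]
    intro k
    rw [Real.norm_eq_abs, abs_div, abs_abs, div_le_one hxi]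
    exact hi _ (Finset.mem_univ _)
  · simp only [hface, norm_smul, norm_inv, Real.norm_eq_abs, abs_abs, hxn, mul_one, inv_inv,
      smul_smul, mul_inv_cancel₀ hxi.ne', one_smul]

theorem one_le_norm_faceMap (i : Fin (n + 1)) {s : ℝ} (hs : s ∈ ({1, -1} : Set ℝ))
    (y : Fin n → ℝ) : 1 ≤ ‖faceMap i s y‖ := by
  have h1 := PiLp.norm_apply_le (faceMap i s y) i
  have h2 : faceMap i s y i = s := by simp [faceMap]
  rw [h2] at h1
  rcases hs with rfl | rfl <;> simpa using h1

theorem sphMeasure_sphere_lt_top : sphMeasure n (sphere 0 1) < ∞ := by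
  refine (measure_mono sphere_subset_iUnion_image_faceMap).trans_lt ?_
  refine (measure_iUnion_fintype_le _ _).trans_lt (ENNReal.sum_lt_top.2 fun i _ => ?_)
  refine (measure_biUnion_lt_top (by simp) fun s hs => ?_)
  obtain ⟨C, hC⟩ := exists_lipschitzWith_faceMap (n := n) i s
  have h1 : LipschitzWith (2 * C) (fun y => ‖faceMap i s y‖⁻¹ • faceMap i s y) := by
    refine LipschitzWith.of_dist_le_mul fun y z => ?_
    refine (dist_smul_inv_norm_le (one_le_norm_faceMap i hs y)
      (one_le_norm_faceMap i hs z)).trans ?_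
    have := hC.dist_le_mul y z
    push_cast
    linarith
  refine (h1.hausdorffMeasure_image_le (Nat.cast_nonneg n) _).trans_lt ?_
  refine ENNReal.mul_lt_top (ENNReal.rpow_lt_top_of_nonneg (Nat.cast_nonneg n)
    ENNReal.coe_ne_top) ?_
  have h2 := hausdorffMeasure_pi_real (ι := Fin n)
  rw [Fintype.card_fin] at h2
  rw [h2]
  exact measure_closedBall_lt_top

theorem sphMeasure_sphere_pos : 0 < sphMeasure n (sphere 0 1) := by
  have h1 : LipschitzWith 1 (fun (x : Es n) (k : Fin n) => x k.succ) := by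
    refine LipschitzWith.of_dist_le_mul fun y z => ?_
    rw [NNReal.coe_one, one_mul, dist_pi_le_iff dist_nonneg]
    intro j
    simpa [dist_eq_norm] using PiLp.norm_apply_le (y - z) j.succ
  have h2 := h1.hausdorffMeasure_image_le (Nat.cast_nonneg n) (sphere 0 1)
  rw [ENNReal.coe_one, ENNReal.one_rpow, one_mul] at h2
  refine lt_of_lt_of_le ?_ h2
  have h3 := hausdorffMeasure_pi_real (ι := Fin n)
  rw [Fintype.card_fin] at h3
  rw [h3]
  have hopen : IsOpen {y : Fin n → ℝ | ∑ k, y k ^ 2 < 1} :=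
    isOpen_lt (by fun_prop) continuous_const
  refine (hopen.measure_pos volume ⟨0, by simp⟩).trans_le (measure_mono fun y hy => ?_)
  refine ⟨faceMap 0 (√(1 - ∑ k, y k ^ 2)) y, ?_, ?_⟩
  · rw [mem_sphere_zero_iff_norm, EuclideanSpace.norm_eq, Real.sqrt_eq_one, Fin.sum_univ_succ]
    have : (0 : ℝ) ≤ 1 - ∑ k, y k ^ 2 := by linarith [mem_ofPred_eq ▸ hy]
    simp [faceMap, Real.sq_sqrt this]
  · ext k
    simp [faceMap]

/-- The Hausdorff measure on the sphere is proportional to the surface measure. -/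
theorem exists_sphMeasure_restrict_eq_smul :
    ∃ c : ℝ≥0∞, c ≠ 0 ∧ c ≠ ∞ ∧
      (sphMeasure n).restrict (unitSphere n) = c • surfaceMeasure (Es n) := by
  have hS : MeasurableSet (unitSphere n) := isClosed_sphere.measurableSet
  have : IsFiniteMeasure ((sphMeasure n).restrict (unitSphere n)) :=
    ⟨by rw [Measure.restrict_apply_univ]; exact sphMeasure_sphere_lt_top⟩
  have heq : ∀ x ∈ unitSphere n, ∀ y ∈ unitSphere n, ‖x‖ = ‖y‖ := fun x hx y hy =>
    (mem_sphere_zero_iff_norm.1 hx).trans (mem_sphere_zero_iff_norm.1 hy).symm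
  refine Measure.exists_eq_smul_of_closedBall (S := unitSphere n) (ae_restrict_mem hS)
    ae_surfaceMeasure_mem (fun x hx y hy r => ?_) (fun x hx y hy r => ?_) (fun h => ?_)
    surfaceMeasure_ne_zero
  · refine measure_closedBall_eq_of_isometry_invariant (fun e A hA => ?_) (heq x hx y hy) r
    rw [Measure.restrict_apply hA, Measure.restrict_apply (e.continuous.measurable hA)]
    have h1 := e.toIsometryEquiv.hausdorffMeasure_preimage n (A ∩ unitSphere n)
    rw [sphMeasure, ← h1, preimage_inter]
    congr 2
    ext z
    simp [unitSphere]
  · exact measure_closedBall_eq_of_isometry_invariant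
      (fun e A hA => surfaceMeasure_preimage e hA) (heq x hx y hy) r
  · have := congrArg (fun m => m univ) h
    simp only [Measure.restrict_apply_univ, Measure.coe_zero, Pi.zero_apply] at this
    exact sphMeasure_sphere_pos.ne' this

end SphMeasure

section SliceMeasure

variable {V : Type*} [NormedAddCommGroup V] [InnerProductSpace ℝ V] {α q : V → V} {k : V → ℝ}
  {W : Set V}

/-- The `r ^ (N - 1) dr` measure of the slice of `E` along the ray through `θ`. -/
def sliceMeasure (E : Set V) (θ : V) : ℝ≥0∞ :=
  ∫⁻ r in Ioi (0 : ℝ), ENNReal.ofReal (r ^ (finrank ℝ V - 1)) * E.indicator 1 (r • θ)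

theorem sliceMeasure_eq_zero {E : Set V} {θ : V} (h : ∀ r > (0 : ℝ), r • θ ∉ E) :
    sliceMeasure E θ = 0 := by
  rw [sliceMeasure, setLIntegral_congr_fun (g := 0) measurableSet_Ioi]
  · simp
  · intro r hr
    simp [h r hr]

theorem injOn_of_radial (hW : W ⊆ sphere 0 1) (hk0 : ∀ w ∈ W, 0 < k w) (hqi : q.Injective)
    (hq : ∀ r > 0, ∀ w ∈ W, q (r • w) = (r * k w) • α w) : InjOn α W := by
  intro w hw w' hw' h
  have h1 : q ((k w)⁻¹ • w) = q ((k w')⁻¹ • w') := by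
    rw [hq _ (inv_pos.2 (hk0 w hw)) w hw, hq _ (inv_pos.2 (hk0 w' hw')) w' hw', h,
      inv_mul_cancel₀ (hk0 w hw).ne', inv_mul_cancel₀ (hk0 w' hw').ne']
  have h2 := hqi h1
  have h3 := congrArg norm h2
  rw [norm_smul, norm_smul, mem_sphere_zero_iff_norm.1 (hW hw),
    mem_sphere_zero_iff_norm.1 (hW hw'), mul_one, mul_one,
    Real.norm_of_nonneg (inv_pos.2 (hk0 w hw)).le,
    Real.norm_of_nonneg (inv_pos.2 (hk0 w' hw')).le] at h3
  rw [h3] at h2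
  exact smul_right_injective V (inv_pos.2 (hk0 w' hw')).ne' h2

theorem sliceMeasure_scale [FiniteDimensional ℝ V] [Nontrivial V]
    {E E' : Set V} {θ θ' : V} {k : ℝ} (hk : 0 < k)
    (h : ∀ r > (0 : ℝ), (r * k) • θ' ∈ E' ↔ r • θ ∈ E) :
    sliceMeasure E' θ' = ENNReal.ofReal (k ^ finrank ℝ V) * sliceMeasure E θ := by
  have hN : 0 < finrank ℝ V := finrank_pos
  have him : (fun r : ℝ => r * k) '' Ioi 0 = Ioi 0 := by
    ext r
    constructor
    · rintro ⟨s, hs, rfl⟩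
      exact mul_pos hs hk
    · exact fun hr => ⟨r / k, div_pos hr hk, div_mul_cancel₀ r hk.ne'⟩
  have h1 := lintegral_image_eq_lintegral_abs_deriv_mul (s := Ioi (0 : ℝ))
    (f := fun r => r * k) (f' := fun _ => k) measurableSet_Ioi
    (fun x _ => by simpa using ((hasDerivAt_id x).mul_const k).hasDerivWithinAt)
    (fun a _ b _ hab => mul_right_cancel₀ hk.ne' hab)
    (fun r => ENNReal.ofReal (r ^ (finrank ℝ V - 1)) * E'.indicator 1 (r • θ'))
  rw [him] at h1
  rw [sliceMeasure, h1, sliceMeasure, ← lintegral_const_mul' _ _ ENNReal.ofReal_ne_top]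
  refine setLIntegral_congr_fun measurableSet_Ioi fun r hr => ?_
  have hr' : (0 : ℝ) < r := hr
  have h2 : E'.indicator (1 : V → ℝ≥0∞) ((r * k) • θ') = E.indicator 1 (r • θ) := by
    by_cases hE : r • θ ∈ E
    · rw [indicator_of_mem hE, indicator_of_mem ((h r hr').2 hE)]; rfl
    · rw [indicator_of_notMem hE, indicator_of_notMem (mt (h r hr').1 hE)]
  simp only [h2, ← mul_assoc]
  congr 1
  rw [← ENNReal.ofReal_mul (by positivity), ← ENNReal.ofReal_mul (by positivity), abs_of_pos hk]
  congr 1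
  obtain ⟨m, hm⟩ : ∃ m, finrank ℝ V = m + 1 := ⟨_, (Nat.succ_pred_eq_of_pos hN).symm⟩
  rw [hm, Nat.add_sub_cancel]
  ring

end SliceMeasure

section PolarTransfer

variable {V : Type*} [NormedAddCommGroup V] [InnerProductSpace ℝ V] [FiniteDimensional ℝ V]
  [MeasurableSpace V] [BorelSpace V]

theorem measurable_sliceMeasure {E : Set V} (hE : MeasurableSet E) :
    Measurable (sliceMeasure E) := by
  have h1 : Measurable (E.indicator (1 : V → ℝ≥0∞)) := measurable_one.indicator hE
  have h2 : Measurable fun p : V × ℝ =>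
    ENNReal.ofReal (p.2 ^ (finrank ℝ V - 1)) * E.indicator 1 (p.2 • p.1) := by fun_prop
  exact h2.lintegral_prod_right'

theorem volume_eq_lintegral_sliceMeasure [Nontrivial V] {E : Set V} (hE : MeasurableSet E) :
    volume E = ∫⁻ θ, sliceMeasure E θ ∂(surfaceMeasure V) := by
  rw [← lintegral_indicator_one hE,
    lintegral_eq_lintegral_surfaceMeasure (measurable_one.indicator hE)]
  rfl

variable {α q : V → V} {k : V → ℝ} {φ : V → ℝ≥0∞} {W E : Set V}

theorem lintegral_comap_withDensity (hk : Measurable k)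
    (hφ : Measurable φ) (hE : MeasurableSet E) :
    ∫⁻ w : W, φ w * (ENNReal.ofReal (k w ^ finrank ℝ V) * sliceMeasure E w)
        ∂((surfaceMeasure V).comap Subtype.val) =
      ∫⁻ w : W, ENNReal.ofReal (k w ^ finrank ℝ V) * sliceMeasure E w
        ∂(((surfaceMeasure V).comap Subtype.val).withDensity fun w : W => φ w) := by
  have h1 := measurable_sliceMeasure hE
  rw [lintegral_withDensity_eq_lintegral_mul _ (by fun_prop) (by fun_prop)]
  rfl

theorem comap_apply_of_measurableEmbedding (hα : MeasurableEmbedding fun w : W => α w) (S : Set W) :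
    (surfaceMeasure V).comap (fun w : W => α w) S = surfaceMeasure V (α '' (Subtype.val '' S)) := by
  rw [hα.comap_apply, image_image]

theorem withDensity_comap_apply (hWm : MeasurableSet W) {S : Set W} (hS : MeasurableSet S) :
    ((surfaceMeasure V).comap Subtype.val).withDensity (fun w : W => φ w) S =
      ∫⁻ θ in Subtype.val '' S, φ θ ∂surfaceMeasure V := by
  have he := MeasurableEmbedding.subtype_coe hWm
  rw [withDensity_apply _ hS, setLIntegral_subtype hWm]

theorem measurableEmbedding_of_radial (hWm : MeasurableSet W) (hW : W ⊆ sphere 0 1)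
    (hα : ContinuousOn α W) (hk0 : ∀ w ∈ W, 0 < k w) (hqi : q.Injective)
    (hq : ∀ r > 0, ∀ w ∈ W, q (r • w) = (r * k w) • α w) :
    MeasurableEmbedding fun w : W => α w := by
  exact hα.measurableEmbedding hWm (injOn_of_radial hW hk0 hqi hq)

variable [Nontrivial V]

theorem volume_image_eq_lintegral_comap
    (hα : MeasurableEmbedding (fun w : W => α w)) (hαW : MapsTo α W (sphere 0 1))
    (hk0 : ∀ w ∈ W, 0 < k w) (hqc : Continuous q) (hqi : q.Injective)
    (hq : ∀ r > 0, ∀ w ∈ W, q (r • w) = (r * k w) • α w) (hE : MeasurableSet E)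
    (hEW : ∀ x ∈ E, ∃ r > (0 : ℝ), ∃ w ∈ W, x = r • w) :
    volume (q '' E) = ∫⁻ w : W, ENNReal.ofReal (k w ^ finrank ℝ V) * sliceMeasure E w
      ∂((surfaceMeasure V).comap fun w : W => α w) := by
  have hm : MeasurableSet (q '' E) := hE.image_of_continuousOn_injOn hqc.continuousOn hqi.injOn
  have hr : MeasurableSet (range fun w : W => α w) := hα.measurableSet_range
  rw [volume_eq_lintegral_sliceMeasure hm]
  have h1 : ∀ᵐ θ ∂(surfaceMeasure V), sliceMeasure (q '' E) θ =
      (range fun w : W => α w).indicator (sliceMeasure (q '' E)) θ := by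
    filter_upwards [ae_surfaceMeasure_mem (V := V)] with θ hθ
    by_cases h : θ ∈ range fun w : W => α w
    · rw [indicator_of_mem h]
    · rw [indicator_of_notMem h]
      refine sliceMeasure_eq_zero fun r hr0 hmem => h ?_
      obtain ⟨x, hx, hxr⟩ := hmem
      obtain ⟨s, hs, w, hw, rfl⟩ := hEW x hx
      rw [hq s hs w hw] at hxr
      have h2 := congrArg norm hxr
      have hsk := mul_pos hs (hk0 w hw)
      rw [norm_smul, norm_smul, mem_sphere_zero_iff_norm.1 hθ,
        mem_sphere_zero_iff_norm.1 (hαW hw), mul_one, mul_one, Real.norm_of_nonneg hsk.le,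
        Real.norm_of_nonneg hr0.le] at h2
      rw [h2] at hxr
      exact ⟨⟨w, hw⟩, smul_right_injective V hr0.ne' hxr⟩
  rw [lintegral_congr_ae h1, lintegral_indicator hr, ← hα.map_comap, hα.lintegral_map]
  refine lintegral_congr fun w => sliceMeasure_scale (hk0 w w.2) fun r hr0 => ?_
  rw [← hq r hr0 w w.2, hqi.mem_set_image]

theorem setLIntegral_eq_lintegral_comap (hWm : MeasurableSet W) (hW : W ⊆ sphere 0 1)
    (hk : Measurable k) (hφ : Measurable φ) (hE : MeasurableSet E)
    (hEW : ∀ x ∈ E, ∃ r > (0 : ℝ), ∃ w ∈ W, x = r • w) :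
    ∫⁻ x in E, φ (‖x‖⁻¹ • x) * ENNReal.ofReal (k (‖x‖⁻¹ • x) ^ finrank ℝ V) =
      ∫⁻ w : W, φ w * (ENNReal.ofReal (k w ^ finrank ℝ V) * sliceMeasure E w)
        ∂((surfaceMeasure V).comap Subtype.val) := by
  have hm : Measurable fun x : V =>
      φ (‖x‖⁻¹ • x) * ENNReal.ofReal (k (‖x‖⁻¹ • x) ^ finrank ℝ V) := by fun_prop
  rw [← lintegral_indicator hE, lintegral_eq_lintegral_surfaceMeasure (hm.indicator hE)]
  have h1 : ∀ᵐ θ ∂(surfaceMeasure V), (∫⁻ r in Ioi (0 : ℝ), ENNReal.ofReal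
      (r ^ (finrank ℝ V - 1)) * E.indicator (fun x : V =>
      φ (‖x‖⁻¹ • x) * ENNReal.ofReal (k (‖x‖⁻¹ • x) ^ finrank ℝ V)) (r • θ)) =
      W.indicator (fun w => φ w * (ENNReal.ofReal (k w ^ finrank ℝ V) * sliceMeasure E w)) θ := by
    filter_upwards [ae_surfaceMeasure_mem (V := V)] with θ hθ
    have hn : ‖θ‖ = 1 := mem_sphere_zero_iff_norm.1 hθ
    have hind : ∀ r ∈ Ioi (0 : ℝ), ENNReal.ofReal (r ^ (finrank ℝ V - 1)) *
        E.indicator (fun x : V => φ (‖x‖⁻¹ • x) *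
          ENNReal.ofReal (k (‖x‖⁻¹ • x) ^ finrank ℝ V)) (r • θ) =
        φ θ * ENNReal.ofReal (k θ ^ finrank ℝ V) *
          (ENNReal.ofReal (r ^ (finrank ℝ V - 1)) * E.indicator 1 (r • θ)) := by
      intro r hr
      have hr' : (0 : ℝ) < r := hr
      by_cases h : r • θ ∈ E
      · simp only [indicator_of_mem h, norm_smul, hn, mul_one, Real.norm_of_nonneg hr'.le,
          smul_smul, inv_mul_cancel₀ hr'.ne', one_smul, Pi.one_apply]
        rw [mul_comm]
      · simp only [indicator_of_notMem h, mul_zero]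
    rw [setLIntegral_congr_fun measurableSet_Ioi hind]
    by_cases h : θ ∈ W
    · rw [indicator_of_mem h, ← mul_assoc, lintegral_const_mul]
      · rfl
      · have : Measurable (E.indicator (1 : V → ℝ≥0∞)) := measurable_one.indicator hE
        fun_prop
    · rw [indicator_of_notMem h]
      rw [setLIntegral_congr_fun (g := 0) measurableSet_Ioi]
      · simp
      intro r hr
      have : r • θ ∉ E := ?_
      · simp [this]
      intro hmem
      obtain ⟨s, hs, w, hw, hsw⟩ := hEW _ hmem
      have hr' : (0 : ℝ) < r := hr
      have h2 := congrArg norm hsw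
      rw [norm_smul, norm_smul, hn, mem_sphere_zero_iff_norm.1 (hW hw), mul_one, mul_one,
        Real.norm_of_nonneg hr'.le, Real.norm_of_nonneg hs.le] at h2
      rw [← h2] at hsw
      exact h (smul_right_injective V hr'.ne' hsw ▸ hw)
  rw [lintegral_congr_ae h1, lintegral_indicator hWm, ← lintegral_subtype_comap hWm]

theorem volume_image_le_of_surfaceMeasure_image_le (hWm : MeasurableSet W) (hW : W ⊆ sphere 0 1)
    (hα : ContinuousOn α W) (hαW : MapsTo α W (sphere 0 1)) (hk : Measurable k)
    (hk0 : ∀ w ∈ W, 0 < k w) (hqc : Continuous q) (hqi : q.Injective)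
    (hq : ∀ r > 0, ∀ w ∈ W, q (r • w) = (r * k w) • α w) (hφ : Measurable φ)
    (hE : MeasurableSet E) (hEW : ∀ x ∈ E, ∃ r > (0 : ℝ), ∃ w ∈ W, x = r • w)
    (h : ∀ ω ⊆ W, MeasurableSet ω → surfaceMeasure V (α '' ω) ≤ ∫⁻ θ in ω, φ θ ∂surfaceMeasure V) :
    volume (q '' E) ≤
      ∫⁻ x in E, φ (‖x‖⁻¹ • x) * ENNReal.ofReal (k (‖x‖⁻¹ • x) ^ finrank ℝ V) := by
  have hemb := measurableEmbedding_of_radial hWm hW hα hk0 hqi hq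
  rw [volume_image_eq_lintegral_comap hemb hαW hk0 hqc hqi hq hE hEW,
    setLIntegral_eq_lintegral_comap hWm hW hk hφ hE hEW, lintegral_comap_withDensity hk hφ hE]
  refine lintegral_mono' (Measure.le_iff.2 fun S hS => ?_) le_rfl
  rw [comap_apply_of_measurableEmbedding hemb, withDensity_comap_apply hWm hS]
  exact h _ (Subtype.coe_image_subset _ _) (hWm.subtype_image hS)

theorem le_volume_image_of_le_surfaceMeasure_image (hWm : MeasurableSet W) (hW : W ⊆ sphere 0 1)
    (hα : ContinuousOn α W) (hαW : MapsTo α W (sphere 0 1)) (hk : Measurable k)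
    (hk0 : ∀ w ∈ W, 0 < k w) (hqc : Continuous q) (hqi : q.Injective)
    (hq : ∀ r > 0, ∀ w ∈ W, q (r • w) = (r * k w) • α w) (hφ : Measurable φ)
    (hE : MeasurableSet E) (hEW : ∀ x ∈ E, ∃ r > (0 : ℝ), ∃ w ∈ W, x = r • w)
    (h : ∀ ω ⊆ W, MeasurableSet ω → ∫⁻ θ in ω, φ θ ∂surfaceMeasure V ≤ surfaceMeasure V (α '' ω)) :
    ∫⁻ x in E, φ (‖x‖⁻¹ • x) * ENNReal.ofReal (k (‖x‖⁻¹ • x) ^ finrank ℝ V) ≤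
      volume (q '' E) := by
  have hemb := measurableEmbedding_of_radial hWm hW hα hk0 hqi hq
  rw [volume_image_eq_lintegral_comap hemb hαW hk0 hqc hqi hq hE hEW,
    setLIntegral_eq_lintegral_comap hWm hW hk hφ hE hEW, lintegral_comap_withDensity hk hφ hE]
  refine lintegral_mono' (Measure.le_iff.2 fun S hS => ?_) le_rfl
  rw [comap_apply_of_measurableEmbedding hemb, withDensity_comap_apply hWm hS]
  exact h _ (Subtype.coe_image_subset _ _) (hWm.subtype_image hS)

end PolarTransfer

section ConvexBody

variable {n : ℕ}

/-- `K` is a strictly convex `C¹` convex body around the origin, with Gauss image map `α`. -/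
structure IsGaussBody (K : Set (Es n)) (α : Es n → Es n) : Prop where
  isCompact : IsCompact K
  convex : Convex ℝ K
  zero_mem_interior : (0 : Es n) ∈ interior K
  not_segment_subset : ∀ a b : Es n, a ≠ b → ¬ segment ℝ a b ⊆ frontier K
  normalCone_eq : ∀ θ ∈ unitSphere n, normalCone K ((radialFn K θ) • θ) = {α θ}

/-- Half of the squared gauge of `K`. -/
def halfSqGauge (K : Set (Es n)) (x : Es n) : ℝ := gauge K x ^ 2 / 2

/-- The gradient of `halfSqGauge K`, in terms of the Gauss image map `α` of `K`. -/
def gradHalfSqGauge (K : Set (Es n)) (α : Es n → Es n) (x : Es n) : Es n :=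
  (gauge K x / supportFn K (α (‖x‖⁻¹ • x))) • α (‖x‖⁻¹ • x)

theorem norm_inv_smul_mem_unitSphere {x : Es n} (hx : x ≠ 0) : ‖x‖⁻¹ • x ∈ unitSphere n := by
  rw [unitSphere, mem_sphere_zero_iff_norm, norm_smul, norm_inv, norm_norm,
    inv_mul_cancel₀ (norm_ne_zero_iff.2 hx)]

theorem norm_eq_one_of_mem_unitSphere {θ : Es n} (hθ : θ ∈ unitSphere n) : ‖θ‖ = 1 :=
  mem_sphere_zero_iff_norm.1 hθ

theorem ne_zero_of_mem_unitSphere {θ : Es n} (hθ : θ ∈ unitSphere n) : θ ≠ 0 := by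
  rintro rfl
  simpa using norm_eq_one_of_mem_unitSphere hθ

namespace IsGaussBody

variable {K : Set (Es n)} {α : Es n → Es n}

theorem mem_nhds (hK : IsGaussBody K α) :
    K ∈ 𝓝 (0 : Es n) :=
  mem_interior_iff_mem_nhds.1 hK.zero_mem_interior

theorem continuous_gauge (hK : IsGaussBody K α) :
    Continuous (gauge K) :=
  _root_.continuous_gauge hK.convex hK.mem_nhds

theorem gauge_pos (hK : IsGaussBody K α) {x : Es n} (hx : x ≠ 0) : 0 < gauge K x :=
  (_root_.gauge_pos (absorbent_nhds_zero hK.mem_nhds)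
    (NormedSpace.isVonNBounded_of_isBounded ℝ hK.isCompact.isBounded)).2 hx

theorem mem_iff_gauge_le_one (hK : IsGaussBody K α) {x : Es n} : x ∈ K ↔ gauge K x ≤ 1 := by
  rw [gauge_le_one_iff_mem_closure hK.convex hK.mem_nhds, hK.isCompact.isClosed.closure_eq]

theorem radialFn_eq (hK : IsGaussBody K α)
    {θ : Es n} (hθ : θ ≠ 0) : radialFn K θ = (gauge K θ)⁻¹ := by
  have h1 : {s : ℝ | 0 < s ∧ s • θ ∈ K} = Ioc 0 (gauge K θ)⁻¹ := by
    ext s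
    refine and_congr_right fun hs => ?_
    rw [hK.mem_iff_gauge_le_one, gauge_smul_of_nonneg hs.le, smul_eq_mul,
      ← le_div_iff₀ (hK.gauge_pos hθ), one_div]
  rw [radialFn, h1, csSup_Ioc (inv_pos.2 (hK.gauge_pos hθ))]

theorem radialFn_pos (hK : IsGaussBody K α)
    {θ : Es n} (hθ : θ ∈ unitSphere n) : 0 < radialFn K θ := by
  rw [hK.radialFn_eq (ne_zero_of_mem_unitSphere hθ)]
  exact inv_pos.2 (hK.gauge_pos (ne_zero_of_mem_unitSphere hθ))

theorem continuousOn_radialFn (hK : IsGaussBody K α) :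
    ContinuousOn (radialFn K) (unitSphere n) := by
  refine ContinuousOn.congr (f := fun θ => (gauge K θ)⁻¹) ?_
    fun θ hθ => hK.radialFn_eq (ne_zero_of_mem_unitSphere hθ)
  exact hK.continuous_gauge.continuousOn.inv₀ fun θ hθ =>
    (hK.gauge_pos (ne_zero_of_mem_unitSphere hθ)).ne'

theorem gauge_eq (hK : IsGaussBody K α) {x : Es n} (hx : x ≠ 0) :
    gauge K x = ‖x‖ / radialFn K (‖x‖⁻¹ • x) := by
  have h0 : ‖x‖ ≠ 0 := norm_ne_zero_iff.2 hx
  rw [hK.radialFn_eq (ne_zero_of_mem_unitSphere (norm_inv_smul_mem_unitSphere hx)), div_inv_eq_mul,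
    gauge_smul_of_nonneg (by positivity), smul_eq_mul, mul_inv_cancel_left₀ h0]

theorem radialFn_smul_mem (hK : IsGaussBody K α)
    {θ : Es n} (hθ : θ ∈ unitSphere n) : radialFn K θ • θ ∈ K := by
  have h0 := hK.gauge_pos (ne_zero_of_mem_unitSphere hθ)
  rw [hK.mem_iff_gauge_le_one, gauge_smul_of_nonneg (hK.radialFn_pos hθ).le, smul_eq_mul,
    hK.radialFn_eq (ne_zero_of_mem_unitSphere hθ), inv_mul_cancel₀ h0.ne']

theorem mem_normalCone (hK : IsGaussBody K α) {θ : Es n} (hθ : θ ∈ unitSphere n) :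
    α θ ∈ normalCone K ((radialFn K θ) • θ) := by
  rw [hK.normalCone_eq θ hθ]; rfl

theorem norm_map (hK : IsGaussBody K α)
    {θ : Es n} (hθ : θ ∈ unitSphere n) : ‖α θ‖ = 1 :=
  (hK.mem_normalCone hθ).1

theorem supportFn_eq (hK : IsGaussBody K α) {θ : Es n} (hθ : θ ∈ unitSphere n) :
    supportFn K (α θ) = radialFn K θ * ⟪θ, α θ⟫ := by
  rw [← real_inner_smul_left]
  refine IsGreatest.csSup_eq ⟨⟨_, hK.radialFn_smul_mem hθ, rfl⟩, ?_⟩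
  rintro _ ⟨y, hy, rfl⟩
  have := (hK.mem_normalCone hθ).2 y hy
  rw [inner_sub_left] at this
  exact sub_nonpos.1 this

theorem inner_le_supportFn (hK : IsGaussBody K α)
    {θ y : Es n} (hθ : θ ∈ unitSphere n) (hy : y ∈ K) :
    ⟪y, α θ⟫ ≤ supportFn K (α θ) := by
  have := (hK.mem_normalCone hθ).2 y hy
  rw [inner_sub_left, real_inner_smul_left, ← hK.supportFn_eq hθ] at this
  exact sub_nonpos.1 this

theorem exists_le_supportFn (hK : IsGaussBody K α) :
    ∃ ε > 0, ∀ θ ∈ unitSphere n, ε ≤ supportFn K (α θ) := by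
  obtain ⟨ε, hε, hball⟩ := Metric.nhds_basis_closedBall.mem_iff.1 hK.mem_nhds
  refine ⟨ε, hε, fun θ hθ => ?_⟩
  have h1 := hK.norm_map hθ
  have h2 : ε • α θ ∈ K := hball (by
    rw [mem_closedBall_zero_iff, norm_smul, h1, Real.norm_of_nonneg hε.le, mul_one])
  have h3 := hK.inner_le_supportFn hθ h2
  rwa [real_inner_smul_left, real_inner_self_eq_norm_sq, h1, one_pow, mul_one] at h3

theorem supportFn_pos (hK : IsGaussBody K α)
    {θ : Es n} (hθ : θ ∈ unitSphere n) : 0 < supportFn K (α θ) := by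
  obtain ⟨ε, hε, h⟩ := hK.exists_le_supportFn
  exact hε.trans_le (h θ hθ)

theorem continuousOn_map (hK : IsGaussBody K α) : ContinuousOn α (unitSphere n) := by
  intro θ hθ
  refine (isCompact_sphere (0 : Es n) 1).tendsto_nhds_of_unique_mapClusterPt ?_ fun y hy hcl => ?_
  · filter_upwards [self_mem_nhdsWithin] with θ' hθ'
    exact mem_sphere_zero_iff_norm.2 (hK.norm_map hθ')
  rw [← mem_singleton_iff, ← hK.normalCone_eq θ hθ]
  refine ⟨mem_sphere_zero_iff_norm.1 hy, fun z hz => ?_⟩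
  by_contra! hlt
  have h1 : ContinuousAt (fun p : Es n × Es n => ⟪z - p.1, p.2⟫) (radialFn K θ • θ, y) := by
    fun_prop
  have h2 := h1.eventually (lt_mem_nhds hlt)
  rw [nhds_prod_eq] at h2
  obtain ⟨P, hP, Q, hQ, hPQ⟩ := eventually_prod_iff.1 h2
  have h3 : Tendsto (fun θ' => radialFn K θ' • θ') (𝓝[unitSphere n] θ) (𝓝 (radialFn K θ • θ)) :=
    (hK.continuousOn_radialFn.smul continuousOn_id) θ hθ
  obtain ⟨θ', hθ'Q, hθ'P, hθ'⟩ := ((hcl.frequently hQ).and_eventually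
    ((h3.eventually hP).and self_mem_nhdsWithin)).exists
  exact absurd ((hK.mem_normalCone hθ').2 z hz) (not_le.2 (hPQ hθ'P hθ'Q))

theorem continuousOn_supportFn (hK : IsGaussBody K α) :
    ContinuousOn (fun θ => supportFn K (α θ)) (unitSphere n) := by
  refine ContinuousOn.congr (f := fun θ => radialFn K θ * ⟪θ, α θ⟫) ?_
    fun θ hθ => hK.supportFn_eq hθ
  exact hK.continuousOn_radialFn.mul (continuousOn_id.inner hK.continuousOn_map)

theorem inner_le_supportFn_mul_gauge (hK : IsGaussBody K α)
    {θ : Es n} (hθ : θ ∈ unitSphere n) (y : Es n) :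
    ⟪y, α θ⟫ ≤ supportFn K (α θ) * gauge K y := by
  rcases eq_or_ne y 0 with rfl | hy
  · simp
  have h0 := hK.gauge_pos hy
  have h1 : (gauge K y)⁻¹ • y ∈ K := by
    rw [hK.mem_iff_gauge_le_one, gauge_smul_of_nonneg (inv_nonneg.2 h0.le), smul_eq_mul,
      inv_mul_cancel₀ h0.ne']
  have h2 := hK.inner_le_supportFn hθ h1
  rwa [real_inner_smul_left, inv_mul_le_iff₀ h0, mul_comm] at h2

theorem inner_self_eq (hK : IsGaussBody K α) {x : Es n} (hx : x ≠ 0) :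
    ⟪x, α (‖x‖⁻¹ • x)⟫ = supportFn K (α (‖x‖⁻¹ • x)) * gauge K x := by
  have hθ := norm_inv_smul_mem_unitSphere hx
  have h0 : ‖x‖ ≠ 0 := norm_ne_zero_iff.2 hx
  have h1 := (hK.radialFn_pos hθ).ne'
  rw [hK.gauge_eq hx, hK.supportFn_eq hθ, real_inner_smul_left]
  generalize ‖x‖⁻¹ • x = θ at h1 ⊢
  field_simp

/-- The support hyperplanes touch `K` only once. -/
theorem eq_of_inner_eq (hK : IsGaussBody K α)
    {θ a b : Es n} (hθ : θ ∈ unitSphere n) (ha : a ∈ K) (hb : b ∈ K)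
    (ha' : ⟪a, α θ⟫ = supportFn K (α θ)) (hb' : ⟪b, α θ⟫ = supportFn K (α θ)) : a = b := by
  by_contra hab
  refine hK.not_segment_subset a b hab fun z hz => ?_
  have hzK := hK.convex.segment_subset ha hb hz
  have hz' : ⟪z, α θ⟫ = supportFn K (α θ) := by
    obtain ⟨s, t, -, -, hst, rfl⟩ := hz
    rw [inner_add_left, real_inner_smul_left, real_inner_smul_left, ha', hb', ← add_mul, hst,
      one_mul]
  rw [← gauge_eq_one_iff_mem_frontier hK.convex hK.mem_nhds]
  refine le_antisymm (hK.mem_iff_gauge_le_one.1 hzK) ?_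
  have h1 := hK.inner_le_supportFn_mul_gauge hθ z
  rw [hz'] at h1
  exact le_of_mul_le_mul_left (by rwa [mul_one]) (hK.supportFn_pos hθ)

theorem isStrictSubgradientMap (hK : IsGaussBody K α) :
    IsStrictSubgradientMap (halfSqGauge K) (gradHalfSqGauge K α) := by
  intro x y hxy
  rcases eq_or_ne x 0 with rfl | hx
  · have := hK.gauge_pos hxy.symm
    simp only [halfSqGauge, gradHalfSqGauge, gauge_zero, zero_div, zero_smul, inner_zero_left,
      add_zero, zero_pow two_ne_zero]
    positivity
  have hθ := norm_inv_smul_mem_unitSphere hx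
  set ξ := α (‖x‖⁻¹ • x) with hξ
  have hh : 0 < supportFn K ξ := hK.supportFn_pos hθ
  have hgx := hK.gauge_pos hx
  have h1 : ⟪x, ξ⟫ = supportFn K ξ * gauge K x := hK.inner_self_eq hx
  have h2 : ⟪y, ξ⟫ ≤ supportFn K ξ * gauge K y := hK.inner_le_supportFn_mul_gauge hθ y
  have h3 : ⟪gradHalfSqGauge K α x, y - x⟫ =
      gauge K x * (⟪y, ξ⟫ / supportFn K ξ) - gauge K x ^ 2 := by
    rw [gradHalfSqGauge, ← hξ, real_inner_smul_left, real_inner_comm, inner_sub_left, h1]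
    field_simp
  have h4 : ⟪y, ξ⟫ / supportFn K ξ ≤ gauge K y := by rwa [div_le_iff₀' hh]
  rw [h3, halfSqGauge, halfSqGauge]
  by_cases hg : gauge K x = gauge K y
  · have h5 : ⟪y, ξ⟫ / supportFn K ξ < gauge K y := by
      refine lt_of_le_of_ne h4 fun h5 => hxy ?_
      rw [div_eq_iff hh.ne', ← hg] at h5
      have hmem : ∀ z : Es n, gauge K z = gauge K x → (gauge K x)⁻¹ • z ∈ K := by
        intro z hz
        rw [hK.mem_iff_gauge_le_one, gauge_smul_of_nonneg (inv_nonneg.2 hgx.le), smul_eq_mul, hz,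
          inv_mul_cancel₀ hgx.ne']
      refine smul_right_injective _ (inv_pos.2 hgx).ne' (hK.eq_of_inner_eq hθ (hmem x rfl)
        (hmem y hg.symm) ?_ ?_)
      · rw [real_inner_smul_left, ← hξ, h1]
        field_simp
      · rw [real_inner_smul_left, ← hξ, h5]
        field_simp
    rw [← hg] at h5 ⊢
    nlinarith
  · have h5 := mul_le_mul_of_nonneg_left h4 hgx.le
    have h6 : 0 < (gauge K x - gauge K y) ^ 2 := by
      have := sub_ne_zero.2 hg
      positivity
    nlinarith

theorem gradHalfSqGauge_smul (hK : IsGaussBody K α)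
    {r : ℝ} (hr : 0 < r) {θ : Es n} (hθ : θ ∈ unitSphere n) :
    gradHalfSqGauge K α (r • θ) = (r * (radialFn K θ * supportFn K (α θ))⁻¹) • α θ := by
  have h1 : ‖r • θ‖⁻¹ • r • θ = θ := by
    rw [norm_smul, norm_eq_one_of_mem_unitSphere hθ, mul_one, Real.norm_of_nonneg hr.le,
      smul_smul, inv_mul_cancel₀ hr.ne', one_smul]
  rw [gradHalfSqGauge, h1, gauge_smul_of_nonneg hr.le, smul_eq_mul,
    hK.radialFn_eq (ne_zero_of_mem_unitSphere hθ), mul_inv, inv_inv, mul_div_assoc, div_eq_mul_inv]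

theorem continuous_gradHalfSqGauge (hK : IsGaussBody K α) : Continuous (gradHalfSqGauge K α) := by
  refine continuous_iff_continuousAt.2 fun x => ?_
  rcases eq_or_ne x 0 with rfl | hx
  · obtain ⟨ε, hε, h⟩ := hK.exists_le_supportFn
    have h0 : gradHalfSqGauge K α 0 = 0 := by simp [gradHalfSqGauge]
    rw [ContinuousAt, h0]
    refine squeeze_zero_norm (a := fun x => gauge K x / ε) (fun x => ?_) ?_
    · rcases eq_or_ne x 0 with rfl | hx
      · simp [h0]
      have hθ := norm_inv_smul_mem_unitSphere hx
      rw [gradHalfSqGauge, norm_smul, hK.norm_map hθ, mul_one, Real.norm_of_nonneg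
        (div_nonneg (gauge_nonneg _) (hK.supportFn_pos hθ).le)]
      exact div_le_div_of_nonneg_left (gauge_nonneg _) hε (h _ hθ)
    · have := (hK.continuous_gauge.div_const ε).tendsto 0
      simpa using this
  · have h1 : ContinuousOn (fun x : Es n => ‖x‖⁻¹ • x) {0}ᶜ :=
      (continuousOn_id.norm.inv₀ fun y hy => norm_ne_zero_iff.2 hy).smul continuousOn_id
    have h2 : MapsTo (fun x : Es n => ‖x‖⁻¹ • x) {0}ᶜ (unitSphere n) :=
      fun y hy => norm_inv_smul_mem_unitSphere hy
    have h3 : ContinuousOn (gradHalfSqGauge K α) {0}ᶜ :=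
      (hK.continuous_gauge.continuousOn.div (hK.continuousOn_supportFn.comp h1 h2)
        fun y hy => (hK.supportFn_pos (h2 hy)).ne').smul (hK.continuousOn_map.comp h1 h2)
    exact h3.continuousAt (isOpen_compl_singleton.mem_nhds hx)

end IsGaussBody

end ConvexBody

section LocallyLipschitzAt

variable {X Y Z : Type*} [PseudoMetricSpace X] [PseudoMetricSpace Y] [PseudoMetricSpace Z]

/-- `f` is Lipschitz in a neighbourhood of `x`. -/
def LipschitzNear (f : X → Y) (x : X) : Prop :=
  ∃ C : NNReal, ∃ t ∈ 𝓝 x, LipschitzOnWith C f t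

theorem LipschitzNear.continuousAt {f : X → Y} {x : X} (hf : LipschitzNear f x) :
    ContinuousAt f x := by
  obtain ⟨C, t, ht, h⟩ := hf
  exact h.continuousOn.continuousAt ht

theorem LipschitzOnWith.comp_lipschitzNear {C : NNReal} {g : Y → Z} {s : Set Y} {f : X → Y} {x : X}
    (hg : LipschitzOnWith C g s) (hf : LipschitzNear f x) (h : ∀ᶠ y in 𝓝 x, f y ∈ s) :
    LipschitzNear (fun y => g (f y)) x := by
  obtain ⟨C', t, ht, hft⟩ := hf
  exact ⟨C * C', t ∩ {y | f y ∈ s}, inter_mem ht h,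
    hg.comp (hft.mono inter_subset_left) fun y hy => hy.2⟩

theorem LipschitzNear.comp {g : Y → Z} {f : X → Y} {x : X} (hg : LipschitzNear g (f x))
    (hf : LipschitzNear f x) : LipschitzNear (fun y => g (f y)) x := by
  obtain ⟨C, s, hs, h⟩ := hg
  exact h.comp_lipschitzNear hf (hf.continuousAt hs)

theorem LipschitzNear.prodMk {g : X → Z} {f : X → Y} {x : X} (hf : LipschitzNear f x)
    (hg : LipschitzNear g x) : LipschitzNear (fun y => (f y, g y)) x := by
  obtain ⟨C, s, hs, h⟩ := hf
  obtain ⟨C', t, ht, h'⟩ := hg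
  exact ⟨max C C', s ∩ t, inter_mem hs ht,
    (h.mono inter_subset_left).prodMk (h'.mono inter_subset_right)⟩

end LocallyLipschitzAt

section GaussDensity

variable {n : ℕ} {F G : Es n × ℝ → ℝ} {LF LG : NNReal}

theorem LipschitzNear.div_mul {X : Type*} [PseudoMetricSpace X] {a b m : X → ℝ} {x : X}
    (ha : LipschitzNear a x) (hb : LipschitzNear b x) (hm : LipschitzNear m x) (hbx : b x ≠ 0) :
    LipschitzNear (fun y => a y / b y * m y) x := by
  have h1 : ContDiffAt ℝ 1 (fun z : ℝ × ℝ × ℝ => z.2.1) (a x, b x, m x) := by fun_prop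
  have h2 : ContDiffAt ℝ 1 (fun z : ℝ × ℝ × ℝ => z.2.2) (a x, b x, m x) := by fun_prop
  have h : ContDiffAt ℝ 1 (fun z : ℝ × ℝ × ℝ => z.1 / z.2.1 * z.2.2) (a x, b x, m x) :=
    (contDiffAt_fst.div h1 hbx).mul h2
  exact LipschitzNear.comp (g := fun z : ℝ × ℝ × ℝ => z.1 / z.2.1 * z.2.2)
    (f := fun y => (a y, b y, m y)) h.exists_lipschitzOnWith (ha.prodMk (hb.prodMk hm))

theorem LipschitzOnWith.lipschitzNear_normalize {X : Type*} [NormedAddCommGroup X]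
    [NormedSpace ℝ X] (hF : LipschitzOnWith LF F (unitSphere n ×ˢ Ioi (0 : ℝ))) {c : X → Es n}
    {s : X → ℝ} {x : X} (hc : ContDiffAt ℝ 1 c x) (hs : ContDiffAt ℝ 1 s x) (hc0 : c x ≠ 0)
    (hs0 : 0 < s x) : LipschitzNear (fun y => F (‖c y‖⁻¹ • c y, s y)) x := by
  have h : ContDiffAt ℝ 1 (fun y => (‖c y‖⁻¹ • c y, s y)) x :=
    (((hc.norm ℝ hc0).inv (norm_ne_zero_iff.2 hc0)).smul hc).prodMk hs
  refine hF.comp_lipschitzNear (f := fun y => (‖c y‖⁻¹ • c y, s y)) h.exists_lipschitzOnWith ?_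
  filter_upwards [hc.continuousAt.eventually_ne hc0,
    hs.continuousAt.eventually (lt_mem_nhds hs0)] with y h1 h2
  exact ⟨norm_inv_smul_mem_unitSphere h1, h2⟩

/-- The density of the Monge-Ampère equation associated with the Gauss image problem, as a function
of the position, the value and the gradient. -/
def gaussDensity (F G : Es n × ℝ → ℝ) (w : Es n × ℝ × Es n) : ℝ :=
  F (‖w.1‖⁻¹ • w.1, ‖w.1‖ / √(2 * w.2.1)) / G (‖w.2.2‖⁻¹ • w.2.2, √(2 * w.2.1) / ‖w.2.2‖) *
    (‖w.2.2‖ / ‖w.1‖) ^ (n + 1)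

theorem lipschitzNear_gaussDensity (hF : LipschitzOnWith LF F (unitSphere n ×ˢ Ioi (0 : ℝ)))
    (hG : LipschitzOnWith LG G (unitSphere n ×ˢ Ioi (0 : ℝ)))
    (hG0 : ∀ z ∈ unitSphere n ×ˢ Ioi (0 : ℝ), 0 < G z) {w : Es n × ℝ × Es n} (h1 : w.1 ≠ 0)
    (h2 : 0 < w.2.1) (h3 : w.2.2 ≠ 0) : LipschitzNear (gaussDensity F G) w := by
  have c1 : ContDiffAt ℝ 1 (fun w : Es n × ℝ × Es n => w.1) w := contDiffAt_fst
  have c2 : ContDiffAt ℝ 1 (fun w : Es n × ℝ × Es n => √(2 * w.2.1)) w :=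
    (contDiffAt_const.mul (contDiffAt_fst.comp w contDiffAt_snd)).sqrt (by positivity)
  have c3 : ContDiffAt ℝ 1 (fun w : Es n × ℝ × Es n => w.2.2) w :=
    contDiffAt_snd.comp w contDiffAt_snd
  have n1 := c1.norm ℝ h1
  have n3 := c3.norm ℝ h3
  have p1 : 0 < ‖w.1‖ := norm_pos_iff.2 h1
  have p2 : 0 < √(2 * w.2.1) := by positivity
  have p3 : 0 < ‖w.2.2‖ := norm_pos_iff.2 h3
  have hC : LipschitzNear (fun w : Es n × ℝ × Es n => (‖w.2.2‖ / ‖w.1‖) ^ (n + 1)) w :=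
    ((n3.div n1 p1.ne').pow (n + 1)).exists_lipschitzOnWith
  have hGw := hG0 (‖w.2.2‖⁻¹ • w.2.2, √(2 * w.2.1) / ‖w.2.2‖)
    ⟨norm_inv_smul_mem_unitSphere h3, div_pos p2 p3⟩
  have hA := hF.lipschitzNear_normalize c1 (n1.div c2 p2.ne') h1 (div_pos p1 p2)
  have hB := hG.lipschitzNear_normalize c3 (c2.div n3 p3.ne') h3 (div_pos p2 p3)
  exact hA.div_mul hB hC hGw.ne'

namespace IsGaussBody

variable {K : Set (Es n)} {α : Es n → Es n}

theorem halfSqGauge_pos (hK : IsGaussBody K α) {x : Es n} (hx : x ≠ 0) : 0 < halfSqGauge K x := by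
  have := hK.gauge_pos hx
  rw [halfSqGauge]; positivity

theorem norm_gradHalfSqGauge (hK : IsGaussBody K α) {x : Es n} (hx : x ≠ 0) :
    ‖gradHalfSqGauge K α x‖ = gauge K x / supportFn K (α (‖x‖⁻¹ • x)) := by
  have hθ := norm_inv_smul_mem_unitSphere hx
  rw [gradHalfSqGauge, norm_smul, hK.norm_map hθ, mul_one, Real.norm_of_nonneg
    (div_nonneg (gauge_nonneg _) (hK.supportFn_pos hθ).le)]

theorem gradHalfSqGauge_ne_zero (hK : IsGaussBody K α)
    {x : Es n} (hx : x ≠ 0) : gradHalfSqGauge K α x ≠ 0 := by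
  rw [← norm_pos_iff, hK.norm_gradHalfSqGauge hx]
  exact div_pos (hK.gauge_pos hx) (hK.supportFn_pos (norm_inv_smul_mem_unitSphere hx))

theorem gaussDensity_eq (hK : IsGaussBody K α)
    (F G : Es n × ℝ → ℝ) {x θ : Es n} (hx : x ≠ 0) (hθ : ‖x‖⁻¹ • x = θ) :
    gaussDensity F G (x, halfSqGauge K x, gradHalfSqGauge K α x) =
      F (θ, radialFn K θ) / G (α θ, supportFn K (α θ)) *
        ((radialFn K θ * supportFn K (α θ))⁻¹) ^ (n + 1) := by
  have hθS : θ ∈ unitSphere n := hθ ▸ norm_inv_smul_mem_unitSphere hx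
  have hg := hK.gauge_pos hx
  have hh := hK.supportFn_pos hθS
  have hρ := hK.radialFn_pos hθS
  have hx0 : 0 < ‖x‖ := norm_pos_iff.2 hx
  have h1 : √(2 * halfSqGauge K x) = gauge K x := by
    rw [halfSqGauge, mul_div_cancel₀ _ two_ne_zero, Real.sqrt_sq hg.le]
  have h2 := hK.norm_gradHalfSqGauge hx
  have h3 := hK.gauge_eq hx
  rw [hθ] at h2 h3
  have h4 : ‖gradHalfSqGauge K α x‖⁻¹ • gradHalfSqGauge K α x = α θ := by
    rw [h2, gradHalfSqGauge, hθ, smul_smul, inv_mul_cancel₀ (div_pos hg hh).ne', one_smul]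
  rw [h2] at h4
  simp only [gaussDensity, h1, h2, h4, hθ]
  have h5 : ‖x‖ / gauge K x = radialFn K θ := by rw [h3]; field_simp
  have h6 : gauge K x / (gauge K x / supportFn K (α θ)) = supportFn K (α θ) := by field_simp
  have h7 : gauge K x / supportFn K (α θ) / ‖x‖ = (radialFn K θ * supportFn K (α θ))⁻¹ := by
    rw [h3]; field_simp
  rw [h5, h6, h7]

theorem continuous_halfSqGauge (hK : IsGaussBody K α) : Continuous (halfSqGauge K) :=
  (hK.continuous_gauge.pow 2).div_const 2

theorem gaussDensity_pos (hK : IsGaussBody K α) (hF0 : ∀ z ∈ unitSphere n ×ˢ Ioi (0 : ℝ), 0 < F z)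
    (hG0 : ∀ z ∈ unitSphere n ×ˢ Ioi (0 : ℝ), 0 < G z) {x : Es n} (hx : x ≠ 0) :
    0 < gaussDensity F G (x, halfSqGauge K x, gradHalfSqGauge K α x) := by
  rw [hK.gaussDensity_eq F G hx rfl]
  have hθ := norm_inv_smul_mem_unitSphere hx
  have h1 := hK.supportFn_pos hθ
  have h2 := hK.radialFn_pos hθ
  have h3 := hF0 (‖x‖⁻¹ • x, _) ⟨hθ, h2⟩
  have h4 := hG0 (α (‖x‖⁻¹ • x), _) ⟨mem_sphere_zero_iff_norm.2 (hK.norm_map hθ), h1⟩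
  positivity

theorem continuousOn_gaussDensity (hK : IsGaussBody K α)
    (hF : LipschitzOnWith LF F (unitSphere n ×ˢ Ioi (0 : ℝ)))
    (hG : LipschitzOnWith LG G (unitSphere n ×ˢ Ioi (0 : ℝ)))
    (hG0 : ∀ z ∈ unitSphere n ×ˢ Ioi (0 : ℝ), 0 < G z) :
    ContinuousOn (fun x => gaussDensity F G (x, halfSqGauge K x, gradHalfSqGauge K α x))
      {0}ᶜ := by
  intro x hx
  have h1 := (lipschitzNear_gaussDensity hF hG hG0
    (w := (x, halfSqGauge K x, gradHalfSqGauge K α x)) hx (hK.halfSqGauge_pos hx)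
    (hK.gradHalfSqGauge_ne_zero hx)).continuousAt
  have h2 : Continuous fun x => (x, halfSqGauge K x, gradHalfSqGauge K α x) :=
    continuous_id.prodMk (hK.continuous_halfSqGauge.prodMk hK.continuous_gradHalfSqGauge)
  exact (h1.comp (f := fun x => (x, halfSqGauge K x, gradHalfSqGauge K α x))
    h2.continuousAt).continuousWithinAt

end IsGaussBody

end GaussDensity

section GaussImage

variable {n : ℕ}

theorem exists_sphMeasure_eq_smul : ∃ c : ℝ≥0∞, c ≠ 0 ∧ c ≠ ∞ ∧
    (∀ A ⊆ unitSphere n, sphMeasure n A = c * surfaceMeasure (Es n) A) ∧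
    ∀ A ⊆ unitSphere n, ∀ g : Es n → ℝ≥0∞,
      ∫⁻ θ in A, g θ ∂sphMeasure n = c * ∫⁻ θ in A, g θ ∂surfaceMeasure (Es n) := by
  obtain ⟨c, hc0, hc1, hc⟩ := exists_sphMeasure_restrict_eq_smul (n := n)
  have hS : MeasurableSet (unitSphere n) := isClosed_sphere.measurableSet
  refine ⟨c, hc0, hc1, fun A hA => ?_, fun A hA g => ?_⟩
  · rw [← smul_eq_mul, ← Measure.smul_apply, ← hc, Measure.restrict_apply' hS,
      inter_eq_left.2 hA]
  · rw [← smul_eq_mul, ← lintegral_smul_measure, ← Measure.restrict_smul, ← hc,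
      Measure.restrict_restrict' hS, inter_eq_left.2 hA]

/-- The open cone over a subset of the sphere. -/
def coneOver (W : Set (Es n)) : Set (Es n) := {x | x ≠ 0 ∧ ‖x‖⁻¹ • x ∈ W}

theorem eq_smul_of_mem_coneOver {W : Set (Es n)} {x : Es n} (hx : x ∈ coneOver W) :
    ∃ r > (0 : ℝ), ∃ w ∈ W, x = r • w :=
  ⟨‖x‖, norm_pos_iff.2 hx.1, _, hx.2, by
    rw [smul_smul, mul_inv_cancel₀ (norm_ne_zero_iff.2 hx.1), one_smul]⟩

theorem continuousOn_norm_inv_smul : ContinuousOn (fun x : Es n => ‖x‖⁻¹ • x) {0}ᶜ :=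
  (continuousOn_id.norm.inv₀ fun _ hy => norm_ne_zero_iff.2 hy).smul continuousOn_id

theorem isOpen_coneOver {O : Set (Es n)} (hO : IsOpen O) :
    IsOpen (coneOver (O ∩ unitSphere n)) := by
  have h1 : coneOver (O ∩ unitSphere n) = {0}ᶜ ∩ (fun x : Es n => ‖x‖⁻¹ • x) ⁻¹' O := by
    ext x
    refine and_congr_right fun hx => ⟨fun h => h.1, fun h => ⟨h, norm_inv_smul_mem_unitSphere hx⟩⟩
  rw [h1]
  exact continuousOn_norm_inv_smul.isOpen_inter_preimage isOpen_compl_singleton hO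

theorem norm_inv_smul_smul {θ : Es n} (hθ : θ ∈ unitSphere n) {r : ℝ} (hr : 0 < r) :
    ‖r • θ‖⁻¹ • r • θ = θ := by
  rw [norm_smul, norm_eq_one_of_mem_unitSphere hθ, mul_one, Real.norm_of_nonneg hr.le,
    smul_smul, inv_mul_cancel₀ hr.ne', one_smul]

theorem isPreconnected_coneOver {W : Set (Es n)} (hW : W ⊆ unitSphere n) (hc : IsPreconnected W) :
    IsPreconnected (coneOver W) := by
  have h1 : coneOver W = (fun p : Es n × ℝ => p.2 • p.1) '' (W ×ˢ Ioi (0 : ℝ)) := by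
    ext x
    constructor
    · intro hx
      obtain ⟨r, hr, w, hw, rfl⟩ := eq_smul_of_mem_coneOver hx
      exact ⟨(w, r), ⟨hw, hr⟩, rfl⟩
    · rintro ⟨⟨w, r⟩, ⟨hw, hr⟩, rfl⟩
      have hr' : (0 : ℝ) < r := hr
      refine ⟨smul_ne_zero hr'.ne' (ne_zero_of_mem_unitSphere (hW hw)), ?_⟩
      simp only
      rwa [norm_inv_smul_smul (hW hw) hr']
  rw [h1]
  exact (hc.prod isPreconnected_Ioi).image _ (by fun_prop)

variable {K : Set (Es n)} {α : Es n → Es n} {F G : Es n × ℝ → ℝ} {LF LG : NNReal} {f : Es n → ℝ}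
  {W : Set (Es n)}

namespace IsGaussBody

theorem mapsTo_sphere (hK : IsGaussBody K α) : MapsTo α (unitSphere n) (unitSphere n) :=
  fun _ hθ => mem_sphere_zero_iff_norm.2 (hK.norm_map hθ)

theorem continuousOn_ratio (hK : IsGaussBody K α)
    (hF : LipschitzOnWith LF F (unitSphere n ×ˢ Ioi (0 : ℝ)))
    (hG : LipschitzOnWith LG G (unitSphere n ×ˢ Ioi (0 : ℝ)))
    (hG0 : ∀ z ∈ unitSphere n ×ˢ Ioi (0 : ℝ), 0 < G z) :
    ContinuousOn (fun θ => F (θ, radialFn K θ) / G (α θ, supportFn K (α θ))) (unitSphere n) := by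
  have h1 : ContinuousOn (fun θ => F (θ, radialFn K θ)) (unitSphere n) :=
    ContinuousOn.comp (g := F) (f := fun θ => (θ, radialFn K θ)) hF.continuousOn
      (continuousOn_id.prodMk hK.continuousOn_radialFn) fun _ hθ => ⟨hθ, hK.radialFn_pos hθ⟩
  have h2 : MapsTo (fun θ => (α θ, supportFn K (α θ))) (unitSphere n)
      (unitSphere n ×ˢ Ioi (0 : ℝ)) :=
    fun _ hθ => ⟨hK.mapsTo_sphere hθ, hK.supportFn_pos hθ⟩
  have h3 : ContinuousOn (fun θ => G (α θ, supportFn K (α θ))) (unitSphere n) :=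
    ContinuousOn.comp (g := G) (f := fun θ => (α θ, supportFn K (α θ))) hG.continuousOn
      (hK.continuousOn_map.prodMk hK.continuousOn_supportFn) h2
  exact h1.div h3 fun θ hθ => (hG0 (α θ, supportFn K (α θ)) (h2 hθ)).ne'

/-- On cones over subsets of the sphere, the Monge-Ampère measure of `halfSqGauge K` is compared
with its density through the Gauss image measure of `K`. -/
theorem volume_image_and_lintegral (hK : IsGaussBody K α)
    (hF : LipschitzOnWith LF F (unitSphere n ×ˢ Ioi (0 : ℝ)))
    (hG : LipschitzOnWith LG G (unitSphere n ×ˢ Ioi (0 : ℝ)))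
    (hG0 : ∀ z ∈ unitSphere n ×ˢ Ioi (0 : ℝ), 0 < G z) (hf : Measurable f)
    (hWm : MeasurableSet W) (hW : W ⊆ unitSphere n) {A : Set (Es n)} (hA : A ⊆ coneOver W)
    (hAm : MeasurableSet A) :
    ((∀ ω ⊆ W, MeasurableSet ω → sphMeasure n (α '' ω) ≤ ∫⁻ θ in ω, ENNReal.ofReal
        (f θ * F (θ, radialFn K θ) / G (α θ, supportFn K (α θ))) ∂sphMeasure n) →
      volume (gradHalfSqGauge K α '' A) ≤ ∫⁻ x in A, ENNReal.ofReal (f (‖x‖⁻¹ • x) *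
        gaussDensity F G (x, halfSqGauge K x, gradHalfSqGauge K α x))) ∧
    ((∀ ω ⊆ W, MeasurableSet ω → ∫⁻ θ in ω, ENNReal.ofReal
        (f θ * F (θ, radialFn K θ) / G (α θ, supportFn K (α θ))) ∂sphMeasure n ≤
          sphMeasure n (α '' ω)) →
      ∫⁻ x in A, ENNReal.ofReal (f (‖x‖⁻¹ • x) *
        gaussDensity F G (x, halfSqGauge K x, gradHalfSqGauge K α x)) ≤
        volume (gradHalfSqGauge K α '' A)) := by
  classical
  have hS : MeasurableSet (unitSphere n) := isClosed_sphere.measurableSet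
  set D : Es n → ℝ := (unitSphere n).indicator
    fun θ => F (θ, radialFn K θ) / G (α θ, supportFn K (α θ)) with hD
  set k : Es n → ℝ := (unitSphere n).indicator
    fun θ => (radialFn K θ * supportFn K (α θ))⁻¹ with hk
  have hDm : Measurable D := by
    rw [hD, ← piecewise_eq_indicator]
    exact (hK.continuousOn_ratio hF hG hG0).measurable_piecewise continuousOn_const hS
  have hkm : Measurable k := by
    rw [hk, ← piecewise_eq_indicator]
    exact ((hK.continuousOn_radialFn.mul hK.continuousOn_supportFn).inv₀ fun θ hθ =>
      (mul_pos (hK.radialFn_pos hθ) (hK.supportFn_pos hθ)).ne').measurable_piecewise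
        continuousOn_const hS
  have hk0 : ∀ w ∈ W, 0 < k w := fun w hw => by
    rw [hk, indicator_of_mem (hW hw)]
    exact inv_pos.2 (mul_pos (hK.radialFn_pos (hW hw)) (hK.supportFn_pos (hW hw)))
  set φ : Es n → ℝ≥0∞ := fun θ => ENNReal.ofReal (f θ * D θ) with hφ
  have hφm : Measurable φ := (hf.mul hDm).ennreal_ofReal
  have hq : ∀ r > 0, ∀ w ∈ W, gradHalfSqGauge K α (r • w) = (r * k w) • α w :=
    fun r hr w hw => by rw [hK.gradHalfSqGauge_smul hr (hW hw), hk, indicator_of_mem (hW hw)]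
  have hint : ∫⁻ x in A, ENNReal.ofReal (f (‖x‖⁻¹ • x) *
        gaussDensity F G (x, halfSqGauge K x, gradHalfSqGauge K α x)) =
      ∫⁻ x in A, φ (‖x‖⁻¹ • x) * ENNReal.ofReal (k (‖x‖⁻¹ • x) ^ finrank ℝ (Es n)) := by
    refine setLIntegral_congr_fun hAm fun x hx => ?_
    have hx0 := (hA hx).1
    have hθ := hW (hA hx).2
    have h2 : 0 ≤ k (‖x‖⁻¹ • x) ^ (n + 1) := pow_nonneg (hk0 _ (hA hx).2).le _
    simp only [hφ]
    rw [finrank_euclideanSpace_fin, ← ENNReal.ofReal_mul' h2, hK.gaussDensity_eq F G hx0 rfl, hk,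
      hD, indicator_of_mem hθ, indicator_of_mem hθ, mul_assoc]
  have hω : ∀ ω ⊆ W, MeasurableSet ω → ∫⁻ θ in ω, ENNReal.ofReal
        (f θ * F (θ, radialFn K θ) / G (α θ, supportFn K (α θ))) ∂sphMeasure n =
      ∫⁻ θ in ω, φ θ ∂sphMeasure n := fun ω hω hm => by
    refine setLIntegral_congr_fun hm fun θ hθ => ?_
    simp only [hφ]
    rw [hD, indicator_of_mem (hW (hω hθ)), mul_div_assoc]
  obtain ⟨c, hc0, hc1, hc, hc'⟩ := exists_sphMeasure_eq_smul (n := n)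
  have hαω : ∀ ω ⊆ W, α '' ω ⊆ unitSphere n := fun ω hω =>
    ((hK.mapsTo_sphere).mono_left (hω.trans hW)).image_subset
  have hα := hK.continuousOn_map.mono hW
  have hαW := hK.mapsTo_sphere.mono_left hW
  have hqi := hK.isStrictSubgradientMap.injective
  have hEW : ∀ x ∈ A, ∃ r > (0 : ℝ), ∃ w ∈ W, x = r • w := fun x hx =>
    eq_smul_of_mem_coneOver (hA hx)
  rw [hint]
  constructor
  · intro h
    refine volume_image_le_of_surfaceMeasure_image_le hWm hW hα hαW hkm hk0
      hK.continuous_gradHalfSqGauge hqi hq hφm hAm hEW fun ω hωW hm => ?_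
    have := h ω hωW hm
    rwa [hω ω hωW hm, hc _ (hαω ω hωW), hc' _ (hωW.trans hW),
      ENNReal.mul_le_mul_iff_right hc0 hc1] at this
  · intro h
    refine le_volume_image_of_le_surfaceMeasure_image hWm hW hα hαW hkm hk0
      hK.continuous_gradHalfSqGauge hqi hq hφm hAm hEW fun ω hωW hm => ?_
    have := h ω hωW hm
    rwa [hω ω hωW hm, hc _ (hαω ω hωW), hc' _ (hωW.trans hW),
      ENNReal.mul_le_mul_iff_right hc0 hc1] at this

theorem gradHalfSqGauge_eq_of_contact {K₁ K₂ : Set (Es n)} {α₁ α₂ : Es n → Es n}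
    (hK₁ : IsGaussBody K₁ α₁) (hK₂ : IsGaussBody K₂ α₂)
    (hle : ∀ x, halfSqGauge K₂ x ≤ halfSqGauge K₁ x) {x : Es n}
    (hx : halfSqGauge K₁ x = halfSqGauge K₂ x) :
    gradHalfSqGauge K₁ α₁ x = gradHalfSqGauge K₂ α₂ x := by
  have h1 := hK₁.isStrictSubgradientMap.isSubgradientMap.sub_inner (gradHalfSqGauge K₂ α₂ x)
  refine sub_eq_zero.1 (h1.eq_zero_of_isLocalMin
    (hK₁.continuous_gradHalfSqGauge.sub continuous_const) (x := x)
      (Eventually.of_forall fun y => ?_))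
  have h2 := hK₂.isStrictSubgradientMap.isSubgradientMap x y
  have h3 := hle y
  rw [inner_sub_right] at h2
  simp only
  linarith

theorem exists_gaussDensity_le {K₁ K₂ : Set (Es n)} {α₁ α₂ : Es n → Es n}
    (hK₁ : IsGaussBody K₁ α₁) (hK₂ : IsGaussBody K₂ α₂)
    (hF : LipschitzOnWith LF F (unitSphere n ×ˢ Ioi (0 : ℝ)))
    (hG : LipschitzOnWith LG G (unitSphere n ×ˢ Ioi (0 : ℝ)))
    (hG0 : ∀ z ∈ unitSphere n ×ˢ Ioi (0 : ℝ), 0 < G z)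
    (hle : ∀ x, halfSqGauge K₂ x ≤ halfSqGauge K₁ x) {x₀ : Es n} (hx₀ : x₀ ≠ 0)
    (hx : halfSqGauge K₁ x₀ = halfSqGauge K₂ x₀) :
    ∃ C, 0 ≤ C ∧ ∀ᶠ x in 𝓝 x₀,
      gaussDensity F G (x, halfSqGauge K₁ x, gradHalfSqGauge K₁ α₁ x) ≤
        gaussDensity F G (x, halfSqGauge K₂ x, gradHalfSqGauge K₂ α₂ x) +
          C * (|halfSqGauge K₁ x - halfSqGauge K₂ x| +
            ‖gradHalfSqGauge K₁ α₁ x - gradHalfSqGauge K₂ α₂ x‖) := by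
  have hg := hK₁.gradHalfSqGauge_eq_of_contact hK₂ hle hx
  obtain ⟨C, t, ht, hC⟩ := lipschitzNear_gaussDensity hF hG hG0
    (w := (x₀, halfSqGauge K₁ x₀, gradHalfSqGauge K₁ α₁ x₀)) hx₀ (hK₁.halfSqGauge_pos hx₀)
    (hK₁.gradHalfSqGauge_ne_zero hx₀)
  have h1 : Continuous fun x => (x, halfSqGauge K₁ x, gradHalfSqGauge K₁ α₁ x) :=
    continuous_id.prodMk (hK₁.continuous_halfSqGauge.prodMk hK₁.continuous_gradHalfSqGauge)
  have h2 : Continuous fun x => (x, halfSqGauge K₂ x, gradHalfSqGauge K₂ α₂ x) :=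
    continuous_id.prodMk (hK₂.continuous_halfSqGauge.prodMk hK₂.continuous_gradHalfSqGauge)
  refine ⟨C, C.2, ?_⟩
  filter_upwards [h1.continuousAt (x := x₀) ht,
    h2.continuousAt (x := x₀) (by rwa [← hx, ← hg])] with x hx1 hx2
  have h3 := hC.dist_le_mul _ hx1 _ hx2
  rw [Real.dist_eq, Prod.dist_eq, Prod.dist_eq, dist_self, Real.dist_eq, dist_eq_norm] at h3
  have h4 : max 0 (max |halfSqGauge K₁ x - halfSqGauge K₂ x|
      ‖gradHalfSqGauge K₁ α₁ x - gradHalfSqGauge K₂ α₂ x‖) ≤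
      |halfSqGauge K₁ x - halfSqGauge K₂ x| +
        ‖gradHalfSqGauge K₁ α₁ x - gradHalfSqGauge K₂ α₂ x‖ :=
    max_le (by positivity) (max_le (le_add_of_nonneg_right (norm_nonneg _))
      (le_add_of_nonneg_left (abs_nonneg _)))
  have h5 := mul_le_mul_of_nonneg_left h4 C.2
  have h6 := (le_abs_self _).trans h3
  exact sub_le_iff_le_add'.1 (h6.trans h5)

end IsGaussBody

end GaussImage

end

/-- Theorem 4.1 (Theorem `thm:smp Gauss image`): the strong maximum principle for the
Gauss image problem. -/
theorem statement_10 {n : ℕ} (hn : 1 ≤ n)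
    (Uhat : Set (Es n)) (hUsub : Uhat ⊆ unitSphere n)
    (hUopen : ∃ O : Set (Es n), IsOpen O ∧ Uhat = O ∩ unitSphere n)
    (hUconn : IsConnected Uhat)
    (ftil : Es n → ℝ) (hfm : Measurable ftil)
    (lam Lam : ℝ) (hlam : 0 < lam) (hLam : lam ≤ Lam)
    (hfb : ∀ θ ∈ unitSphere n, lam ≤ ftil θ ∧ ftil θ ≤ Lam)
    (Ftil Gtil : Es n × ℝ → ℝ) (LF LG : NNReal)
    (hFlip : LipschitzOnWith LF Ftil ((unitSphere n) ×ˢ Set.Ioi (0 : ℝ)))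
    (hGlip : LipschitzOnWith LG Gtil ((unitSphere n) ×ˢ Set.Ioi (0 : ℝ)))
    (hFpos : ∀ z ∈ (unitSphere n) ×ˢ Set.Ioi (0 : ℝ), 0 < Ftil z)
    (hGpos : ∀ z ∈ (unitSphere n) ×ˢ Set.Ioi (0 : ℝ), 0 < Gtil z)
    (K₁ K₂ : Set (Es n))
    (hK₁c : IsCompact K₁) (hK₁conv : Convex ℝ K₁) (hK₁0 : (0 : Es n) ∈ interior K₁)
    (hK₂c : IsCompact K₂) (hK₂conv : Convex ℝ K₂) (hK₂int : (interior K₂).Nonempty)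
    (hsub : K₁ ⊆ K₂)
    -- the boundaries are strictly convex (they contain no line segment) …
    (hK₁seg : ∀ a b : Es n, a ≠ b → ¬ segment ℝ a b ⊆ frontier K₁)
    (hK₂seg : ∀ a b : Es n, a ≠ b → ¬ segment ℝ a b ⊆ frontier K₂)
    -- … and C¹ (the normal cone is a singleton at every boundary point), so that the
    -- Gauss image maps are single-valued, given by `α₁` and `α₂`:
    (hK₁C1 : ∀ x ∈ frontier K₁, ∃ ξ : Es n, normalCone K₁ x = {ξ})
    (hK₂C1 : ∀ x ∈ frontier K₂, ∃ ξ : Es n, normalCone K₂ x = {ξ})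
    (α₁ α₂ : Es n → Es n)
    (hα₁ : ∀ θ ∈ unitSphere n, normalCone K₁ ((radialFn K₁ θ) • θ) = {α₁ θ})
    (hα₂ : ∀ θ ∈ unitSphere n, normalCone K₂ ((radialFn K₂ θ) • θ) = {α₂ θ})
    (hsol₁ : ∀ ω : Set (Es n), ω ⊆ Uhat → MeasurableSet ω →
      sphMeasure n (α₁ '' ω) ≤ ∫⁻ θ in ω, ENNReal.ofReal
        (ftil θ * Ftil (θ, radialFn K₁ θ) / Gtil (α₁ θ, supportFn K₁ (α₁ θ)))
          ∂(sphMeasure n))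
    (hsol₂ : ∀ ω : Set (Es n), ω ⊆ Uhat → MeasurableSet ω →
      (∫⁻ θ in ω, ENNReal.ofReal
        (ftil θ * Ftil (θ, radialFn K₂ θ) / Gtil (α₂ θ, supportFn K₂ (α₂ θ)))
          ∂(sphMeasure n)) ≤ sphMeasure n (α₂ '' ω))
    (θ₀ : Es n) (hθ₀ : θ₀ ∈ Uhat) (heq : radialFn K₁ θ₀ = radialFn K₂ θ₀) :
    ∀ θ ∈ Uhat, radialFn K₁ θ = radialFn K₂ θ := by
  have hG₁ : IsGaussBody K₁ α₁ := ⟨hK₁c, hK₁conv, hK₁0, hK₁seg, hα₁⟩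
  have hG₂ : IsGaussBody K₂ α₂ := ⟨hK₂c, hK₂conv, interior_mono hsub hK₁0, hK₂seg, hα₂⟩
  have hle : ∀ x, halfSqGauge K₂ x ≤ halfSqGauge K₁ x := fun x => by
    have h1 := gauge_mono (absorbent_nhds_zero hG₁.mem_nhds) hsub x
    have h2 : 0 ≤ gauge K₂ x := gauge_nonneg x
    rw [halfSqGauge, halfSqGauge]
    gcongr
  have hcontact : ∀ θ ∈ Uhat,
      (halfSqGauge K₁ θ = halfSqGauge K₂ θ ↔ radialFn K₁ θ = radialFn K₂ θ) := fun θ hθ => by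
    have h0 := ne_zero_of_mem_unitSphere (hUsub hθ)
    rw [hG₁.radialFn_eq h0, hG₂.radialFn_eq h0, inv_inj, halfSqGauge, halfSqGauge,
      div_left_inj' two_ne_zero, sq_eq_sq₀ (gauge_nonneg _) (gauge_nonneg _)]
  have hcone : ∀ θ ∈ Uhat, θ ∈ coneOver Uhat := fun θ hθ =>
    ⟨ne_zero_of_mem_unitSphere (hUsub hθ), by
      rwa [norm_eq_one_of_mem_unitSphere (hUsub hθ), inv_one, one_smul]⟩
  have hcone0 : coneOver Uhat ⊆ {0}ᶜ := fun x hx => hx.1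
  obtain ⟨hUo, hUm⟩ : IsOpen (coneOver Uhat) ∧ MeasurableSet Uhat := by
    obtain ⟨O, hO, rfl⟩ := hUopen
    exact ⟨isOpen_coneOver hO, hO.measurableSet.inter Metric.isClosed_sphere.measurableSet⟩
  have hf : Measurable fun x : Es n => ftil (‖x‖⁻¹ • x) := hfm.comp (by fun_prop)
  have hfb' : ∀ x ∈ coneOver Uhat, lam ≤ ftil (‖x‖⁻¹ • x) ∧ ftil (‖x‖⁻¹ • x) ≤ Lam :=
    fun x hx => hfb _ (hUsub hx.2)
  have hEq := eqOn_of_monge_ampere (f := fun x => ftil (‖x‖⁻¹ • x))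
    (Hu := fun x => gaussDensity Ftil Gtil (x, halfSqGauge K₁ x, gradHalfSqGauge K₁ α₁ x))
    (Hv := fun x => gaussDensity Ftil Gtil (x, halfSqGauge K₂ x, gradHalfSqGauge K₂ α₂ x))
    (by rw [finrank_euclideanSpace_fin]; exact n.succ_pos)
    hG₁.isStrictSubgradientMap hG₁.continuous_gradHalfSqGauge
    hG₂.isStrictSubgradientMap hG₂.continuous_gradHalfSqGauge
    hUo (isPreconnected_coneOver hUsub hUconn.isPreconnected) (fun x _ => hle x) hf hlam
    (fun x hx => (hfb' x hx).1) (fun x hx => (hfb' x hx).2)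
    (fun A hA hm => (hG₁.volume_image_and_lintegral hFlip hGlip hGpos hfm hUm hUsub hA hm).1 hsol₁)
    (fun A hA hm => (hG₂.volume_image_and_lintegral hFlip hGlip hGpos hfm hUm hUsub hA hm).2 hsol₂)
    ((hG₁.continuousOn_gaussDensity hFlip hGlip hGpos).mono hcone0)
    ((hG₂.continuousOn_gaussDensity hFlip hGlip hGpos).mono hcone0)
    (fun x hx => hG₂.gaussDensity_pos hFpos hGpos (hcone0 hx))
    (fun x hx h => hG₁.exists_gaussDensity_le hG₂ hFlip hGlip hGpos hle (hcone0 hx) h)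
    (hcone θ₀ hθ₀) ((hcontact θ₀ hθ₀).2 heq)
  exact fun θ hθ => (hcontact θ hθ).1 (hEq (hcone θ hθ))
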